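/- arXiv:2208.12167 — 10 statements merged into one kernel-verified Lean document; each statement's English description precedes it below -/
import Mathlib

section
/- For any positive integer n, the permanent of the 2n×2n matrix M with entries M[j][k] = (x_j + x_k)/(x_j - x_k) for j ≠ k and M[j][j] = 1 equals (-4)^n · x_1·x_2···x_{2n} · Σ Π_{k=1}^n 1/(x_{i_k} - x_{j_k})^2, where the sum runs over all partitions of {1,...,2n} into n unordered pairs {i_k, j_k}. -/
open Equiv Finset

theorem permanent_option {α R : Type*} [Fintype α] [DecidableEq α] [CommRing R]
    (A : Matrix (Option α) (Option α) R) :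
    A.permanent = A none none * (A.submatrix some some).permanent +
      ∑ σ : Perm α, ∑ a, A (some (σ a)) none * A none (some a) *
        ∏ c ∈ univ.erase a, A (some (σ c)) (some c) := by
  rw [Matrix.permanent, ← Equiv.Perm.decomposeOption.symm.sum_comp, Fintype.sum_prod_type,
    Fintype.sum_option]
  congr 1
  · simp [Matrix.permanent, Fintype.prod_option, Finset.mul_sum]
  · rw [Finset.sum_comm]
    refine Finset.sum_congr rfl fun σ _ => ?_
    rw [← Equiv.sum_comp σ]
    refine Finset.sum_congr rfl fun a _ => ?_
    rw [Fintype.prod_option, ← Finset.mul_prod_erase univ _ (Finset.mem_univ a), ← mul_assoc]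
    congr 1
    · simp
    · refine Finset.prod_congr rfl fun c hc => ?_
      have : σ c ≠ σ a := by simpa using hc
      simp [Equiv.swap_apply_of_ne_of_ne, this]

theorem sum_fixing_eq_permanent {α R : Type*} [Fintype α] [DecidableEq α] [CommRing R]
    (A : Matrix α α R) (a : α) :
    ∑ σ : Perm α, (if σ a = a then ∏ c ∈ univ.erase a, A (σ c) c else 0) =
      (A.submatrix (Subtype.val : {c // c ≠ a} → α) Subtype.val).permanent := by
  rw [← Finset.sum_filter, Matrix.permanent]
  symm
  refine Finset.sum_bij (fun σ _ => Equiv.Perm.ofSubtype σ) ?_ ?_ ?_ ?_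
  · intro σ _
    simp [Equiv.Perm.ofSubtype_apply_of_not_mem]
  · intro σ _ τ _ h
    exact Equiv.Perm.ofSubtype_injective h
  · intro σ hσ
    have ha : σ a = a := by simpa using hσ
    have h : ∀ c, c ≠ a ↔ σ c ≠ a := fun c => by
      rw [not_iff_not]
      constructor
      · rintro rfl; exact ha
      · intro h; exact σ.injective (h.trans ha.symm)
    refine ⟨σ.subtypePerm (fun c => (h c).symm), mem_univ _, ?_⟩
    apply Equiv.Perm.ofSubtype_subtypePerm
    rintro c hc rfl
    exact hc ha
  · intro σ _
    rw [Finset.prod_subtype (univ.erase a) (p := fun c => c ≠ a) (F := inferInstance) (by simp)]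
    simp

theorem permanent_option_of_cocycle {α R : Type*} [Fintype α] [DecidableEq α] [CommRing R]
    (A : Matrix (Option α) (Option α) R) (hdiag : ∀ i, A i i = 1)
    (hanti : ∀ i j, i ≠ j → A j i = -A i j)
    (hcocycle : ∀ i j k, i ≠ j → j ≠ k → i ≠ k →
      A i j * A j k = A i k * (A i j + A j k) - 1) :
    A.permanent = (A.submatrix some some).permanent
      - ∑ σ : Perm α, ∑ a, ∏ c ∈ univ.erase a, A (some (σ c)) (some c)
      + ∑ a, (1 - A none (some a) ^ 2) *
        (A.submatrix (fun c : {c // c ≠ a} => some c.1) (fun c => some c.1)).permanent := by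
  have key (σ : Perm α) (a : α) : A (some (σ a)) none * A none (some a) *
        ∏ c ∈ univ.erase a, A (some (σ c)) (some c) =
      (A (some (σ a)) none - A (some a) none) * ∏ c, A (some (σ c)) (some c) -
        ∏ c ∈ univ.erase a, A (some (σ c)) (some c) +
        (1 - A none (some a) ^ 2) *
          if σ a = a then ∏ c ∈ univ.erase a, A (some (σ c)) (some c) else 0 := by
    rw [← Finset.mul_prod_erase univ _ (Finset.mem_univ a)]
    have h0 := hanti none (some a) (by simp)
    split_ifs with h
    · rw [h, hdiag, h0]; ring
    · rw [hcocycle (some (σ a)) none (some a) (by simp) (by simp) (by simpa using h), h0]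
      ring
  have htel (σ : Perm α) : ∑ a, (A (some (σ a)) none - A (some a) none) = 0 := by
    rw [Finset.sum_sub_distrib, Equiv.sum_comp σ (fun a => A (some a) none), sub_self]
  rw [permanent_option, hdiag, one_mul]
  simp_rw [key, Finset.sum_add_distrib, Finset.sum_sub_distrib, ← Finset.sum_mul, htel]
  rw [Finset.sum_comm (s := univ) (t := univ)
    (f := fun (σ : Perm α) a => (1 - A none (some a) ^ 2) * _)]
  simp_rw [← Finset.mul_sum]
  have := fun a => sum_fixing_eq_permanent (A.submatrix some some) a
  simp only [Matrix.submatrix_apply, Matrix.submatrix_submatrix] at this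
  simp_rw [this]
  simp [Function.comp_def]
  ring

/-- The permanent of the sub-array of `g` with rows and columns indexed by `S`. -/
def finsetPermanent {V R : Type*} [DecidableEq V] [CommRing R] (g : V → V → R)
    (S : Finset V) : R :=
  (Matrix.of fun i j : S => g i j).permanent

theorem permanent_eq_finsetPermanent {V R α : Type*} [DecidableEq V] [CommRing R]
    [Fintype α] [DecidableEq α] (g : V → V → R) (S : Finset V) (e : α ≃ S) :
    (Matrix.of fun i j : α => g (e i) (e j)).permanent = finsetPermanent g S := by
  simp only [finsetPermanent, Matrix.permanent, Matrix.of_apply]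
  rw [← e.permCongr.sum_comp]
  refine Finset.sum_congr rfl fun σ _ => ?_
  rw [← e.prod_comp]
  simp [Equiv.permCongr_apply]

theorem finsetPermanent_map {V W R : Type*} [DecidableEq V] [DecidableEq W] [CommRing R]
    (g : W → W → R) (e : V ↪ W) (S : Finset V) :
    finsetPermanent g (S.map e) = finsetPermanent (fun i j => g (e i) (e j)) S := by
  have he : Function.Bijective
      (fun i : S => (⟨e i, Finset.mem_map_of_mem e i.2⟩ : (S.map e : Finset W))) := by
    constructor
    · exact fun i j h => Subtype.ext (e.injective (congrArg Subtype.val h))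
    · rintro ⟨j, hj⟩
      obtain ⟨i, hi, rfl⟩ := Finset.mem_map.1 hj
      exact ⟨⟨i, hi⟩, rfl⟩
  rw [← permanent_eq_finsetPermanent g _ (Equiv.ofBijective _ he)]
  rfl

/-- A function with unit diagonal, antisymmetric off the diagonal, and satisfying the
addition law of the hyperbolic cotangent. -/
structure IsCothLike {V R : Type*} [CommRing R] (g : V → V → R) : Prop where
  diag : ∀ i, g i i = 1
  anti : ∀ i j, i ≠ j → g j i = -g i j
  add : ∀ i j k, i ≠ j → j ≠ k → i ≠ k → g i j * g j k = g i k * (g i j + g j k) - 1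

theorem IsCothLike.finsetPermanent_insert {V R : Type*} [DecidableEq V] [CommRing R]
    {g : V → V → R} (hg : IsCothLike g) {b : V} {T : Finset V} (hb : b ∉ T) :
    finsetPermanent g (insert b T) = finsetPermanent g T
      - ∑ σ : Perm T, ∑ a, ∏ c ∈ univ.erase a, g (σ c) c
      + ∑ a ∈ T, (1 - g b a ^ 2) * finsetPermanent g (T.erase a) := by
  let e : Option T ≃ (insert b T : Finset V) := (Finset.subtypeInsertEquivOption hb).symm
  have he0 : (e none : V) = b := rfl
  have he1 (c : T) : (e (some c) : V) = c := rfl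
  have hinj {i j : Option T} (h : i ≠ j) : (e i : V) ≠ e j := fun h' =>
    h (e.injective (Subtype.ext h'))
  rw [← permanent_eq_finsetPermanent g _ e, permanent_option_of_cocycle]
  · simp only [Matrix.submatrix, Matrix.of_apply, he0, he1]
    congr 1
    rw [← Finset.sum_coe_sort T]
    refine Finset.sum_congr rfl fun a _ => ?_
    let e' : {c : T // c ≠ a} ≃ (T.erase (a : V) : Finset V) :=
      { toFun := fun c => ⟨c.1, Finset.mem_erase.2 ⟨fun h => c.2 (Subtype.ext h), c.1.2⟩⟩
        invFun := fun c => ⟨⟨c, Finset.mem_of_mem_erase c.2⟩,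
          fun h => Finset.ne_of_mem_erase c.2 (congrArg Subtype.val h)⟩
        left_inv := fun _ => rfl
        right_inv := fun _ => rfl }
    rw [← permanent_eq_finsetPermanent g _ e']
    rfl
  · exact fun i => hg.diag _
  · exact fun i j h => hg.anti _ _ (hinj h)
  · exact fun i j k h₁ h₂ h₃ => hg.add _ _ _ (hinj h₁) (hinj h₂) (hinj h₃)


theorem permanent_sign_eq_zero {R : Type*} [Field R] [CharZero R] {m : ℕ} (hm : Odd m) :
    (Matrix.of fun i j : Fin (m + 1) => if i ≤ j then (1 : R) else -1).permanent = 0 := by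
  set K := Matrix.of fun i j : Fin (m + 1) => if i ≤ j then (1 : R) else -1 with hK
  have h : (K.transpose.submatrix id (finRotate (m + 1))).permanent = -K.permanent := by
    rw [Matrix.permanent, Matrix.permanent, ← Finset.sum_neg_distrib]
    refine Finset.sum_congr rfl fun σ _ => ?_
    have h₁ (i : Fin m) : (K.transpose.submatrix id (finRotate (m + 1))) (σ i.castSucc)
        i.castSucc = -K (σ i.castSucc) i.castSucc := by
      generalize σ i.castSucc = k
      simp only [hK, Matrix.submatrix_apply, Matrix.transpose_apply, Matrix.of_apply, id,
        finRotate_apply, Fin.coeSucc_eq_succ, Fin.le_def, Fin.val_castSucc, Fin.val_succ]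
      split_ifs <;> first | omega | simp
    have h₂ : (K.transpose.submatrix id (finRotate (m + 1))) (σ (Fin.last m)) (Fin.last m) =
        K (σ (Fin.last m)) (Fin.last m) := by
      simp [hK, Fin.le_last]
    rw [Fin.prod_univ_castSucc, Fin.prod_univ_castSucc, h₂, Finset.prod_congr rfl fun i _ => h₁ i,
      Finset.prod_neg, Finset.card_univ, Fintype.card_fin, hm.neg_one_pow]
    ring
  rw [Matrix.permanent_permute_rows, Matrix.permanent_transpose] at h
  linear_combination h / 2

/-- Adjoin to `f` a sequence of points at infinity, each one larger than all its
predecessors. -/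
def extendAtInfinity {V R : Type*} [CommRing R] (f : V → V → R) : V ⊕ ℕ → V ⊕ ℕ → R
  | .inl i, .inl j => f i j
  | .inl _, .inr _ => 1
  | .inr _, .inl _ => -1
  | .inr i, .inr j => if i ≤ j then 1 else -1

theorem IsCothLike.extend {V R : Type*} [CommRing R] {f : V → V → R}
    (hf : IsCothLike f) : IsCothLike (extendAtInfinity f) where
  diag := by
    rintro (i | i)
    · exact hf.diag i
    · simp [extendAtInfinity]
  anti := by
    rintro (i | i) (j | j) h <;> simp only [extendAtInfinity]
    · exact hf.anti i j (by simpa using h)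
    · simp
    · have : i ≠ j := by simpa using h
      split_ifs <;> first | omega | simp
  add := by
    rintro (i | i) (j | j) (k | k) h₁ h₂ h₃ <;>
      simp only [extendAtInfinity, ne_eq, Sum.inl.injEq, Sum.inr.injEq] at h₁ h₂ h₃ ⊢
    · exact hf.add i j k h₁ h₂ h₃
    · ring
    · ring
    · split_ifs <;> ring
    · ring
    · split_ifs <;> ring
    · split_ifs <;> ring
    · split_ifs <;> first | omega | ring

theorem IsCothLike.finsetPermanent_insert_add_fresh {V R : Type*} [DecidableEq V] [CommRing R]
    {f : V → V → R} (hf : IsCothLike f) {T : Finset (V ⊕ ℕ)} {b : V ⊕ ℕ} (hb : b ∉ T)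
    {m : ℕ} (hm : .inr m ∉ T) :
    finsetPermanent (extendAtInfinity f) (insert b T) =
      finsetPermanent (extendAtInfinity f) (insert (.inr m) T) +
      ∑ a ∈ T, (1 - extendAtInfinity f b a ^ 2) *
        finsetPermanent (extendAtInfinity f) (T.erase a) := by
  have h : ∑ a ∈ T, (1 - extendAtInfinity f (.inr m) a ^ 2) *
        finsetPermanent (extendAtInfinity f) (T.erase a) = 0 := by
    refine Finset.sum_eq_zero ?_
    rintro (a | a) -
    · simp [extendAtInfinity]
    · simp only [extendAtInfinity]
      split_ifs <;> simp
  rw [hf.extend.finsetPermanent_insert hb, hf.extend.finsetPermanent_insert hm,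
    h]
  ring

theorem exists_inr_notMem {V : Type*} (T : Finset (V ⊕ ℕ)) : ∃ m : ℕ, .inr m ∉ T := by
  obtain ⟨m, hm⟩ := Infinite.exists_notMem_finset T.toRight
  exact ⟨m, by simpa using hm⟩

theorem IsCothLike.finsetPermanent_eq_zero {V R : Type*} [DecidableEq V] [Field R] [CharZero R]
    {f : V → V → R} (hf : IsCothLike f) (S : Finset (V ⊕ ℕ)) (hS : Even #S)
    (hS' : S.toRight.Nonempty) : finsetPermanent (extendAtInfinity f) S = 0 := by
  induction hN : #S.toLeft using Nat.strong_induction_on generalizing S with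
  | _ N ih =>
  obtain hl | ⟨b, hb⟩ := S.toLeft.eq_empty_or_nonempty
  · obtain ⟨m, hm⟩ : ∃ m, #S.toRight = m + 1 :=
      Nat.exists_eq_succ_of_ne_zero (Finset.card_ne_zero.2 hS')
    have hmap : S.toRight.map .inr = S := by
      ext (i | i)
      · have : i ∉ S.toLeft := by simp [hl]
        simpa using this
      · simp
    have hodd : Odd m := by
      rw [← hmap, Finset.card_map, hm] at hS
      exact Nat.not_even_iff_odd.1 (Nat.even_add_one.1 hS)
    have heq : finsetPermanent (extendAtInfinity f) (S.toRight.map .inr) = 0 := by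
      rw [finsetPermanent_map, ← permanent_eq_finsetPermanent _ _
        (S.toRight.orderIsoOfFin hm).toEquiv, ← permanent_sign_eq_zero (R := R) hodd]
      congr 1
      ext i j
      simp [extendAtInfinity]
    rwa [hmap] at heq
  · have hbS : .inl b ∈ S := by simpa using hb
    obtain ⟨T, hbT, rfl⟩ : ∃ T : Finset (V ⊕ ℕ), .inl b ∉ T ∧ insert (.inl b) T = S :=
      ⟨S.erase (.inl b), by simp, Finset.insert_erase hbS⟩
    obtain ⟨m, hm⟩ := exists_inr_notMem T
    have hbl : b ∉ T.toLeft := by simpa using hbT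
    have hcard : #T.toLeft < N := by
      rw [← hN, Finset.toLeft_insert_inl, Finset.card_insert_of_notMem hbl]
      exact Nat.lt_succ_self _
    rw [Finset.card_insert_of_notMem hbT] at hS
    rw [Finset.toRight_insert_inl] at hS'
    rw [hf.finsetPermanent_insert_add_fresh hbT hm]
    rw [ih _ (by simpa using hcard) (insert (.inr m) T) (by rwa [Finset.card_insert_of_notMem hm])
      (by simp) rfl, zero_add]
    refine Finset.sum_eq_zero ?_
    rintro (a | a) ha
    · rw [ih _ ?_ (T.erase (.inl a)) ?_ ?_ rfl, mul_zero]
      · exact (Finset.card_le_card (Finset.toLeft_subset_toLeft (Finset.erase_subset _ _))).trans_lt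
          hcard
      · rw [← Finset.card_erase_add_one ha] at hS
        simpa [add_assoc, Nat.even_add] using hS
      · obtain ⟨c, hc⟩ := hS'
        exact ⟨c, by simpa using hc⟩
    · simp [extendAtInfinity]

theorem IsCothLike.finsetPermanent_insert_of_odd {V R : Type*} [DecidableEq V] [Field R]
    [CharZero R] {f : V → V → R} (hf : IsCothLike f) {b : V} {T : Finset V} (hb : b ∉ T)
    (hT : Odd #T) :
    finsetPermanent f (insert b T) = ∑ a ∈ T, (1 - f b a ^ 2) * finsetPermanent f (T.erase a) := by
  have hmap (S : Finset V) : finsetPermanent (extendAtInfinity f) (S.map .inl) =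
      finsetPermanent f S :=
    finsetPermanent_map _ _ _
  obtain ⟨m, hm⟩ := exists_inr_notMem (T.map (.inl : V ↪ V ⊕ ℕ))
  rw [← hmap, Finset.map_insert, Function.Embedding.inl_apply,
    hf.finsetPermanent_insert_add_fresh (by simpa using hb) hm,
    hf.finsetPermanent_eq_zero (insert (.inr m) (T.map .inl)) ?_ (by simp), zero_add,
    Finset.sum_map]
  · refine Finset.sum_congr rfl fun a _ => ?_
    rw [← hmap, Finset.map_erase]
    rfl
  · rw [Finset.card_insert_of_notMem hm, Finset.card_map]
    exact hT.add_one

/-- The sum over the perfect matchings of `S`, encoded as involutions moving exactly the points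
of `S`, of the products of the weights `w` of the matched pairs. -/
def matchingSum {V R : Type*} [Fintype V] [LinearOrder V] [CommRing R] (w : V → V → R)
    (S : Finset V) : R :=
  ∑ τ ∈ univ.filter (fun τ : Perm V => τ * τ = 1 ∧ ∀ j, τ j ≠ j ↔ j ∈ S),
    ∏ j ∈ univ.filter (fun j => j < τ j), w j (τ j)

theorem prod_swap_mul {V R : Type*} [Fintype V] [LinearOrder V] [CommRing R] {w : V → V → R}
    (hw : ∀ i j, w i j = w j i) {τ : Perm V} {a b : V} (hab : a ≠ b) (ha : τ a = a) (hb : τ b = b) :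
    ∏ j ∈ univ.filter (fun j => j < (swap b a * τ) j), w j ((swap b a * τ) j) =
      w b a * ∏ j ∈ univ.filter (fun j => j < τ j), w j (τ j) := by
  have hother {j : V} (hja : j ≠ a) (hjb : j ≠ b) : (swap b a * τ) j = τ j := by
    rw [Perm.mul_apply]
    apply swap_apply_of_ne_of_ne
    · intro h
      exact hjb (τ.injective (h.trans hb.symm))
    · intro h
      exact hja (τ.injective (h.trans ha.symm))
  have ha' : (swap b a * τ) a = b := by simp [ha]
  have hb' : (swap b a * τ) b = a := by simp [hb]
  rw [Finset.prod_filter, Finset.prod_filter,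
    ← Finset.mul_prod_erase univ _ (Finset.mem_univ a),
    ← Finset.mul_prod_erase (univ.erase a) _ (Finset.mem_erase.2 ⟨hab.symm, Finset.mem_univ b⟩),
    ← Finset.mul_prod_erase univ (fun j => if j < τ j then _ else _) (Finset.mem_univ a),
    ← Finset.mul_prod_erase (univ.erase a) (fun j => if j < τ j then _ else _)
      (Finset.mem_erase.2 ⟨hab.symm, Finset.mem_univ b⟩), ha', hb', ha, hb, ← mul_assoc]
  simp only [lt_irrefl, if_false, one_mul]
  congr 1
  · obtain h | h := hab.lt_or_gt
    · simp [h, h.not_gt, hw a b]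
    · simp [h, h.not_gt]
  · refine Finset.prod_congr rfl fun j hj => ?_
    simp only [Finset.mem_erase] at hj
    rw [hother hj.2.1 hj.1]

theorem matchingSum_empty {V R : Type*} [Fintype V] [LinearOrder V] [CommRing R]
    (w : V → V → R) : matchingSum w ∅ = 1 := by
  have : univ.filter (fun τ : Perm V => τ * τ = 1 ∧ ∀ j, τ j ≠ j ↔ j ∈ (∅ : Finset V)) = {1} := by
    ext τ
    simp only [Finset.mem_filter, Finset.mem_univ, true_and, Finset.notMem_empty, iff_false,
      not_not, Finset.mem_singleton]
    constructor
    · rintro ⟨-, h⟩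
      exact Equiv.ext h
    · rintro rfl
      simp
  rw [matchingSum, this]
  simp

theorem matchingSum_insert {V R : Type*} [Fintype V] [LinearOrder V] [CommRing R] {w : V → V → R}
    (hw : ∀ i j, w i j = w j i) {b : V} {T : Finset V} (hb : b ∉ T) :
    matchingSum w (insert b T) = ∑ a ∈ T, w b a * matchingSum w (T.erase a) := by
  rw [matchingSum, ← Finset.sum_fiberwise_of_maps_to (t := T) (g := fun τ : Perm V => τ b)]
  · refine Finset.sum_congr rfl fun a ha => ?_
    have hab : a ≠ b := by rintro rfl; exact hb ha
    rw [matchingSum, Finset.mul_sum, Finset.filter_filter]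
    refine Finset.sum_bij' (fun τ _ => swap b a * τ) (fun τ _ => swap b a * τ) ?_ ?_ ?_ ?_ ?_
    · intro τ hτ
      simp only [Finset.mem_filter, Finset.mem_univ, true_and, Equiv.ext_iff, Perm.mul_apply,
        Perm.one_apply, swap_apply_def, Finset.mem_insert, Finset.mem_erase] at hτ ⊢
      grind
    · intro τ hτ
      simp only [Finset.mem_filter, Finset.mem_univ, true_and, Equiv.ext_iff, Perm.mul_apply,
        Perm.one_apply, swap_apply_def, Finset.mem_insert, Finset.mem_erase] at hτ ⊢
      grind
    · simp [← mul_assoc]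
    · simp [← mul_assoc]
    · intro τ hτ
      simp only [Finset.mem_filter, Finset.mem_univ, true_and] at hτ
      obtain ⟨⟨h₁, h₂⟩, h₃⟩ := hτ
      have h₄ : τ a = b := by rw [← h₃, ← Perm.mul_apply, h₁, Perm.one_apply]
      rw [← prod_swap_mul hw hab (by simp [h₄]) (by simp [h₃]), ← mul_assoc, swap_mul_self, one_mul]
  · intro τ hτ
    simp only [Finset.mem_filter, Finset.mem_univ, true_and] at hτ
    obtain ⟨h₁, h₂⟩ := hτ
    have hb' : τ b ≠ b := (h₂ b).2 (Finset.mem_insert_self _ _)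
    have : τ b ∈ insert b T := (h₂ _).1 (fun h => hb' (τ.injective h))
    exact Finset.mem_of_mem_insert_of_ne this hb'

theorem isCothLike_ratio {V F : Type*} [DecidableEq V] [Field F] {x : V → F}
    (hx : Function.Injective x) :
    IsCothLike fun j k => if j = k then (1 : F) else (x j + x k) / (x j - x k) where
  diag := by simp
  anti i j h := by
    have h₁ : x i - x j ≠ 0 := sub_ne_zero.2 (hx.ne h)
    have h₂ : x j - x i ≠ 0 := sub_ne_zero.2 (hx.ne h.symm)
    simp only [h, h.symm, if_false]
    field_simp
    ring
  add i j k h₁ h₂ h₃ := by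
    have h₁' : x i - x j ≠ 0 := sub_ne_zero.2 (hx.ne h₁)
    have h₂' : x j - x k ≠ 0 := sub_ne_zero.2 (hx.ne h₂)
    have h₃' : x i - x k ≠ 0 := sub_ne_zero.2 (hx.ne h₃)
    simp only [h₁, h₂, h₃, if_false]
    field_simp
    ring

theorem finsetPermanent_ratio_eq {V F : Type*} [Fintype V] [LinearOrder V] [Field F] [CharZero F]
    {x : V → F} (hx : Function.Injective x) (n : ℕ) (S : Finset V) (hS : #S = 2 * n) :
    finsetPermanent (fun j k => if j = k then (1 : F) else (x j + x k) / (x j - x k)) S =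
      (-4) ^ n * (∏ j ∈ S, x j) * matchingSum (fun j k => ((x j - x k) ^ 2)⁻¹) S := by
  induction n generalizing S with
  | zero =>
    obtain rfl : S = ∅ := by simpa using hS
    simp [matchingSum_empty, finsetPermanent, Matrix.permanent_isEmpty]
  | succ n ih =>
    obtain ⟨b, T, hb, rfl, hT⟩ := Finset.card_eq_succ.1 (hS.trans (by ring : _ = 2 * n + 1 + 1))
    rw [(isCothLike_ratio hx).finsetPermanent_insert_of_odd hb ⟨n, hT⟩,
      matchingSum_insert (fun i j => by rw [← neg_sub, neg_sq]) hb, Finset.prod_insert hb,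
      Finset.mul_sum]
    refine Finset.sum_congr rfl fun a ha => ?_
    have hba : b ≠ a := by rintro rfl; exact hb ha
    have h : x b - x a ≠ 0 := sub_ne_zero.2 (hx.ne hba)
    rw [ih _ (by rw [Finset.card_erase_of_mem ha, hT, Nat.add_sub_cancel]),
      ← Finset.mul_prod_erase T _ ha]
    simp only [hba, if_false]
    field_simp
    ring

/- For pairwise distinct `x_1, …, x_{2n}` in a field of characteristic zero, the permanent of
the `2n × 2n` matrix with entries `(x_j + x_k)/(x_j - x_k)` off the diagonal and `1` on the
diagonal equals `(-4)^n x_1 ⋯ x_{2n} ∑ ∏_{k=1}^n 1/(x_{i_k} - x_{j_k})^2`, the sum running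
over all partitions of `{1, …, 2n}` into `n` unordered pairs `{i_k, j_k}`; such partitions
are encoded by fixed-point-free involutions `τ`, the pairs being `{j, τ j}` with `j < τ j`. -/
open scoped Classical in
theorem permanent_ratio_matrix_eq {F : Type*} [Field F] [CharZero F]
    (n : ℕ) (hn : 0 < n) (x : Fin (2 * n) → F) (hx : Function.Injective x) :
    Matrix.permanent (Matrix.of fun j k : Fin (2 * n) =>
        if j = k then (1 : F) else (x j + x k) / (x j - x k)) =
      (-4) ^ n * (∏ j, x j) *
        ∑ τ ∈ univ.filter (fun τ : Perm (Fin (2 * n)) => τ * τ = 1 ∧ ∀ j, τ j ≠ j),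
          ∏ j ∈ univ.filter (fun j => j < τ j), ((x j - x (τ j)) ^ 2)⁻¹ := by
  have h := finsetPermanent_ratio_eq hx n univ (by simp)
  rw [← permanent_eq_finsetPermanent _ _ (Equiv.subtypeUnivEquiv Finset.mem_univ).symm] at h
  simp only [matchingSum, Finset.mem_univ, iff_true] at h
  convert h
  all_goals rfl
end

section
/- For any positive integer n, if one of the variables x_1,...,x_{2n} equals zero, then Σ_{τ ∈ S_{2n}} Π_{j: τ(j)≠j} (x_j + x_{τ(j)})/(x_j - x_{τ(j)}) = 0, where an empty product equals 1. -/
open Equiv Finset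

namespace PermRatio

open Polynomial

variable {ι F : Type*} [DecidableEq ι] [Field F]

/-- The ratio `(x_i + x_j) / (x_i - x_j)`. -/
def ratio (x : ι → F) (i j : ι) : F := (x i + x j) / (x i - x j)

/-- The matrix entry `X + 1` on the diagonal and `X + (x_i + x_j) / (x_i - x_j)` off it. -/
noncomputable def entry (x : ι → F) (i j : ι) : F[X] :=
  X + C (if i = j then 1 else ratio x i j)

lemma entry_mul_entry {x : ι → F} (hx : Function.Injective x) {z j l : ι}
    (hj : j ≠ z) (hl : l ≠ z) :
    entry x z l * entry x j z = (X ^ 2 - 1) + entry x j l * C (ratio x j z - ratio x l z) +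
      if l = j then C (1 - ratio x j z ^ 2) else 0 := by
  have hjz : x j - x z ≠ 0 := sub_ne_zero.2 (hx.ne hj)
  have hlz : x l - x z ≠ 0 := sub_ne_zero.2 (hx.ne hl)
  have hneg : ratio x z l = -ratio x l z := by
    unfold ratio
    rw [← neg_sub (x l) (x z), div_neg, add_comm]
  rcases eq_or_ne l j with rfl | h
  · simp only [entry, if_neg hj, if_neg hj.symm, hneg, if_true, C_neg, C_sub, C_pow, C_1]
    ring
  · have hjl : x j - x l ≠ 0 := sub_ne_zero.2 (hx.ne h.symm)
    have key : ratio x j z * ratio x l z = 1 - ratio x j l * (ratio x j z - ratio x l z) := by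
      unfold ratio
      field_simp
      ring
    have key' := congrArg (C : F → F[X]) key
    simp only [C_mul, C_sub, C_1] at key'
    simp only [entry, if_neg hj, if_neg hl.symm, if_neg h, if_neg h.symm, hneg, C_neg, C_sub]
    linear_combination -key'

variable [Fintype ι]

/-- The permanent of the submatrix of `entry x` indexed by `S`. -/
noncomputable def perm (x : ι → F) (S : Finset ι) : F[X] :=
  ∑ σ : Perm ι with σ.support ⊆ S, ∏ k ∈ S, entry x k (σ k)

lemma derivative_perm (x : ι → F) (S : Finset ι) :
    derivative (perm x S) =
      ∑ σ : Perm ι with σ.support ⊆ S, ∑ j ∈ S, ∏ k ∈ S.erase j, entry x k (σ k) := by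
  simp [perm, derivative_prod_finset, entry]

lemma perm_insert_expand (x : ι → F) {S : Finset ι} {z : ι} (hz : z ∉ S) :
    perm x (insert z S) = ∑ σ : Perm ι with σ.support ⊆ S,
      (entry x z z * ∏ k ∈ S, entry x k (σ k) +
        ∑ j ∈ S, entry x z (σ j) * entry x j z * ∏ k ∈ S.erase j, entry x k (σ k)) := by
  have fix {σ : Perm ι} (hσ : σ.support ⊆ S) : σ z = z := by
    by_contra h
    exact hz (hσ (Perm.mem_support.2 h))
  have hsum : perm x (insert z S) =
      ∑ p ∈ ({σ : Perm ι | σ.support ⊆ S} : Finset _) ×ˢ insert z S,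
        ∏ k ∈ insert z S, entry x k ((p.1 * swap z p.2) k) := by
    refine Finset.sum_bij' (fun τ _ => (τ * swap z (τ⁻¹ z), τ⁻¹ z))
      (fun p _ => p.1 * swap z p.2) ?_ ?_ ?_ ?_ ?_
    · intro τ hτ
      simp only [mem_filter, mem_univ, true_and, mem_product] at hτ ⊢
      have hmem : τ⁻¹ z ∈ insert z S := by
        by_contra h
        have h1 : τ (τ⁻¹ z) = τ⁻¹ z := by
          by_contra h2
          exact h (hτ (Perm.mem_support.2 h2))
        rw [Perm.coe_inv, Equiv.apply_symm_apply] at h1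
        exact h (h1 ▸ mem_insert_self _ _)
      refine ⟨fun k hk => ?_, hmem⟩
      rw [Perm.mem_support, Perm.mul_apply] at hk
      have hkz : k ≠ z := by
        rintro rfl
        simp at hk
      by_cases hk' : k = τ⁻¹ z
      · rw [← hk'] at hmem
        exact (mem_insert.1 hmem).resolve_left hkz
      · rw [swap_apply_of_ne_of_ne hkz hk'] at hk
        exact (mem_insert.1 (hτ (Perm.mem_support.2 hk))).resolve_left hkz
    · rintro ⟨σ, j⟩ hp
      simp only [mem_filter, mem_univ, true_and, mem_product] at hp ⊢
      intro k hk
      rw [Perm.mem_support, Perm.mul_apply] at hk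
      by_cases hkz : k = z
      · exact hkz ▸ mem_insert_self _ _
      by_cases hkj : k = j
      · exact hkj ▸ hp.2
      rw [swap_apply_of_ne_of_ne hkz hkj] at hk
      exact mem_insert_of_mem (hp.1 (Perm.mem_support.2 hk))
    · intro τ _
      simp [mul_assoc]
    · rintro ⟨σ, j⟩ hp
      simp only [mem_filter, mem_univ, true_and, mem_product] at hp
      have h1 : (σ * swap z j)⁻¹ z = j := by
        rw [Perm.inv_eq_iff_eq, Perm.mul_apply, swap_apply_right, fix hp.1]
      simp only [h1, mul_assoc, swap_mul_self, mul_one]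
    · intro τ _
      simp [mul_assoc]
  rw [hsum, sum_product]
  refine sum_congr rfl fun σ hσ => ?_
  have hσz := fix (mem_filter.1 hσ).2
  rw [sum_insert hz]
  congr 1
  · simp [prod_insert hz, hσz]
  · refine sum_congr rfl fun j hj => ?_
    have hjz : j ≠ z := ne_of_mem_of_not_mem hj hz
    rw [prod_insert hz, ← mul_prod_erase S _ hj, mul_assoc]
    simp only [Perm.mul_apply, swap_apply_left, swap_apply_right, hσz]
    congr 2
    refine prod_congr rfl fun k hk => ?_
    rw [swap_apply_of_ne_of_ne (ne_of_mem_of_not_mem (mem_of_mem_erase hk) hz) (ne_of_mem_erase hk)]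

lemma perm_insert {x : ι → F} (hx : Function.Injective x) {S : Finset ι} {z : ι} (hz : z ∉ S) :
    perm x (insert z S) = (1 + X) * perm x S + (X ^ 2 - 1) * derivative (perm x S) +
      ∑ j ∈ S, C (1 - ratio x j z ^ 2) * perm x (S.erase j) := by
  have herase : ∑ j ∈ S, C (1 - ratio x j z ^ 2) * perm x (S.erase j) =
      ∑ σ : Perm ι with σ.support ⊆ S, ∑ j ∈ S,
        (if σ j = j then C (1 - ratio x j z ^ 2) else 0) *
          ∏ k ∈ S.erase j, entry x k (σ k) := by
    rw [sum_comm]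
    refine sum_congr rfl fun j _ => ?_
    simp only [ite_mul, zero_mul]
    rw [← sum_filter, filter_filter, perm, mul_sum]
    refine sum_congr (filter_congr fun σ _ => ?_) fun _ _ => rfl
    rw [subset_erase, Perm.notMem_support]
  rw [perm_insert_expand x hz, derivative_perm, herase, perm, mul_sum, mul_sum,
    ← sum_add_distrib, ← sum_add_distrib]
  refine sum_congr rfl fun σ hσ => ?_
  have hσ' := (mem_filter.1 hσ).2
  have htel : ∑ j ∈ S, (ratio x j z - ratio x (σ j) z) = 0 := by
    rw [sum_sub_distrib, sub_eq_zero]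
    exact (Perm.sum_comp σ S (fun j => ratio x j z)
      fun k hk => hσ' (Perm.mem_support.2 hk)).symm
  have hterm : ∀ j ∈ S,
      entry x z (σ j) * entry x j z * ∏ k ∈ S.erase j, entry x k (σ k) =
        (X ^ 2 - 1) * ∏ k ∈ S.erase j, entry x k (σ k) +
        (∏ k ∈ S, entry x k (σ k)) * C (ratio x j z - ratio x (σ j) z) +
        (if σ j = j then C (1 - ratio x j z ^ 2) else 0) *
          ∏ k ∈ S.erase j, entry x k (σ k) := by
    intro j hj
    have hσj : σ j ∈ S := by
      by_cases h : σ j = j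
      · rwa [h]
      · exact hσ' (Perm.apply_mem_support.2 (Perm.mem_support.2 h))
    rw [entry_mul_entry hx (ne_of_mem_of_not_mem hj hz) (ne_of_mem_of_not_mem hσj hz),
      ← mul_prod_erase S _ hj]
    ring
  rw [sum_congr rfl hterm, sum_add_distrib, sum_add_distrib, ← mul_sum, ← mul_sum,
    ← map_sum, htel]
  simp only [entry, if_true, C_0, C_1]
  ring

lemma perm_singleton (x : ι → F) (o : ι) : perm x {o} = 1 + X := by
  have h : perm x {o} = perm x (insert o ∅) := rfl
  rw [h, perm_insert_expand x (notMem_empty o)]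
  simp [Perm.support_eq_empty_iff, filter_eq', entry, add_comm]

/-- If `x` vanishes at `o ∈ S`, then `perm x S` is `1 + X` times a polynomial which is even or odd
according to the parity of `#S - 1`. -/
lemma exists_perm_eq {x : ι → F} (hx : Function.Injective x) {o : ι} (ho : x o = 0) (m : ℕ) :
    ∀ S : Finset ι, o ∈ S → #S = m + 1 →
      ∃ E : F[X], perm x S = (1 + X) * E ∧ E.comp (-X) = (-1) ^ m * E := by
  induction m using Nat.strong_induction_on with
  | _ m ih =>
  intro S hoS hcard
  rcases m with _ | m
  · obtain rfl : S = {o} := by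
      obtain ⟨a, rfl⟩ := card_eq_one.1 hcard
      rw [mem_singleton.1 hoS]
    exact ⟨1, by rw [perm_singleton, mul_one], by simp⟩
  obtain ⟨z, hzS, hzo⟩ := exists_mem_ne (by omega : 1 < #S) o
  obtain ⟨T, hzT, rfl⟩ : ∃ T, z ∉ T ∧ S = insert z T :=
    ⟨S.erase z, notMem_erase _ _, (insert_erase hzS).symm⟩
  have hoT : o ∈ T := (mem_insert.1 hoS).resolve_left hzo.symm
  have hT : #T = m + 1 := by
    rw [card_insert_of_notMem hzT] at hcard
    omega
  have hratio : ratio x o z = -1 := by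
    have : x z ≠ 0 := ho ▸ hx.ne hzo
    rw [ratio, ho, zero_add, zero_sub, div_neg, div_self this]
  obtain ⟨E, hE, hEp⟩ := ih m (by omega) T hoT hT
  have hsmall : ∀ j, ∃ D : F[X], j ∈ T →
      C (1 - ratio x j z ^ 2) * perm x (T.erase j) = (1 + X) * D ∧
        D.comp (-X) = (-1) ^ (m + 1) * D := by
    intro j
    by_cases hj : j ∈ T
    swap
    · exact ⟨0, fun h => absurd h hj⟩
    rcases eq_or_ne j o with rfl | hjo
    · exact ⟨0, fun _ => by simp [hratio]⟩
    have hTj : 1 < #T := one_lt_card.2 ⟨j, hj, o, hoT, hjo⟩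
    obtain ⟨r, rfl⟩ : ∃ r, m = r + 1 := ⟨m - 1, by omega⟩
    obtain ⟨D, hD, hDp⟩ := ih r (by omega) (T.erase j) (mem_erase.2 ⟨hjo.symm, hoT⟩)
      (by rw [card_erase_of_mem hj]; omega)
    refine ⟨C (1 - ratio x j z ^ 2) * D, fun _ => ⟨by rw [hD]; ring, ?_⟩⟩
    rw [mul_comp, C_comp, hDp]
    ring
  choose D hD using hsmall
  have hder : (derivative E).comp (-X) = (-1) ^ (m + 1) * derivative E := by
    have h := congrArg derivative hEp
    have hc : ((-1) ^ m : F[X]) = C ((-1) ^ m) := by simp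
    rw [derivative_comp, hc, derivative_C_mul, ← hc] at h
    simp only [derivative_neg, derivative_X] at h
    linear_combination -h
  refine ⟨2 * X * E + (X ^ 2 - 1) * derivative E + ∑ j ∈ T, D j, ?_, ?_⟩
  · rw [perm_insert hx hzT, sum_congr rfl fun j hj => (hD j hj).1, ← mul_sum, hE]
    simp only [derivative_mul, derivative_add, derivative_one, derivative_X]
    ring
  · have hsum : (∑ j ∈ T, D j).comp (-X) = (-1) ^ (m + 1) * ∑ j ∈ T, D j := by
      rw [Polynomial.sum_comp, mul_sum]
      exact sum_congr rfl fun j hj => (hD j hj).2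
    simp only [add_comp, mul_comp, sub_comp, pow_comp, X_comp, one_comp, ofNat_comp, hsum, hder,
      hEp]
    ring

lemma eval_zero_perm_univ (x : ι → F) :
    (perm x univ).eval 0 =
      ∑ τ : Perm ι, ∏ j ∈ τ.support, (x j + x (τ j)) / (x j - x (τ j)) := by
  simp only [perm, subset_univ, filter_true, eval_finsetSum, eval_prod]
  refine sum_congr rfl fun τ _ => ?_
  rw [← prod_subset (subset_univ τ.support)]
  · refine prod_congr rfl fun j hj => ?_
    simp [entry, ratio, (Perm.mem_support.1 hj).symm]
  · intro j _ hj
    simp [entry, Perm.notMem_support.1 hj]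

end PermRatio

/- If one of pairwise distinct `x_1, …, x_{2n}` is zero, then
`∑_{τ ∈ S_{2n}} ∏_{j : τ(j) ≠ j} (x_j + x_{τ(j)})/(x_j - x_{τ(j)}) = 0`. -/
theorem sum_perm_prod_ratio_eq_zero {F : Type*} [Field F] [CharZero F]
    (n : ℕ) (hn : 0 < n) (x : Fin (2 * n) → F) (hx : Function.Injective x)
    (h0 : ∃ i, x i = 0) :
    ∑ τ : Perm (Fin (2 * n)),
      ∏ j ∈ τ.support, (x j + x (τ j)) / (x j - x (τ j)) = 0 := by
  obtain ⟨o, ho⟩ := h0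
  obtain ⟨E, hE, hEp⟩ := PermRatio.exists_perm_eq hx ho (2 * n - 1) univ (mem_univ o)
    (by rw [card_univ, Fintype.card_fin]; omega)
  rw [← PermRatio.eval_zero_perm_univ, hE]
  have hodd : Odd (2 * n - 1) := ⟨n - 1, by omega⟩
  have h := congrArg (Polynomial.eval 0) hEp
  rw [hodd.neg_one_pow] at h
  simp only [Polynomial.eval_comp, Polynomial.eval_neg, Polynomial.eval_X, neg_zero,
    neg_mul, one_mul] at h
  simp [self_eq_neg.1 h]
end

section
/- For any integer n > 1, the sum over all 2n-cycles τ in S_{2n} of Π_{j=1}^{2n} (x_j + x_{τ(j)})/(x_j - x_{τ(j)}) is a constant rational function, i.e., it does not depend on any of the variables x_1,...,x_{2n}. -/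
open Equiv Finset

namespace CycleSum

/-- Points in the same cycle are related by any equivalence relation that relates each point to
its image. -/
lemma rel_of_sameCycle {α : Type*} {r : α → α → Prop} (hr : Equivalence r) {f : Perm α}
    (h : ∀ x, r x (f x)) {x y : α} (hxy : f.SameCycle x y) : r x y := by
  obtain ⟨k, rfl⟩ := hxy
  induction k with
  | zero => exact hr.refl x
  | succ k ih =>
    rw [add_comm, zpow_one_add, Perm.mul_apply]
    exact hr.trans ih (h _)
  | pred k ih =>
    refine hr.trans ih (hr.symm ?_)
    have := h ((f ^ (-(k : ℤ) - 1)) x)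
    rwa [← Perm.mul_apply, ← zpow_one_add, add_sub_cancel] at this

/-- The permutation acts transitively, i.e. it is a single cycle through all points. -/
def IsFullCycle {α : Type*} (f : Perm α) : Prop := ∀ x y, f.SameCycle x y

lemma IsFullCycle.apply_ne {α : Type*} [Nontrivial α] {f : Perm α} (hf : IsFullCycle f) (x : α) :
    f x ≠ x := by
  intro hx
  obtain ⟨y, hy⟩ := exists_ne x
  exact hy ((hf x y).eq_of_left hx).symm

lemma isFullCycle_iff {α : Type*} [Fintype α] [DecidableEq α] [Nontrivial α] (f : Perm α) :
    IsFullCycle f ↔ f.IsCycle ∧ f.support = univ := by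
  constructor
  · intro hf
    obtain ⟨x⟩ := (inferInstance : Nonempty α)
    exact ⟨⟨x, hf.apply_ne x, fun y _ => hf x y⟩, by
      ext y; simpa using hf.apply_ne y⟩
  · rintro ⟨hc, hs⟩ x y
    have h : ∀ z, f z ≠ z := fun z => by rw [← Perm.mem_support, hs]; exact mem_univ z
    exact hc.sameCycle (h x) (h y)

lemma IsFullCycle.permCongr {α β : Type*} (e : α ≃ β) {f : Perm α} (hf : IsFullCycle f) :
    IsFullCycle (e.permCongr f) := by
  intro x y
  have := rel_of_sameCycle (r := fun a b => (e.permCongr f).SameCycle (e a) (e b))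
    ⟨fun _ => Perm.SameCycle.refl _ _, Perm.SameCycle.symm, Perm.SameCycle.trans⟩
    (fun a => ⟨1, by simp⟩) (hf (e.symm x) (e.symm y))
  simpa using this

lemma isFullCycle_permCongr_iff {α β : Type*} (e : α ≃ β) {f : Perm α} :
    IsFullCycle (e.permCongr f) ↔ IsFullCycle f := by
  refine ⟨fun h => ?_, fun h => h.permCongr e⟩
  have := h.permCongr e.symm
  rwa [← Equiv.permCongr_symm, Equiv.symm_apply_apply] at this

section Insertion

variable {α : Type*} [DecidableEq α]

/-- The permutation of `Option α` obtained from `f` by inserting `none` between `x` and `f x`. -/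
def insertNone (f : Perm α) (x : α) : Perm (Option α) :=
  Perm.decomposeOption.symm (some (f x), f)

@[simp]
lemma insertNone_none (f : Perm α) (x : α) : insertNone f x none = some (f x) := by
  simp [insertNone]

@[simp]
lemma insertNone_some_self (f : Perm α) (x : α) : insertNone f x (some x) = none := by
  simp [insertNone]

lemma insertNone_some_of_ne (f : Perm α) {x z : α} (h : z ≠ x) :
    insertNone f x (some z) = some (f z) := by
  simp [insertNone, swap_apply_of_ne_of_ne, h]

lemma isFullCycle_insertNone_iff (f : Perm α) (x : α) :
    IsFullCycle (insertNone f x) ↔ IsFullCycle f := by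
  constructor
  · intro h y z
    refine rel_of_sameCycle (r := fun a b => f.SameCycle (a.getD (f x)) (b.getD (f x)))
      ⟨fun _ => Perm.SameCycle.refl _ _, Perm.SameCycle.symm, Perm.SameCycle.trans⟩
      ?_ (h (some y) (some z))
    rintro (_ | w)
    · simpa using Perm.SameCycle.refl f (f x)
    · by_cases hw : w = x
      · subst hw
        simpa using Perm.SameCycle.refl f w
      · simpa [insertNone_some_of_ne f hw] using Perm.SameCycle.refl f w
  · intro h
    have hs : ∀ y z, (insertNone f x).SameCycle (some y) (some z) := fun y z => by
      refine rel_of_sameCycle (r := fun a b => (insertNone f x).SameCycle (some a) (some b))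
        ⟨fun _ => Perm.SameCycle.refl _ _, Perm.SameCycle.symm, Perm.SameCycle.trans⟩
        (fun w => ?_) (h y z)
      by_cases hw : w = x
      · subst hw
        exact ⟨2, by rw [zpow_two]; simp⟩
      · exact ⟨1, by simp [insertNone_some_of_ne f hw]⟩
    have hn : ∀ y, (insertNone f x).SameCycle none (some y) := fun y =>
      Perm.SameCycle.trans ⟨1, by simp⟩ (hs (f x) y)
    rintro (_ | y) (_ | z)
    · exact Perm.SameCycle.refl _ _
    · exact hn z
    · exact (hn y).symm
    · exact hs y z

lemma not_isFullCycle_decomposeOption_symm_none [Nonempty α] (f : Perm α) :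
    ¬ IsFullCycle (Perm.decomposeOption.symm (none, f)) := fun h =>
  h.apply_ne none (by simp)

open scoped Classical in
/-- Full cycles on `Option α` arise from full cycles on `α` by inserting `none`. -/
lemma sum_isFullCycle_option [Fintype α] [Nonempty α] {M : Type*} [AddCommMonoid M]
    (g : Perm (Option α) → M) :
    ∑ τ with IsFullCycle τ, g τ =
      ∑ f : Perm α with IsFullCycle f, ∑ x, g (insertNone f x) := by
  rw [sum_filter, ← Equiv.sum_comp Perm.decomposeOption.symm, Fintype.sum_prod_type_right,
    sum_filter]
  refine sum_congr rfl fun f _ => ?_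
  rw [Fintype.sum_option, if_neg (not_isFullCycle_decomposeOption_symm_none f), zero_add,
    ← Equiv.sum_comp f]
  change ∑ x, (if IsFullCycle (insertNone f x) then g (insertNone f x) else 0) = _
  simp only [isFullCycle_insertNone_iff]
  split_ifs <;> simp

end Insertion

variable {K : Type*} [Field K]

/-- The hyperbolic-cotangent addition law for `(x + y) / (x - y)`. -/
lemma ratio_mul_ratio {x y z : K} (hxy : x ≠ y) (hyz : y ≠ z) (hxz : x ≠ z) :
    (x + y) / (x - y) * ((y + z) / (y - z)) =
      (x + z) / (x - z) * ((x + y) / (x - y) - (z + y) / (z - y)) - 1 := by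
  have h1 := sub_ne_zero.2 hxy
  have h2 := sub_ne_zero.2 hyz
  have h3 := sub_ne_zero.2 hxz
  have h4 := sub_ne_zero.2 hyz.symm
  field_simp
  ring

open scoped Classical in
/-- The sum over full cycles `τ` of `∏ j, (v j + v (τ j)) / (v j - v (τ j))`. -/
noncomputable def cycleSum {β : Type*} [Fintype β] (v : β → K) : K :=
  ∑ τ : Perm β with IsFullCycle τ, ∏ j, (v j + v (τ j)) / (v j - v (τ j))

lemma cycleSum_comp_equiv {β γ : Type*} [Fintype β] [Fintype γ] (e : β ≃ γ) (v : γ → K) :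
    cycleSum (v ∘ e) = cycleSum v := by
  classical
  unfold cycleSum
  rw [sum_filter, sum_filter, ← Equiv.sum_comp e.permCongr]
  refine sum_congr rfl fun τ _ => ?_
  rw [isFullCycle_permCongr_iff, ← Equiv.prod_comp e]
  simp

lemma prod_insertNone {α : Type*} [Fintype α] [DecidableEq α] [Nontrivial α] {v : Option α → K}
    (hv : Function.Injective v) {f : Perm α} (hf : IsFullCycle f) (x : α) :
    ∏ j, (v j + v (insertNone f x j)) / (v j - v (insertNone f x j)) =
      (∏ j, (v (some j) + v (some (f j))) / (v (some j) - v (some (f j)))) *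
        ((v (some x) + v none) / (v (some x) - v none) -
          (v (some (f x)) + v none) / (v (some (f x)) - v none)) -
      ∏ j ∈ univ.erase x, (v (some j) + v (some (f j))) / (v (some j) - v (some (f j))) := by
  have hrest : ∏ j ∈ univ.erase x, (v (some j) + v (insertNone f x (some j))) /
      (v (some j) - v (insertNone f x (some j))) =
      ∏ j ∈ univ.erase x, (v (some j) + v (some (f j))) / (v (some j) - v (some (f j))) :=
    prod_congr rfl fun j hj => by rw [insertNone_some_of_ne f (ne_of_mem_erase hj)]
  rw [Fintype.prod_option, ← mul_prod_erase univ _ (mem_univ x), hrest,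
    ← mul_prod_erase univ (fun j => (v (some j) + v (some (f j))) /
      (v (some j) - v (some (f j)))) (mem_univ x), insertNone_none, insertNone_some_self]
  have key := ratio_mul_ratio (x := v (some x)) (y := v none) (z := v (some (f x)))
    (hv.ne (by simp)) (hv.ne (by simp)) (hv.ne (by simpa using (hf.apply_ne x).symm))
  linear_combination (∏ j ∈ univ.erase x, (v (some j) + v (some (f j))) /
    (v (some j) - v (some (f j)))) * key

open scoped Classical in
/-- The cycle sum does not involve the value at `none`. -/
lemma cycleSum_option {α : Type*} [Fintype α] [Nontrivial α] {v : Option α → K}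
    (hv : Function.Injective v) :
    cycleSum v = ∑ f : Perm α with IsFullCycle f, ∑ x, -∏ j ∈ univ.erase x,
      (v (some j) + v (some (f j))) / (v (some j) - v (some (f j))) := by
  trans ∑ f : Perm α with IsFullCycle f, ∑ x,
    ∏ j, (v j + v (insertNone f x j)) / (v j - v (insertNone f x j))
  · rw [← sum_isFullCycle_option fun τ => ∏ j, (v j + v (τ j)) / (v j - v (τ j))]
    unfold cycleSum
    congr!
  refine sum_congr rfl fun f hf => ?_
  rw [sum_congr rfl fun x _ => prod_insertNone hv (mem_filter.1 hf).2 x, sum_sub_distrib,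
    ← mul_sum, sum_sub_distrib,
    Equiv.sum_comp f fun x => (v (some x) + v none) / (v (some x) - v none)]
  simp

lemma cycleSum_eq_of_eqOn_compl {β : Type*} [Fintype β] (hβ : 2 < Fintype.card β) {v w : β → K}
    (hv : Function.Injective v) (hw : Function.Injective w) (p : β)
    (h : ∀ j, j ≠ p → v j = w j) : cycleSum v = cycleSum w := by
  classical
  have : Nontrivial {j // j ≠ p} := Fintype.one_lt_card_iff_nontrivial.1 (by
    rw [Fintype.card_subtype_compl, Fintype.card_subtype_eq]; omega)
  rw [← cycleSum_comp_equiv (optionSubtypeNe p) v, ← cycleSum_comp_equiv (optionSubtypeNe p) w,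
    cycleSum_option (hv.comp (Equiv.injective _)), cycleSum_option (hw.comp (Equiv.injective _))]
  have hvw : ∀ j : {j // j ≠ p}, v j = w j := fun j => h j j.2
  simp [hvw]

/-- If `v` and `w` are injective with disjoint ranges, they have the same cycle sum. -/
lemma cycleSum_eq_of_ne {β : Type*} [Fintype β] (hβ : 2 < Fintype.card β) {v w : β → K}
    (hv : Function.Injective v) (hw : Function.Injective w) (h : ∀ i j, v i ≠ w j) :
    cycleSum v = cycleSum w := by
  classical
  have hinj : ∀ s : Finset β, Function.Injective (s.piecewise w v) := by
    intro s i j hij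
    by_cases hi : i ∈ s <;> by_cases hj : j ∈ s <;>
      simp only [piecewise, hi, hj, if_true, if_false] at hij
    · exact hw hij
    · exact (h _ _ hij.symm).elim
    · exact (h _ _ hij).elim
    · exact hv hij
  have hs : ∀ s : Finset β, cycleSum (s.piecewise w v) = cycleSum v := by
    intro s
    induction s using Finset.induction_on with
    | empty => simp
    | insert p s _ ih =>
      rw [← ih]
      refine cycleSum_eq_of_eqOn_compl hβ (hinj _) (hinj _) p fun j hj => ?_
      simp [piecewise, hj]
  simpa using (hs univ).symm

lemma map_cycleSum {L β : Type*} [Field L] [Fintype β] (φ : K →+* L) (v : β → K) :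
    cycleSum (φ ∘ v) = φ (cycleSum v) := by
  simp [cycleSum]

end CycleSum

/- For `n > 1`, in the field `ℚ(x_1, …, x_{2n})` of rational functions, the sum over all
`2n`-cycles `τ` in `S_{2n}` of `∏_{j=1}^{2n} (x_j + x_{τ(j)})/(x_j - x_{τ(j)})` is a constant,
i.e. it is (the image of) a rational number. -/
open scoped Classical in
theorem sum_cycles_prod_ratio_is_constant (n : ℕ) (hn : 1 < n) :
    ∃ c : ℚ,
      ∑ τ ∈ univ.filter (fun τ : Perm (Fin (2 * n)) => τ.IsCycle ∧ τ.support = univ),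
        ∏ j : Fin (2 * n),
          (algebraMap (MvPolynomial (Fin (2 * n)) ℚ)
              (FractionRing (MvPolynomial (Fin (2 * n)) ℚ)) (MvPolynomial.X j) +
            algebraMap (MvPolynomial (Fin (2 * n)) ℚ)
              (FractionRing (MvPolynomial (Fin (2 * n)) ℚ)) (MvPolynomial.X (τ j))) /
          (algebraMap (MvPolynomial (Fin (2 * n)) ℚ)
              (FractionRing (MvPolynomial (Fin (2 * n)) ℚ)) (MvPolynomial.X j) -
            algebraMap (MvPolynomial (Fin (2 * n)) ℚ)
              (FractionRing (MvPolynomial (Fin (2 * n)) ℚ)) (MvPolynomial.X (τ j))) =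
      algebraMap ℚ (FractionRing (MvPolynomial (Fin (2 * n)) ℚ)) c := by
  have hcard : 2 < Fintype.card (Fin (2 * n)) := by rw [Fintype.card_fin]; omega
  have : Nontrivial (Fin (2 * n)) := Fintype.one_lt_card_iff_nontrivial.1 (by omega)
  have hinj := IsFractionRing.injective (MvPolynomial (Fin (2 * n)) ℚ)
    (FractionRing (MvPolynomial (Fin (2 * n)) ℚ))
  have hq : Function.Injective (fun j : Fin (2 * n) => ((j : ℕ) : ℚ)) :=
    Nat.cast_injective.comp Fin.val_injective
  refine ⟨CycleSum.cycleSum fun j : Fin (2 * n) => ((j : ℕ) : ℚ), ?_⟩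
  rw [← CycleSum.map_cycleSum]
  have key := CycleSum.cycleSum_eq_of_ne hcard (hinj.comp (MvPolynomial.X_injective))
    ((algebraMap ℚ (FractionRing (MvPolynomial (Fin (2 * n)) ℚ))).injective.comp hq) (by
      intro i j hij
      simp only [Function.comp_apply] at hij
      rw [IsScalarTower.algebraMap_apply ℚ (MvPolynomial (Fin (2 * n)) ℚ)] at hij
      have := congrArg MvPolynomial.totalDegree (hinj hij)
      rw [MvPolynomial.algebraMap_eq, MvPolynomial.totalDegree_C, MvPolynomial.totalDegree_X] at this
      exact one_ne_zero this)
  rw [← key]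
  simp only [CycleSum.cycleSum, CycleSum.isFullCycle_iff, Function.comp_apply]
  congr!
end

section
/- Define s_k for k ≥ 1 by: s_1 = -1 and for k ≥ 2, s_k is the common value of Σ_{τ a 2k-cycle in S_{2k}} Π_{j=1}^{2k} (x_j + x_{τ(j)})/(x_j - x_{τ(j)}). Then for every integer n ≥ 1, 1 + Σ_{k=1}^n C(2n-1, 2k-1) s_k = 0. -/
open Equiv Finset

/-- The skew-symmetric matrix with entries `1` below the diagonal and `-1` above it. -/
def skewSign (α : Type*) [LinearOrder α] : Matrix α α ℚ :=
  Matrix.of fun i j => if j < i then 1 else if i < j then -1 else 0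

/-- The determinant of the matrix `skewSign α` is `1` or `0` according to the parity of `#α`. -/
theorem det_skewSign (α : Type*) [LinearOrder α] [Fintype α] :
    (skewSign α).det = if Even (Fintype.card α) then 1 else 0 := by
  set J : ℚ → Matrix α α ℚ := fun t =>
    Matrix.replicateCol Unit (fun _ : α => t) *
      Matrix.replicateRow Unit (fun _ : α => (1 : ℚ)) with hJ
  have hJa : ∀ t i j, J t i j = t := fun t i j => by simp [hJ, Matrix.mul_apply]
  set B : Matrix α α ℚ := skewSign α + J 1 with hB
  have hBdet : B.det = 1 := by
    rw [Matrix.det_of_isLowerTriangular]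
    · simp [hB, hJa, skewSign]
    · intro i j hij
      have : i < j := hij
      simp [hB, hJa, skewSign, this, this.not_gt]
  have hBJ : ∀ t, (B + J t).det = 1 + t * ∑ i, ∑ j, B⁻¹ i j := by
    intro t
    rw [hJ, Matrix.det_add_replicateCol_mul_replicateRow (by simp [hBdet]), hBdet]
    simp [Matrix.mul_apply, Finset.sum_mul, Finset.mul_sum]
    rw [Finset.sum_comm]
    simp [mul_comm]
  have h1 : B + J (-1) = skewSign α := by
    ext i j; simp [hB, hJa]
  have h2 : (B + J (-2)).det = (-1) ^ Fintype.card α := by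
    rw [Matrix.det_of_isUpperTriangular]
    · simp [hB, hJa, skewSign]
      norm_num
    · intro i j hij
      have : j < i := hij
      simp [hB, hJa, skewSign, this]
      norm_num
  rw [hBJ] at h2
  rw [← h1, hBJ]
  split_ifs with h
  · rw [h.neg_one_pow] at h2
    linarith
  · rw [(Nat.not_even_iff_odd.mp h).neg_one_pow] at h2
    linarith

open scoped Classical in
/-- Expansion of a determinant along the nontrivial cycle through a given index `a`, for a matrix
whose diagonal entry at `a` vanishes. -/
theorem Matrix.det_eq_sum_isCycle {α R : Type*} [Fintype α] [DecidableEq α] [CommRing R]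
    (A : Matrix α α R) (a : α) (ha : A a a = 0) :
    A.det = ∑ c : Perm α with c.IsCycle ∧ c a ≠ a,
      (Perm.sign c : ℤ) * (∏ j ∈ c.support, A (c j) j) *
        (A.submatrix (Subtype.val : {x // x ∉ c.support} → α) Subtype.val).det := by
  rw [Matrix.det_apply']
  have h0 : ∑ σ : Perm α, ((Perm.sign σ : ℤ) : R) * ∏ i, A (σ i) i =
      ∑ σ : Perm α with σ a ≠ a, ((Perm.sign σ : ℤ) : R) * ∏ i, A (σ i) i := by
    rw [Finset.sum_filter_of_ne]
    intro σ _ hσ hfix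
    apply hσ
    rw [Finset.prod_eq_zero (Finset.mem_univ a) (by rw [hfix, ha]), mul_zero]
  rw [h0, ← Finset.sum_fiberwise_of_maps_to (g := fun σ => σ.cycleOf a)
    (t := univ.filter fun c : Perm α => c.IsCycle ∧ c a ≠ a)]
  swap
  · intro σ hσ
    have hσ : σ a ≠ a := by simpa using hσ
    simp [Perm.isCycle_cycleOf, hσ]
  refine Finset.sum_congr rfl fun c hc => ?_
  obtain ⟨hc, hca⟩ : c.IsCycle ∧ c a ≠ a := by simpa using hc
  rw [Matrix.det_apply', Finset.mul_sum]
  symm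
  refine Finset.sum_bij (fun τ _ => c * Perm.ofSubtype τ) ?_ ?_ ?_ ?_
  · intro τ _
    have hfix : (Perm.ofSubtype τ) a = a := Perm.ofSubtype_apply_of_not_mem _ (by simpa using hca)
    have hd : Perm.Disjoint c (Perm.ofSubtype τ) := by
      intro x
      by_cases hx : c x = x
      · exact Or.inl hx
      · exact Or.inr (Perm.ofSubtype_apply_of_not_mem _ (by simpa using hx))
    simp only [mem_filter, mem_univ, true_and, Perm.mul_apply, hfix]
    refine ⟨hca, ?_⟩
    rw [Perm.cycleOf_mul_of_apply_right_eq_self hd.commute _ hfix, hc.cycleOf_eq hca]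
  · intro τ _ τ' _ h
    exact Perm.ofSubtype_injective (mul_left_cancel h)
  · intro σ hσ
    obtain ⟨hσa, rfl⟩ : σ a ≠ a ∧ σ.cycleOf a = c := by simpa using hσ
    have hd : Perm.Disjoint (σ * (σ.cycleOf a)⁻¹) (σ.cycleOf a) :=
      Perm.disjoint_mul_inv_of_mem_cycleFactorsFinset
        (Perm.cycleOf_mem_cycleFactorsFinset_iff.mpr (by simpa using hσa))
    set c := σ.cycleOf a
    have h2 : ∀ x, (σ * c⁻¹) x ≠ x → x ∉ c.support := by
      intro x hx
      simpa using (hd x).resolve_left hx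
    have h1 : ∀ x, (σ * c⁻¹) x ∉ c.support ↔ x ∉ c.support := by
      intro x
      by_cases hx : (σ * c⁻¹) x = x
      · rw [hx]
      · exact iff_of_true (h2 _ fun h => hx ((σ * c⁻¹).injective h)) (h2 _ hx)
    refine ⟨(σ * c⁻¹).subtypePerm h1, mem_univ _, ?_⟩
    rw [Perm.ofSubtype_subtypePerm h1 h2, ← hd.commute.eq]
    simp
  · intro τ _
    rw [Perm.sign_mul, Perm.sign_ofSubtype, ← Finset.prod_mul_prod_compl c.support
      (fun i => A ((c * Perm.ofSubtype τ) i) i)]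
    have e1 : ∏ i ∈ c.support, A ((c * Perm.ofSubtype τ) i) i = ∏ i ∈ c.support, A (c i) i := by
      refine Finset.prod_congr rfl fun i hi => ?_
      rw [Perm.mul_apply, Perm.ofSubtype_apply_of_not_mem _ (by simpa using hi)]
    have e2 : ∏ i ∈ c.supportᶜ, A ((c * Perm.ofSubtype τ) i) i =
        ∏ i : {x // x ∉ c.support}, A (τ i) i := by
      rw [Finset.prod_subtype (p := fun x => x ∉ c.support) c.supportᶜ (fun x => Finset.mem_compl)]
      refine Finset.prod_congr rfl fun i _ => ?_
      rw [Perm.mul_apply, Perm.ofSubtype_apply_coe, Perm.notMem_support.mp (τ i).2]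
    rw [e1, e2]
    simp only [Matrix.submatrix_apply]
    push_cast
    ring

/-- The sum over all cycles `τ` moving every element of `α` of `∏ j, skewSign α (τ j) j`. -/
noncomputable def signedCycleSum (α : Type*) [LinearOrder α] [Fintype α] : ℚ :=
  open scoped Classical in
  ∑ τ : Perm α with τ.IsCycle ∧ τ.support = univ, ∏ j, skewSign α (τ j) j

open scoped Classical in
/-- The cycles with support `S` contribute `signedCycleSum (Fin #S)`. -/
theorem sum_isCycle_support_eq {α : Type*} [LinearOrder α] [Fintype α] (S : Finset α) :
    ∑ c : Perm α with c.IsCycle ∧ c.support = S, ∏ j ∈ c.support, skewSign α (c j) j =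
      signedCycleSum (Fin #S) := by
  rw [signedCycleSum]
  symm
  let f : Fin #S ≃ {x // x ∈ S} := (S.orderIsoOfFin rfl).toEquiv
  have hf : ∀ i j, (f i : α) < f j ↔ i < j := fun i j => (S.orderIsoOfFin rfl).lt_iff_lt
  have hsupp : ∀ τ : Perm (Fin #S), τ.support = univ → (τ.extendDomain f).support = S := by
    intro τ h
    rw [Perm.support_extend_domain, h]
    ext x
    simp only [mem_map, mem_univ, true_and, asEmbedding, Function.Embedding.trans_apply]
    constructor
    · rintro ⟨i, rfl⟩
      exact (f i).2
    · intro hx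
      exact ⟨f.symm ⟨x, hx⟩, by simp⟩
  refine Finset.sum_bij (fun τ _ => τ.extendDomain f) ?_ ?_ ?_ ?_
  · intro τ hτ
    simp only [mem_filter, mem_univ, true_and] at hτ ⊢
    exact ⟨hτ.1.extendDomain f, hsupp τ hτ.2⟩
  · intro τ _ τ' _ h
    exact Perm.extendDomainHom_injective f h
  · intro c hc
    simp only [mem_filter, mem_univ, true_and] at hc
    obtain ⟨hc, hcS⟩ := hc
    have hS : ∀ x, c x ∈ S ↔ x ∈ S := fun x => by rw [← hcS]; exact Perm.apply_mem_support
    set τ : Perm (Fin #S) := f.symm.permCongr (c.subtypePerm hS) with hτ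
    have hext : τ.extendDomain f = c := by
      ext x
      by_cases hx : x ∈ S
      · rw [Perm.extendDomain_apply_subtype _ _ hx]
        simp [hτ]
      · rw [Perm.extendDomain_apply_not_subtype _ _ hx]
        rw [← hcS] at hx
        simpa [eq_comm] using hx
    refine ⟨τ, ?_, hext⟩
    simp only [mem_filter, mem_univ, true_and]
    constructor
    · obtain ⟨a, ha, hcyc⟩ := hext ▸ hc
      have haS : a ∈ S := by
        rw [← hcS, ← hext]
        exact Perm.mem_support.mpr ha
      obtain ⟨i, rfl⟩ : ∃ i, (f i : α) = a := ⟨f.symm ⟨a, haS⟩, by simp⟩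
      refine ⟨i, fun h => ha (by rw [Perm.extendDomain_apply_image, h]), fun j hj => ?_⟩
      refine Perm.sameCycle_extendDomain.mp (hcyc fun h => hj ?_)
      rw [Perm.extendDomain_apply_image] at h
      exact f.injective (Subtype.ext h)
    · refine Finset.eq_univ_of_card _ ?_
      rw [← Perm.card_support_extend_domain f, hext, hcS, Fintype.card_fin]
  · intro τ hτ
    simp only [mem_filter, mem_univ, true_and] at hτ
    rw [hsupp τ hτ.2, ← Finset.prod_coe_sort S, ← f.prod_comp]
    refine Finset.prod_congr rfl fun j _ => ?_
    rw [Perm.extendDomain_apply_image]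
    simp [skewSign, hf]

/-- Since `skewSign (Fin (2 * n))` has determinant `1`, expanding along the cycle through `0` yields a
recursion for the sums `signedCycleSum (Fin (2 * k))`. -/
theorem one_add_sum_choose_mul_signedCycleSum (n : ℕ) (hn : 1 ≤ n) :
    1 + ∑ k ∈ Icc 1 n, (Nat.choose (2 * n - 1) (2 * k - 1) : ℚ) * signedCycleSum (Fin (2 * k)) =
      0 := by
  classical
  have : NeZero (2 * n) := ⟨by lia⟩
  have hdet := Matrix.det_eq_sum_isCycle (skewSign (Fin (2 * n))) 0 (by simp [skewSign])
  have hterm : ∀ c : Perm (Fin (2 * n)), c.IsCycle →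
      ((Perm.sign c : ℤ) : ℚ) * (∏ j ∈ c.support, skewSign _ (c j) j) *
        ((skewSign _).submatrix (Subtype.val : {x // x ∉ c.support} → _) Subtype.val).det =
      if Even #c.support then -∏ j ∈ c.support, skewSign _ (c j) j else 0 := by
    intro c hc
    have hsub : (skewSign (Fin (2 * n))).submatrix
        (Subtype.val : {x // x ∉ c.support} → _) Subtype.val =
        skewSign {x // x ∉ c.support} := by
      ext i j; simp [skewSign]
    have hle : #c.support ≤ 2 * n := by simpa using Finset.card_le_univ c.support
    have hcard : Even (Fintype.card {x // x ∉ c.support}) ↔ Even #c.support := by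
      rw [Fintype.card_subtype_compl]
      simp only [Fintype.card_fin, Fintype.card_coe, Nat.even_sub hle]
      simp
    have hdet' : (skewSign {x // x ∉ c.support}).det = if Even #c.support then 1 else 0 := by
      simp only [← hcard]
      convert det_skewSign {x // x ∉ c.support}
    rw [hsub, hdet', hc.sign]
    split_ifs with h
    · simp [h.neg_one_pow]
    · simp
  rw [det_skewSign, Finset.sum_congr rfl fun c hc => hterm c (by simp at hc; exact hc.1),
    ← Finset.sum_fiberwise_of_maps_to (g := fun c => c.support.erase 0)
      (t := (univ.erase 0).powerset)] at hdet
  swap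
  · intro c _
    simpa using Finset.erase_subset_erase _ (Finset.subset_univ _)
  have hinner : ∀ T ∈ ((univ : Finset (Fin (2 * n))).erase 0).powerset,
      (∑ c ∈ univ.filter (fun c : Perm (Fin (2 * n)) => c.IsCycle ∧ c 0 ≠ 0) with
        c.support.erase 0 = T,
        if Even #c.support then -∏ j ∈ c.support, skewSign _ (c j) j else 0) =
      (fun i => if Even (i + 1) then -signedCycleSum (Fin (i + 1)) else 0) #T := by
    intro T hT
    have h0 : 0 ∉ T := fun h => by simpa using Finset.mem_powerset.mp hT h
    have hset : (univ.filter (fun c : Perm (Fin (2 * n)) => c.IsCycle ∧ c 0 ≠ 0)).filter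
        (fun c => c.support.erase 0 = T) =
        univ.filter fun c => c.IsCycle ∧ c.support = insert 0 T := by
      ext c
      simp only [mem_filter, mem_univ, true_and, and_assoc, and_congr_right_iff]
      intro _
      rw [← Perm.mem_support]
      constructor
      · rintro ⟨h, rfl⟩
        rw [Finset.insert_erase h]
      · intro h
        simp [h, h0]
    have hc : #(insert 0 T) = #T + 1 := Finset.card_insert_of_notMem h0
    rw [hset]
    simp only
    rw [← hc, ← sum_isCycle_support_eq]
    split_ifs with h
    · rw [← Finset.sum_neg_distrib]
      refine Finset.sum_congr rfl fun c hc => ?_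
      rw [if_pos]
      simp at hc
      rwa [hc.2]
    · refine Finset.sum_eq_zero fun c hc => ?_
      rw [if_neg]
      simp at hc
      rwa [hc.2]
  rw [Finset.sum_congr rfl hinner, Finset.sum_powerset_apply_card
    (fun i => if Even (i + 1) then -signedCycleSum (Fin (i + 1)) else 0)] at hdet
  have hodd : ∀ (g : ℕ → ℚ) (m : ℕ), (∀ i, Even i → g i = 0) →
      ∑ i ∈ range (2 * m), g i = ∑ k ∈ Icc 1 m, g (2 * k - 1) := by
    intro g m hg
    induction m with
    | zero => simp
    | succ m ih =>
      rw [show 2 * (m + 1) = 2 * m + 1 + 1 by ring, Finset.sum_range_succ, Finset.sum_range_succ,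
        ih, Finset.sum_Icc_succ_top (by lia), hg (2 * m) (by simp), add_zero]
      rfl
  have hcard : #((univ : Finset (Fin (2 * n))).erase 0) = 2 * n - 1 := by simp
  rw [hcard, show 2 * n - 1 + 1 = 2 * n by lia, hodd] at hdet
  · simp only [Fintype.card_fin, even_two, Even.mul_right, if_true] at hdet
    rw [hdet, ← Finset.sum_add_distrib]
    refine Finset.sum_eq_zero fun k hk => ?_
    have hk : 2 * k - 1 + 1 = 2 * k := by have := (Finset.mem_Icc.mp hk).1; lia
    rw [hk]
    simp
  · intro i hi
    simp [Nat.even_add_one, hi]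

open Filter Topology in
/-- The entries of `skewSign (Fin m)` are limits of the ratios `(x j + x i) / (x j - x i)` for
`x j = u ^ j`, as `u` tends to `0` from the right. -/
theorem tendsto_pow_add_div_pow_sub {m : ℕ} (i j : Fin m) (hij : i ≠ j) :
    Tendsto (fun u : ℚ => (u ^ (j : ℕ) + u ^ (i : ℕ)) / (u ^ (j : ℕ) - u ^ (i : ℕ))) (𝓝[>] 0)
      (𝓝 (skewSign (Fin m) i j)) := by
  have key : ∀ d : ℕ, d ≠ 0 →
      Tendsto (fun u : ℚ => (1 + u ^ d) / (1 - u ^ d)) (𝓝[>] 0) (𝓝 1) := by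
    intro d hd
    have : ContinuousAt (fun u : ℚ => (1 + u ^ d) / (1 - u ^ d)) 0 :=
      ContinuousAt.div (by fun_prop) (by fun_prop) (by simp [hd])
    simpa [hd] using this.tendsto.mono_left nhdsWithin_le_nhds
  rcases lt_or_gt_of_ne hij with h | h
  · obtain ⟨d, hd⟩ := Nat.exists_eq_add_of_lt (Fin.lt_def.mp h)
    have h1 : skewSign (Fin m) i j = -1 := by simp [skewSign, h, h.not_gt]
    rw [h1]
    refine ((key (d + 1) (by simp)).neg).congr' ?_
    filter_upwards [self_mem_nhdsWithin] with u hu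
    have hu : u ≠ 0 := ne_of_gt hu
    have hfac : u ^ (j : ℕ) = u ^ (i : ℕ) * u ^ (d + 1) := by rw [hd, add_assoc, pow_add]
    rw [hfac, ← mul_add_one, ← mul_sub_one, mul_div_mul_left _ _ (pow_ne_zero _ hu), ← div_neg,
      neg_sub, add_comm]
  · obtain ⟨d, hd⟩ := Nat.exists_eq_add_of_lt (Fin.lt_def.mp h)
    have h1 : skewSign (Fin m) i j = 1 := by simp [skewSign, h]
    rw [h1]
    refine (key (d + 1) (by simp)).congr' ?_
    filter_upwards [self_mem_nhdsWithin] with u hu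
    have hu : u ≠ 0 := ne_of_gt hu
    have hfac : u ^ (i : ℕ) = u ^ (j : ℕ) * u ^ (d + 1) := by rw [hd, add_assoc, pow_add]
    rw [hfac, ← mul_one_add, ← mul_one_sub, mul_div_mul_left _ _ (pow_ne_zero _ hu)]

open Filter Topology in
open scoped Classical in
/-- If the cyclic sum of products of ratios does not depend on the choice of distinct values, it equals
`signedCycleSum (Fin m)`. -/
theorem signedCycleSum_fin_eq {m : ℕ} {r : ℚ}
    (h : ∀ x : Fin m → ℚ, Function.Injective x →
      ∑ τ ∈ univ.filter (fun τ : Perm (Fin m) => τ.IsCycle ∧ τ.support = univ),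
        ∏ j : Fin m, (x j + x (τ j)) / (x j - x (τ j)) = r) :
    signedCycleSum (Fin m) = r := by
  have hlim : Tendsto (fun u : ℚ =>
      ∑ τ ∈ univ.filter (fun τ : Perm (Fin m) => τ.IsCycle ∧ τ.support = univ),
        ∏ j : Fin m, (u ^ (j : ℕ) + u ^ (τ j : ℕ)) / (u ^ (j : ℕ) - u ^ (τ j : ℕ)))
      (𝓝[>] 0) (𝓝 (signedCycleSum (Fin m))) := by
    refine tendsto_finsetSum _ fun τ hτ => tendsto_finsetProd _ fun j _ =>
      tendsto_pow_add_div_pow_sub _ _ ?_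
    simp only [mem_filter, mem_univ, true_and] at hτ
    exact Perm.mem_support.mp (hτ.2 ▸ mem_univ j)
  refine tendsto_nhds_unique hlim (tendsto_const_nhds.congr' ?_)
  filter_upwards [Ioo_mem_nhdsGT (zero_lt_one' ℚ)] with u hu
  exact (h (fun j => u ^ (j : ℕ)) fun i j hij =>
    Fin.ext (pow_right_injective₀ hu.1 hu.2.ne hij)).symm

/- If `s 1 = -1` and, for each `k ≥ 2`, `s k` is the common value of
`∑_{τ a 2k-cycle in S_{2k}} ∏_{j=1}^{2k} (x_j + x_{τ(j)})/(x_j - x_{τ(j)})` for all choices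
of pairwise distinct `x_1, …, x_{2k}`, then `1 + ∑_{k=1}^n C(2n-1, 2k-1) s k = 0` for every
`n ≥ 1`. -/
open scoped Classical in
theorem one_add_sum_choose_mul_s_eq_zero (s : ℕ → ℚ) (hs1 : s 1 = -1)
    (hs : ∀ k : ℕ, 2 ≤ k → ∀ x : Fin (2 * k) → ℚ, Function.Injective x →
      ∑ τ ∈ univ.filter (fun τ : Perm (Fin (2 * k)) => τ.IsCycle ∧ τ.support = univ),
        ∏ j : Fin (2 * k), (x j + x (τ j)) / (x j - x (τ j)) = s k) :
    ∀ n : ℕ, 1 ≤ n →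
      1 + ∑ k ∈ Icc 1 n, (Nat.choose (2 * n - 1) (2 * k - 1) : ℚ) * s k = 0 := by
  intro n hn
  have hs' : ∀ k, 1 ≤ k → s k = signedCycleSum (Fin (2 * k)) := by
    intro k hk
    rcases hk.eq_or_lt with rfl | hk
    · have := one_add_sum_choose_mul_signedCycleSum 1 le_rfl
      simp at this
      rw [hs1]
      simp
      linarith
    · exact (signedCycleSum_fin_eq (hs k hk)).symm
  rw [← one_add_sum_choose_mul_signedCycleSum n hn]
  congr 1
  exact Finset.sum_congr rfl fun k hk => by rw [hs' k (Finset.mem_Icc.mp hk).1]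
end

section
/- For any positive integer n and pairwise distinct nonzero x_1,...,x_{2n} in a field of characteristic 0, per([x_{j,k} - 1]) = (-1)^n det([x_{j,k} - 1]) = per([x_{j,k}]), where x_{j,k} = (x_j + x_k)/(x_j - x_k) for j ≠ k and x_{j,j} = 1, and the matrices are 2n×2n. -/
open Equiv Finset

namespace Matrix

section LaplaceExpansion

variable {R : Type*} [CommRing R]

theorem permanent_succ_column_zero {m : ℕ} (A : Matrix (Fin (m + 1)) (Fin (m + 1)) R) :
    A.permanent = ∑ i, A i 0 * (A.submatrix i.succAbove Fin.succ).permanent := by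
  rw [permanent, univ_perm_fin_succ, ← univ_product_univ]
  simp only [sum_map, Equiv.toEmbedding_apply, sum_product]
  refine sum_congr rfl fun i _ => ?_
  refine Fin.cases ?_ (fun i => ?_) i
  · simp [permanent, Fin.prod_univ_succ, mul_sum]
  · rw [← permanent_permute_cols i.cycleRange, permanent, mul_sum]
    refine sum_congr rfl fun σ _ => ?_
    simp [Fin.prod_univ_succ, Fin.succAbove_cycleRange]

theorem permanent_succ_row_zero {m : ℕ} (A : Matrix (Fin (m + 1)) (Fin (m + 1)) R) :
    A.permanent = ∑ j, A 0 j * (A.submatrix Fin.succ j.succAbove).permanent := by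
  rw [← permanent_transpose, permanent_succ_column_zero]
  refine sum_congr rfl fun j _ => ?_
  rw [← permanent_transpose, transpose_submatrix, transpose_transpose, transpose_apply]

/-- Laplace expansion of the permanent along row `i`. -/
theorem permanent_succ_row {m : ℕ} (A : Matrix (Fin (m + 1)) (Fin (m + 1)) R)
    (i : Fin (m + 1)) :
    A.permanent = ∑ j, A i j * (A.submatrix i.succAbove j.succAbove).permanent := by
  rw [← permanent_permute_cols i.cycleRange.symm, permanent_succ_row_zero]
  refine sum_congr rfl fun j _ => ?_
  simp only [submatrix_apply, Fin.cycleRange_symm_zero, id, submatrix_submatrix]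
  congr 2
  ext a b
  simp

/-- Laplace expansion of the permanent along column `j`. -/
theorem permanent_succ_column {m : ℕ} (A : Matrix (Fin (m + 1)) (Fin (m + 1)) R)
    (j : Fin (m + 1)) :
    A.permanent = ∑ i, A i j * (A.submatrix i.succAbove j.succAbove).permanent := by
  rw [← permanent_transpose, permanent_succ_row _ j]
  refine sum_congr rfl fun i _ => ?_
  rw [← permanent_transpose, transpose_submatrix, transpose_transpose, transpose_apply]

/-- If all entries of `A` have derivative `1`, the derivative of its permanent is the sum of all
the permanental minors. -/
theorem derivative_permanent {m : ℕ}
    (A : Matrix (Fin (m + 1)) (Fin (m + 1)) (Polynomial R))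
    (hA : ∀ i j, Polynomial.derivative (A i j) = 1) :
    Polynomial.derivative A.permanent =
      ∑ j : Fin (m + 1), ∑ k : Fin (m + 1),
        (A.submatrix k.succAbove j.succAbove).permanent := by
  have hcol (j : Fin (m + 1)) :
      ∑ k : Fin (m + 1), (A.submatrix k.succAbove j.succAbove).permanent =
        (A.updateCol j 1).permanent := by
    simp [permanent_succ_column _ j]
  simp_rw [hcol, permanent, Polynomial.derivative_sum, Polynomial.derivative_prod_finset, hA,
    mul_one]
  rw [sum_comm]
  refine sum_congr rfl fun j _ => sum_congr rfl fun σ _ => ?_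
  rw [← mul_prod_erase univ _ (mem_univ j), updateCol_self, Pi.one_apply, one_mul]
  exact prod_congr rfl fun i hi => by rw [updateCol_ne (ne_of_mem_erase hi)]

/-- Double expansion along the first row and the first column, for a function of square matrices
obeying Laplace expansion (with sign `ε`), when the products of border entries decompose in the
way the addition formula for the hyperbolic cotangent provides. -/
theorem laplace_border_expansion (ε : R) (hε : ε * ε = 1)
    (G : ∀ m, Matrix (Fin m) (Fin m) R → R)
    (hrow : ∀ (m : ℕ) (A : Matrix (Fin (m + 1)) (Fin (m + 1)) R) (i : Fin (m + 1)),
      G (m + 1) A = ∑ j : Fin (m + 1),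
        ε ^ (i + j : ℕ) * A i j * G m (A.submatrix i.succAbove j.succAbove))
    (hcol : ∀ (m : ℕ) (A : Matrix (Fin (m + 1)) (Fin (m + 1)) R) (j : Fin (m + 1)),
      G (m + 1) A = ∑ i : Fin (m + 1),
        ε ^ (i + j : ℕ) * A i j * G m (A.submatrix i.succAbove j.succAbove))
    {m : ℕ} (A : Matrix (Fin (m + 2)) (Fin (m + 2)) R) (p : R) (u w : Fin (m + 1) → R)
    (hA : ∀ k j : Fin (m + 1), A 0 j.succ * A k.succ 0 =
      p + (u j - u k) * A k.succ j.succ + if k = j then w j else 0) :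
    G (m + 2) A = A 0 0 * G (m + 1) (A.submatrix Fin.succ Fin.succ) +
      ε * (p * ∑ j : Fin (m + 1), ∑ k : Fin (m + 1), ε ^ (k + j : ℕ) *
          G m ((A.submatrix Fin.succ Fin.succ).submatrix k.succAbove j.succAbove) +
        ∑ j : Fin (m + 1),
          w j * G m ((A.submatrix Fin.succ Fin.succ).submatrix j.succAbove j.succAbove)) := by
  set B := A.submatrix Fin.succ Fin.succ with hB
  set cof : Fin (m + 1) → Fin (m + 1) → R := fun k j =>
    ε ^ (k + j : ℕ) * G m (B.submatrix k.succAbove j.succAbove) with hcof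
  have hr (k) : ∑ j, B k j * cof k j = G (m + 1) B := by
    rw [hrow m B k]; exact sum_congr rfl fun j _ => by simp only [hcof]; ring
  have hc (j) : ∑ k, B k j * cof k j = G (m + 1) B := by
    rw [hcol m B j]; exact sum_congr rfl fun k _ => by simp only [hcof]; ring
  have hdiag (j : Fin (m + 1)) : cof j j = G m (B.submatrix j.succAbove j.succAbove) := by
    simp only [hcof]
    rw [pow_add, ← mul_pow, hε, one_pow, one_mul]
  have key : ∑ j, ∑ k, A 0 j.succ * A k.succ 0 * cof k j =
      p * ∑ j, ∑ k, cof k j + ∑ j, w j * cof j j := by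
    have hterm (k j) : A 0 j.succ * A k.succ 0 * cof k j = p * cof k j +
        u j * (B k j * cof k j) - u k * (B k j * cof k j) +
        if k = j then w j * cof k j else 0 := by
      rw [hA]
      simp only [hB, submatrix_apply]
      split_ifs <;> ring
    simp_rw [hterm, sum_add_distrib, sum_sub_distrib, sum_add_distrib, ← mul_sum, hc]
    rw [sum_comm (f := fun j k => u k * (B k j * cof k j))]
    simp_rw [← mul_sum, hr]
    simp
  have hminor (j : Fin (m + 1)) :
      G (m + 1) (A.submatrix (Fin.succAbove 0) j.succ.succAbove) =
        ∑ k : Fin (m + 1), ε ^ (k : ℕ) * A k.succ 0 *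
          G m (B.submatrix k.succAbove j.succAbove) := by
    rw [hcol m _ 0]
    refine sum_congr rfl fun k _ => ?_
    simp only [submatrix_apply, submatrix_submatrix, Fin.succAbove_zero, hB, Fin.val_zero,
      add_zero, Fin.succ_succAbove_zero]
    congr 2
    ext a b
    simp
  simp_rw [← hdiag]
  rw [← key, hrow (m + 1) A 0, Fin.sum_univ_succ]
  congr 1
  · simp [hB, Fin.succAbove_zero]
  · rw [mul_sum]
    refine sum_congr rfl fun j _ => ?_
    rw [hminor, mul_sum, mul_sum]
    refine sum_congr rfl fun k _ => ?_
    simp only [hcof, Fin.val_zero, zero_add, Fin.val_succ, pow_add, pow_one]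
    ring

end LaplaceExpansion

end Matrix

section Ratio

variable {F : Type*} [Field F]

/-- The matrix with entries `(x j + x k) / (x j - x k)` off the diagonal and `1` on it. -/
def ratioMatrix {m : ℕ} (x : Fin m → F) : Matrix (Fin m) (Fin m) F :=
  Matrix.of fun j k => if j = k then 1 else (x j + x k) / (x j - x k)

theorem ratioMatrix_submatrix {m l : ℕ} (x : Fin m → F) {e : Fin l → Fin m}
    (he : Function.Injective e) : (ratioMatrix x).submatrix e e = ratioMatrix (x ∘ e) := by
  ext j k
  simp [ratioMatrix, he.eq_iff]

theorem ratioMatrix_border {m : ℕ} {x : Fin (m + 1) → F} (hx : Function.Injective x) (s : F)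
    (k j : Fin m) :
    (s + ratioMatrix x 0 j.succ) * (s + ratioMatrix x k.succ 0) =
      (s ^ 2 - 1) + (ratioMatrix x 0 j.succ - ratioMatrix x 0 k.succ) *
        (s + ratioMatrix x k.succ j.succ) +
        if k = j then 1 - ratioMatrix x 0 j.succ ^ 2 else 0 := by
  have h0 (i : Fin m) : x 0 - x i.succ ≠ 0 :=
    sub_ne_zero.2 (hx.ne (Fin.succ_ne_zero i).symm)
  have h0' (i : Fin m) : x i.succ - x 0 ≠ 0 := sub_ne_zero.2 (hx.ne (Fin.succ_ne_zero i))
  have hneg : ratioMatrix x k.succ 0 = - ratioMatrix x 0 k.succ := by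
    have := h0 k
    have := h0' k
    simp only [ratioMatrix, Matrix.of_apply, Fin.succ_ne_zero, (Fin.succ_ne_zero k).symm, if_false]
    field_simp
    ring
  rw [hneg]
  by_cases h : k = j
  · subst h
    simp
    ring
  · have hkj : x k.succ - x j.succ ≠ 0 :=
      sub_ne_zero.2 (hx.ne (mt (Fin.succ_injective m |>.eq_iff).1 h))
    have := h0 k
    have := h0 j
    simp only [ratioMatrix, Matrix.of_apply, (Fin.succ_ne_zero _).symm, if_false,
      (Fin.succ_injective m).eq_iff, h]
    field_simp
    ring

theorem permanent_det_ratioMatrix_sub_one_recurrence {m : ℕ} {x : Fin (m + 2) → F}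
    (hx : Function.Injective x) :
    (Matrix.of fun j k => ratioMatrix x j k - 1).permanent =
      ∑ j : Fin (m + 1), (1 - ratioMatrix x 0 j.succ ^ 2) *
        (Matrix.of fun i k => ratioMatrix (x ∘ Fin.succ ∘ j.succAbove) i k - 1).permanent ∧
    (Matrix.of fun j k => ratioMatrix x j k - 1).det =
      - ∑ j : Fin (m + 1), (1 - ratioMatrix x 0 j.succ ^ 2) *
        (Matrix.of fun i k => ratioMatrix (x ∘ Fin.succ ∘ j.succAbove) i k - 1).det := by
  have hA (k j : Fin (m + 1)) := ratioMatrix_border hx (-1) k j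
  have hsub (j : Fin (m + 1)) :
      ((Matrix.of fun j k => ratioMatrix x j k - 1).submatrix Fin.succ Fin.succ).submatrix
        j.succAbove j.succAbove =
      Matrix.of fun i k => ratioMatrix (x ∘ Fin.succ ∘ j.succAbove) i k - 1 := by
    rw [← ratioMatrix_submatrix x ((Fin.succ_injective _).comp Fin.succAbove_right_injective)]
    rfl
  have h00 : ratioMatrix x 0 0 = 1 := by simp [ratioMatrix]
  simp_rw [neg_add_eq_sub] at hA
  constructor
  · rw [Matrix.laplace_border_expansion (1 : F) (by ring) (fun _ => Matrix.permanent)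
      (fun _ A i => by simpa using A.permanent_succ_row i)
      (fun _ A i => by simpa using A.permanent_succ_column i) _ _ _ _ hA]
    simp [hsub, h00]
  · rw [Matrix.laplace_border_expansion (-1 : F) (by ring) (fun _ => Matrix.det)
      (fun _ A i => A.det_succ_row i) (fun _ A i => A.det_succ_column i) _ _ _ _ hA]
    simp [hsub, h00]

theorem permanent_ratioMatrix_sub_one_eq_det {n : ℕ} {x : Fin (2 * n) → F}
    (hx : Function.Injective x) :
    (Matrix.of fun j k => ratioMatrix x j k - 1).permanent =
      (-1) ^ n * (Matrix.of fun j k => ratioMatrix x j k - 1).det := by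
  induction n with
  | zero => simp [Matrix.permanent]
  | succ n ih =>
    have h := permanent_det_ratioMatrix_sub_one_recurrence (m := 2 * n) hx
    refine h.1.trans (Eq.trans ?_ (congrArg _ h.2).symm)
    rw [pow_succ, mul_assoc, neg_one_mul, neg_neg, mul_sum]
    refine sum_congr rfl fun j _ => ?_
    rw [mul_left_comm]
    exact congrArg _ (ih ((hx.comp (Fin.succ_injective _)).comp Fin.succAbove_right_injective))

section Polynomial

open Polynomial

/-- The matrix `X + ratioMatrix x` over polynomials, with `X` added to each entry. -/
noncomputable def shiftedRatioMatrix {m : ℕ} (x : Fin m → F) : Matrix (Fin m) (Fin m) F[X] :=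
  Matrix.of fun j k => X + C (ratioMatrix x j k)

theorem eval_permanent_shiftedRatioMatrix {m : ℕ} (x : Fin m → F) (s : F) :
    (shiftedRatioMatrix x).permanent.eval s =
      (Matrix.of fun j k => s + ratioMatrix x j k).permanent := by
  simp [Matrix.permanent, shiftedRatioMatrix, eval_finsetSum, eval_prod]

theorem shiftedRatioMatrix_submatrix {m l : ℕ} (x : Fin m → F) {e : Fin l → Fin m}
    (he : Function.Injective e) :
    (shiftedRatioMatrix x).submatrix e e = shiftedRatioMatrix (x ∘ e) := by
  ext1 i k
  simp [shiftedRatioMatrix, ← ratioMatrix_submatrix x he]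

theorem permanent_shiftedRatioMatrix_recurrence {m : ℕ} {x : Fin (m + 2) → F}
    (hx : Function.Injective x) :
    (shiftedRatioMatrix x).permanent =
      (X + 1) * (shiftedRatioMatrix (x ∘ Fin.succ)).permanent +
      (X ^ 2 - 1) * derivative (shiftedRatioMatrix (x ∘ Fin.succ)).permanent +
      ∑ j : Fin (m + 1), C (1 - ratioMatrix x 0 j.succ ^ 2) *
        (shiftedRatioMatrix (x ∘ Fin.succ ∘ j.succAbove)).permanent := by
  have hA (k j : Fin (m + 1)) : shiftedRatioMatrix x 0 j.succ * shiftedRatioMatrix x k.succ 0 =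
      (X ^ 2 - 1) + (C (ratioMatrix x 0 j.succ) - C (ratioMatrix x 0 k.succ)) *
        shiftedRatioMatrix x k.succ j.succ +
        if k = j then C (1 - ratioMatrix x 0 j.succ ^ 2) else 0 := by
    have h0 := congrArg C (ratioMatrix_border hx 0 k j)
    have h1 := congrArg C (ratioMatrix_border hx 1 k j)
    simp only [shiftedRatioMatrix, Matrix.of_apply]
    split_ifs at h0 h1 ⊢ <;> simp only [map_add, map_mul, map_sub, map_pow, map_one, map_zero]
      at h0 h1 ⊢ <;> linear_combination (1 - X) * h0 + X * h1
  rw [Matrix.derivative_permanent _ (fun i j => by simp [shiftedRatioMatrix]),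
    Matrix.laplace_border_expansion (1 : F[X]) (by ring) (fun _ => Matrix.permanent)
      (fun _ A i => by simpa using A.permanent_succ_row i)
      (fun _ A i => by simpa using A.permanent_succ_column i) _ _ _ _ hA]
  have h00 : shiftedRatioMatrix x 0 0 = X + 1 := by simp [shiftedRatioMatrix, ratioMatrix]
  simp only [shiftedRatioMatrix_submatrix x (Fin.succ_injective _), h00, one_pow, one_mul,
    add_assoc]
  simp only [shiftedRatioMatrix_submatrix (x ∘ Fin.succ) Fin.succAbove_right_injective,
    Function.comp_assoc]

theorem permanent_shiftedRatioMatrix_parity {m : ℕ} {x : Fin m → F}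
    (hx : Function.Injective x) :
    ∃ (c : F) (f : F[X]), (shiftedRatioMatrix x).permanent = C c + (X + 1) * f ∧
      f.comp (-X) = (-1) ^ (m + 1) * f ∧ (Odd m → c = 0) := by
  induction m using Nat.twoStepInduction with
  | zero => exact ⟨1, 0, by simp [Matrix.permanent], by simp, by simp⟩
  | one =>
    exact ⟨0, 1, by simp [shiftedRatioMatrix, ratioMatrix], by simp, by simp⟩
  | more m ih₀ ih₁ =>
    obtain ⟨c, f, hP, hf, hc⟩ := ih₁ (hx.comp (Fin.succ_injective _))
    choose c' f' hP' hf' hc' using fun j : Fin (m + 1) =>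
      ih₀ ((hx.comp (Fin.succ_injective _)).comp (Fin.succAbove_right_injective (p := j)))
    set w : Fin (m + 1) → F := fun j => 1 - ratioMatrix x 0 j.succ ^ 2 with hw
    refine ⟨∑ j, w j * c' j,
      C c + 2 * X * f + (X ^ 2 - 1) * derivative f + ∑ j, C (w j) * f' j, ?_, ?_, ?_⟩
    · rw [permanent_shiftedRatioMatrix_recurrence hx, hP]
      simp_rw [← Function.comp_assoc, hP', mul_add (C _), sum_add_distrib]
      simp only [mul_add (X + 1), mul_sum, map_sum, map_mul, derivative_add, derivative_mul,
        derivative_C, derivative_X, derivative_one]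
      simp_rw [mul_left_comm (X + 1 : F[X]) (C _)]
      ring
    · have hd : (derivative f).comp (-X) = (-1) ^ (m + 1) * derivative f := by
        have h := congrArg derivative hf
        rw [derivative_comp] at h
        have hconst : derivative ((-1 : F[X]) ^ (m + 1 + 1) * f) =
            (-1) ^ (m + 1 + 1) * derivative f := by
          rw [show (-1 : F[X]) ^ (m + 1 + 1) = C ((-1) ^ (m + 1 + 1)) by simp, derivative_C_mul]
        rw [hconst] at h
        simp only [derivative_neg, derivative_X] at h
        linear_combination -h
      have hcc : (C c : F[X]) = (-1) ^ (m + 1) * C c := by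
        rcases Nat.even_or_odd (m + 1) with h | h
        · rw [h.neg_one_pow, one_mul]
        · simp [hc h]
      simp only [add_comp, mul_comp, sub_comp, pow_comp, X_comp, C_comp, one_comp, ofNat_comp,
        Polynomial.sum_comp, hf, hf', hd, mul_add ((-1 : F[X]) ^ (m + 2 + 1)), mul_sum,
        mul_left_comm _ (C _)]
      rw [show (-1 : F[X]) ^ (m + 2 + 1) = (-1) ^ (m + 1) by ring]
      linear_combination hcc
    · intro hm
      exact sum_eq_zero fun j _ => by rw [hc' j (by grind), mul_zero]

theorem permanent_ratioMatrix_sub_one_eq_permanent [CharZero F] {n : ℕ} {x : Fin (2 * n) → F}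
    (hx : Function.Injective x) :
    (Matrix.of fun j k => ratioMatrix x j k - 1).permanent = (ratioMatrix x).permanent := by
  obtain ⟨c, f, hP, hf, -⟩ := permanent_shiftedRatioMatrix_parity hx
  have hf0 : f.eval 0 = 0 := by
    have h := congrArg (eval 0) hf
    simp [eval_comp, pow_succ, pow_mul] at h
    exact self_eq_neg.1 h
  have h0 := eval_permanent_shiftedRatioMatrix x 0
  have h1 := eval_permanent_shiftedRatioMatrix x (-1)
  rw [hP] at h0 h1
  simp only [eval_add, eval_mul, eval_C, eval_X, eval_one, neg_add_cancel, zero_mul, add_zero,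
    hf0, mul_zero, zero_add, neg_add_eq_sub] at h0 h1
  exact h1.symm.trans h0

end Polynomial

end Ratio

/- For pairwise distinct nonzero `x_1, …, x_{2n}` in a field of characteristic zero, with
`x_{j,k} = (x_j + x_k)/(x_j - x_k)` for `j ≠ k` and `x_{j,j} = 1`,
`per [x_{j,k} - 1] = (-1)^n det [x_{j,k} - 1] = per [x_{j,k}]`. -/
theorem permanent_sub_one_eq_det_eq_permanent {F : Type*} [Field F] [CharZero F]
    (n : ℕ) (hn : 0 < n) (x : Fin (2 * n) → F) (hx : Function.Injective x)
    (hx0 : ∀ j, x j ≠ 0) :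
    Matrix.permanent (Matrix.of fun j k : Fin (2 * n) =>
        (if j = k then (1 : F) else (x j + x k) / (x j - x k)) - 1) =
      (-1) ^ n * Matrix.det (Matrix.of fun j k : Fin (2 * n) =>
        (if j = k then (1 : F) else (x j + x k) / (x j - x k)) - 1) ∧
    (-1) ^ n * Matrix.det (Matrix.of fun j k : Fin (2 * n) =>
        (if j = k then (1 : F) else (x j + x k) / (x j - x k)) - 1) =
      Matrix.permanent (Matrix.of fun j k : Fin (2 * n) =>
        if j = k then (1 : F) else (x j + x k) / (x j - x k)) := by
  exact ⟨permanent_ratioMatrix_sub_one_eq_det hx,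
    (permanent_ratioMatrix_sub_one_eq_det hx).symm.trans
      (permanent_ratioMatrix_sub_one_eq_permanent hx)⟩
end

section
/- Let n > 1 be an even integer and ζ a primitive n-th root of unity in ℂ. Define c_{j,k} = (1 + ζ^{j-k})/(1 - ζ^{j-k}) for j ≠ k and c_{j,j} = 1. Then the permanent of the n×n matrix [c_{j,k}]_{1≤j,k≤n} equals ((n-1)!!)^2. -/
open Equiv Finset

namespace Matrix

open Polynomial

variable {α R K : Type*} [Fintype α] [DecidableEq α] [CommRing R] [Field K]

theorem sum_perm_option (F : Perm (Option α) → R) :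
    ∑ τ, F τ = ∑ σ : Perm α, F (Perm.decomposeOption.symm (none, σ)) +
      ∑ σ : Perm α, ∑ l, F (Perm.decomposeOption.symm (some (σ l), σ)) := by
  rw [← Perm.decomposeOption.symm.sum_comp, Fintype.sum_prod_type, Fintype.sum_option, sum_comm]
  congr 1
  exact sum_congr rfl fun σ _ =>
    (Equiv.sum_comp σ fun i => F (Perm.decomposeOption.symm (some i, σ))).symm

theorem prod_decomposeOption_none (B : Matrix (Option α) (Option α) R) (σ : Perm α) :
    ∏ i, B (Perm.decomposeOption.symm (none, σ) i) i =
      B none none * ∏ k, B (some (σ k)) (some k) := by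
  simp [Fintype.prod_option]

theorem prod_decomposeOption_some (B : Matrix (Option α) (Option α) R) (σ : Perm α) (l : α) :
    ∏ i, B (Perm.decomposeOption.symm (some (σ l), σ) i) i =
      B (some (σ l)) none * B none (some l) * ∏ k ∈ univ.erase l, B (some (σ k)) (some k) := by
  rw [Fintype.prod_option, ← mul_prod_erase univ _ (mem_univ l), mul_assoc]
  rw [show Perm.decomposeOption.symm (some (σ l), σ) none = some (σ l) by simp,
    show Perm.decomposeOption.symm (some (σ l), σ) (some l) = none by simp]
  refine congrArg _ (congrArg _ (prod_congr rfl fun k hk => ?_))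
  have hkl : σ k ≠ σ l := σ.injective.ne (ne_of_mem_erase hk)
  simp [hkl, swap_apply_of_ne_of_ne]

/-- If the products of the border entries split as a telescoping part, a constant and a diagonal
part, then inserting the border into the cycles of `σ` only leaves the last two contributions. -/
theorem sum_border_mul_prod_erase {B : Matrix (Option α) (Option α) R} {f w : α → R} {d : R}
    (hB : ∀ i j, B (some i) none * B none (some j) =
      B (some i) (some j) * (f i - f j) + d + if i = j then w i else 0) (σ : Perm α) :
    ∑ l, B (some (σ l)) none * B none (some l) * ∏ k ∈ univ.erase l, B (some (σ k)) (some k) =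
      d * ∑ l, ∏ k ∈ univ.erase l, B (some (σ k)) (some k) +
      ∑ l, if σ l = l then w l * ∏ k ∈ univ.erase l, B (some (σ k)) (some k) else 0 := by
  have key : ∑ l, (f (σ l) - f l) * ∏ k, B (some (σ k)) (some k) = 0 := by
    rw [← sum_mul, sum_sub_distrib, Equiv.sum_comp σ f, sub_self, zero_mul]
  rw [mul_sum, ← sum_add_distrib, ← sub_eq_zero, ← sum_sub_distrib]
  refine Eq.trans ?_ key
  refine sum_congr rfl fun l _ => ?_
  rw [hB, ← mul_prod_erase univ _ (mem_univ l)]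
  split_ifs with h
  · rw [h]; ring
  · ring

theorem sum_perm_fixing (G : Perm α → R) (l : α) :
    ∑ σ : Perm α, (if σ l = l then G σ else 0) =
      ∑ σ : Perm {k // k ≠ l}, G (Perm.ofSubtype σ) := by
  rw [← sum_filter, sum_subtype (p := fun σ : Perm α => ∀ a, ¬a ≠ l → σ a = a) _ (by simp)]
  exact ((Perm.subtypeEquivSubtypePerm (· ≠ l)).sum_comp fun σ => G σ.1).symm

theorem prod_erase_ofSubtype (A : Matrix α α R) (l : α) (σ : Perm {k // k ≠ l}) :
    ∏ k ∈ univ.erase l, A (Perm.ofSubtype σ k) k = ∏ k : {k // k ≠ l}, A (σ k) k := by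
  have h : ∏ k ∈ univ.erase l, A (Perm.ofSubtype σ k) k =
      ∏ k : {k // k ≠ l}, A (Perm.ofSubtype σ k.1) k.1 := prod_subtype _ (by simp) _
  simpa using h

theorem permanent_option {B : Matrix (Option α) (Option α) R} {f w : α → R} {d : R}
    (hB : ∀ i j, B (some i) none * B none (some j) =
      B (some i) (some j) * (f i - f j) + d + if i = j then w i else 0) :
    B.permanent = B none none * (B.submatrix some some).permanent +
      d * ∑ σ : Perm α, ∑ l, ∏ k ∈ univ.erase l, B (some (σ k)) (some k) +
      ∑ l, w l * (B.submatrix (fun k : {k // k ≠ l} => some k.1) fun k => some k.1).permanent := by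
  simp only [permanent, submatrix_apply]
  rw [sum_perm_option]
  simp only [prod_decomposeOption_none, prod_decomposeOption_some, sum_border_mul_prod_erase hB,
    sum_add_distrib, ← mul_sum]
  rw [add_assoc]
  congr 2
  rw [sum_comm]
  refine sum_congr rfl fun l _ => ?_
  rw [sum_perm_fixing, mul_sum]
  exact sum_congr rfl fun σ _ =>
    congrArg _ (prod_erase_ofSubtype (B.submatrix some some) l σ)

theorem det_option {B : Matrix (Option α) (Option α) R} {f w : α → R}
    (hB : ∀ i j, B (some i) none * B none (some j) =
      B (some i) (some j) * (f i - f j) + if i = j then w i else 0) :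
    B.det = B none none * (B.submatrix some some).det -
      ∑ l, w l * (B.submatrix (fun k : {k // k ≠ l} => some k.1) fun k => some k.1).det := by
  have hB' : ∀ i j, B (some i) none * B none (some j) =
      B (some i) (some j) * (f i - f j) + 0 + if i = j then w i else 0 := by simpa using hB
  have hsign : ∀ (σ : Perm α) l,
      Perm.sign (Perm.decomposeOption.symm (some (σ l), σ)) = -Perm.sign σ := by simp
  simp only [det_apply', submatrix_apply]
  rw [sum_perm_option]
  simp only [prod_decomposeOption_none, prod_decomposeOption_some, hsign,
    Perm.decomposeOption_symm_sign, Units.val_neg, Int.cast_neg, neg_mul, sum_neg_distrib,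
    ← mul_sum, sum_border_mul_prod_erase hB', zero_mul, zero_add]
  rw [← sub_eq_add_neg]
  congr 1
  · rw [mul_sum]
    exact sum_congr rfl fun σ _ => by ring
  simp only [mul_sum]
  rw [sum_comm]
  refine sum_congr rfl fun l _ => ?_
  simp only [mul_ite, mul_zero]
  rw [sum_perm_fixing]
  refine sum_congr rfl fun σ _ => ?_
  have := prod_erase_ofSubtype (B.submatrix some some) l σ
  simp only [submatrix_apply] at this
  rw [this, Perm.sign_ofSubtype]
  ring

/-- The matrix with entries `(x i + x j) / (x i - x j) + X` off the diagonal and `1 + X` on it. -/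
noncomputable def cothMatrix (x : α → K) : Matrix α α K[X] :=
  of fun i j => C ((x i + x j) / (x i - x j)) + X + if i = j then 1 else 0

/-- The specialization of `cothMatrix x` at `X = -1`. -/
def cauchyMatrix (x : α → K) : Matrix α α K := of fun i j => 2 * x j / (x i - x j)

theorem permanent_submatrix_equiv {β : Type*} [Fintype β] [DecidableEq β] (e : β ≃ α)
    (A : Matrix α α R) : (A.submatrix e e).permanent = A.permanent := by
  simp only [permanent, submatrix_apply]
  refine Fintype.sum_equiv (permCongr e) _ _ fun σ => ?_
  exact Fintype.prod_equiv e _ _ fun i => by simp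

theorem derivative_permanent_cothMatrix (x : α → K) :
    derivative (cothMatrix x).permanent =
      ∑ σ : Perm α, ∑ l, ∏ k ∈ univ.erase l, cothMatrix x (σ k) k := by
  simp only [permanent, derivative_sum, derivative_prod_finset]
  refine sum_congr rfl fun σ _ => sum_congr rfl fun l _ => ?_
  have : derivative (cothMatrix x (σ l) l) = 1 := by
    simp only [cothMatrix, of_apply]
    split_ifs <;> simp
  rw [this, mul_one]

theorem permanent_cothMatrix_option {x : Option α → K} (hx : Function.Injective x) :
    (cothMatrix x).permanent = (1 + X) * (cothMatrix (x ∘ some)).permanent +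
      (X ^ 2 - 1) * derivative (cothMatrix (x ∘ some)).permanent +
      ∑ l, C (1 - ((x (some l) + x none) / (x (some l) - x none)) ^ 2) *
        (cothMatrix fun k : {k // k ≠ l} => x (some k)).permanent := by
  rw [derivative_permanent_cothMatrix, permanent_option (B := cothMatrix x)
    (f := fun i => C ((x (some i) + x none) / (x (some i) - x none))) (d := X ^ 2 - 1)
    (w := fun l => C (1 - ((x (some l) + x none) / (x (some l) - x none)) ^ 2))]
  · have h1 : cothMatrix x none none = 1 + X := by simp [cothMatrix, add_comm]
    have h2 : (cothMatrix x).submatrix some some = cothMatrix (x ∘ some) := by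
      ext1; simp [cothMatrix]
    have h3 (l : α) : ((cothMatrix x).submatrix (fun k : {k // k ≠ l} => some k.1)
        fun k => some k.1) = cothMatrix fun k : {k // k ≠ l} => x (some k) := by
      ext1; simp [cothMatrix, Subtype.ext_iff]
    simp only [h1, h2, h3]
    simp [cothMatrix]
  · intro i j
    have hi : x (some i) - x none ≠ 0 := sub_ne_zero.2 (hx.ne (by simp))
    have hj : x (some j) - x none ≠ 0 := sub_ne_zero.2 (hx.ne (by simp))
    have hj' : (x none + x (some j)) / (x none - x (some j)) =
        -((x (some j) + x none) / (x (some j) - x none)) := by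
      rw [← neg_sub (x (some j)), div_neg, add_comm]
    by_cases h : i = j
    · subst h
      simp [cothMatrix, hj']
      ring
    · have hij : x (some i) - x (some j) ≠ 0 := sub_ne_zero.2 (hx.ne (by simpa using h))
      have key : -((x (some i) + x none) / (x (some i) - x none) *
          ((x (some j) + x none) / (x (some j) - x none))) =
          (x (some i) + x (some j)) / (x (some i) - x (some j)) *
          ((x (some i) + x none) / (x (some i) - x none) -
          (x (some j) + x none) / (x (some j) - x none)) - 1 := by
        field_simp
        ring
      have key' := congrArg (C : K → K[X]) key
      simp only [C_neg, C_mul, C_sub, C_1] at key'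
      simp only [cothMatrix, of_apply, hj', C_neg, h, Option.some.injEq, reduceCtorEq, if_false]
      linear_combination key'

theorem det_cauchyMatrix_option {x : Option α → K} (hx : Function.Injective x) :
    (cauchyMatrix x).det =
      -∑ l, (1 - ((x (some l) + x none) / (x (some l) - x none)) ^ 2) *
        (cauchyMatrix fun k : {k // k ≠ l} => x (some k)).det := by
  rw [det_option (B := cauchyMatrix x)
    (f := fun i => (x (some i) + x none) / (x (some i) - x none))
    (w := fun l => 1 - ((x (some l) + x none) / (x (some l) - x none)) ^ 2)]
  · have h1 : cauchyMatrix x none none = 0 := by simp [cauchyMatrix]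
    rw [h1, zero_mul, zero_sub]
    rfl
  · intro i j
    have hi : x (some i) - x none ≠ 0 := sub_ne_zero.2 (hx.ne (by simp))
    have hj : x (some j) - x none ≠ 0 := sub_ne_zero.2 (hx.ne (by simp))
    have hj' : x none - x (some j) ≠ 0 := sub_ne_zero.2 (hx.ne (by simp))
    by_cases h : i = j
    · subst h
      simp only [cauchyMatrix, of_apply, if_true, sub_self, div_zero, zero_mul, zero_add]
      field_simp
      ring
    · have hij : x (some i) - x (some j) ≠ 0 := sub_ne_zero.2 (hx.ne (by simpa using h))
      simp only [cauchyMatrix, of_apply, h, if_false]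
      field_simp
      ring

/-- Odd-size determinants of `cauchyMatrix x` vanish. The permanent of `cothMatrix x` is the
determinant of `cauchyMatrix x`, up to sign, plus a multiple `(1 + X) * g` where `g` has the parity
opposite to that of the size. -/
theorem permanent_cothMatrix_structure (m : ℕ) : ∀ {α : Type*} [Fintype α] [DecidableEq α]
    {x : α → K}, Function.Injective x → Fintype.card α = m →
    (Odd m → (cauchyMatrix x).det = 0) ∧
    ∃ g : K[X], (cothMatrix x).permanent =
        C ((-1) ^ (m / 2) * (cauchyMatrix x).det) + (1 + X) * g ∧
      g.comp (-X) = (-1) ^ (m + 1) * g := by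
  induction m using Nat.strong_induction_on with
  | _ m ih =>
  intro α _ _ x hx hm
  rcases m with _ | m
  · have : IsEmpty α := Fintype.card_eq_zero_iff.1 hm
    exact ⟨by simp, 0, by simp [permanent_isEmpty], by simp⟩
  obtain ⟨a⟩ : Nonempty α := Fintype.card_pos_iff.1 (by omega)
  let e := optionSubtypeNe a
  have hper : (cothMatrix x).permanent = (cothMatrix (x ∘ e)).permanent := by
    rw [← permanent_submatrix_equiv e]
    congr 1
    ext1; simp [cothMatrix]
  have hdet : (cauchyMatrix x).det = (cauchyMatrix (x ∘ e)).det :=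
    (det_submatrix_equiv_self e _).symm
  rw [hper, hdet]
  have hy : Function.Injective (x ∘ e) := hx.comp e.injective
  generalize x ∘ e = y at hy
  have hcard : Fintype.card {b // b ≠ a} = m := by simp [Fintype.card_subtype_compl, hm]
  clear hper hdet hx x e
  have hcard' (l : {b // b ≠ a}) : Fintype.card {k // k ≠ l} = m - 1 := by
    simp [Fintype.card_subtype_compl, hcard]
  have hpos (l : {b // b ≠ a}) : 0 < m := hcard ▸ Fintype.card_pos_iff.2 ⟨l⟩
  obtain ⟨h0, g, hg, hgp⟩ := ih m (by omega) (x := y ∘ some)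
    (hy.comp (Option.some_injective _)) hcard
  have IH (l : {b // b ≠ a}) := ih (m - 1) (by omega)
    (x := fun k : {k // k ≠ l} => y (some k))
    (hy.comp ((Option.some_injective _).comp Subtype.val_injective)) (hcard' l)
  choose hodd G hG hGp using IH
  rw [permanent_cothMatrix_option hy, det_cauchyMatrix_option hy]
  refine ⟨fun ho => ?_, ?_⟩
  · rw [neg_eq_zero]
    refine sum_eq_zero fun l _ => ?_
    have := hpos l
    rw [hodd l (by grind), mul_zero]
  set h := (-1) ^ (m / 2) * (cauchyMatrix (y ∘ some)).det with hh
  have hpar : (-1 : K[X]) ^ m * C h = C h := by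
    rcases Nat.even_or_odd m with he | ho
    · simp [he.neg_one_pow]
    · simp [hh, h0 ho]
  refine ⟨C h + 2 * X * g + (X ^ 2 - 1) * derivative g +
    ∑ l, C (1 - ((y (some l) + y none) / (y (some l) - y none)) ^ 2) * G l, ?_, ?_⟩
  · have hs : C ((-1) ^ ((m + 1) / 2) *
        -∑ l, (1 - ((y (some l) + y none) / (y (some l) - y none)) ^ 2) *
          (cauchyMatrix fun k : {k // k ≠ l} => y (some k)).det) =
        ∑ l, C (1 - ((y (some l) + y none) / (y (some l) - y none)) ^ 2) *
          C ((-1) ^ ((m - 1) / 2) *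
            (cauchyMatrix fun k : {k // k ≠ l} => y (some k)).det) := by
      rw [← sum_neg_distrib, mul_sum, map_sum]
      refine sum_congr rfl fun l _ => ?_
      have h2 : (m + 1) / 2 = (m - 1) / 2 + 1 := by have := hpos l; omega
      rw [h2, ← C_mul, pow_succ]
      congr 1
      ring
    rw [hs, hg]
    simp only [hG, mul_add, sum_add_distrib, derivative_add, derivative_mul, derivative_C,
      derivative_one, derivative_X, mul_sum]
    rw [sum_congr rfl fun l _ => mul_left_comm _ (1 + X : K[X]) (G l)]
    simp only [← mul_sum]
    ring
  · have hd : (derivative g).comp (-X) = (-1) ^ m * derivative g := by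
      have := congrArg derivative hgp
      rw [derivative_comp, ← C_1, ← C_neg, ← C_pow, derivative_C_mul] at this
      simp only [derivative_neg, derivative_X, C_neg, C_1, C_pow] at this
      rw [pow_succ] at this
      linear_combination -this
    simp only [add_comp, mul_comp, sub_comp, pow_comp, X_comp, C_comp, one_comp, ofNat_comp,
      Polynomial.sum_comp, hgp, hGp, hd, Nat.cast_ofNat]
    have hsum : ∑ l, C (1 - ((y (some l) + y none) / (y (some l) - y none)) ^ 2) *
        ((-1) ^ (m - 1 + 1) * G l) = (-1) ^ m *
        ∑ l, C (1 - ((y (some l) + y none) / (y (some l) - y none)) ^ 2) * G l := by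
      rw [mul_sum]
      refine sum_congr rfl fun l _ => ?_
      rw [Nat.sub_add_cancel (hpos l), mul_left_comm]
    rw [hsum]
    have h2 : (-1 : K[X]) ^ (m + 1 + 1) = (-1) ^ m := by ring
    rw [h2, pow_succ]
    linear_combination -hpar

theorem permanent_eq_det_cauchyMatrix [CharZero K] {x : α → K} (hx : Function.Injective x)
    {m : ℕ} (hm : Fintype.card α = 2 * m) :
    (of fun i j => if i = j then (1 : K) else (x i + x j) / (x i - x j)).permanent =
      (-1) ^ m * (cauchyMatrix x).det := by
  obtain ⟨-, g, hg, hgp⟩ := permanent_cothMatrix_structure (2 * m) hx hm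
  have h0 : g.eval 0 = 0 := by
    have := congrArg (eval 0) hgp
    simp only [eval_comp, eval_neg, eval_X, neg_zero, eval_mul, eval_pow, eval_one, pow_succ,
      pow_mul, pow_zero] at this
    simp only [mul_neg, mul_one, neg_neg, one_pow, neg_mul, one_mul] at this
    exact self_eq_neg.1 this
  have := congrArg (eval 0) hg
  rw [eval_add, eval_mul, h0, mul_zero, add_zero, eval_C, Nat.mul_div_cancel_left _ two_pos]
    at this
  rw [← this]
  simp only [permanent, eval_finsetSum, eval_prod]
  refine sum_congr rfl fun σ _ => prod_congr rfl fun k _ => ?_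
  simp only [cothMatrix, of_apply]
  split_ifs with h <;> simp [h]

section RootsOfUnity

variable {K : Type*} [Field K]

theorem _root_.IsPrimitiveRoot.pow_val_add {n : ℕ} [NeZero n] {ζ : K} (hζ : IsPrimitiveRoot ζ n)
    (i j : Fin n) : ζ ^ ((i + j : Fin n) : ℕ) = ζ ^ (i : ℕ) * ζ ^ (j : ℕ) := by
  rw [Fin.val_add, ← pow_add, pow_eq_pow_mod (_ + _) hζ.pow_eq_one]

theorem _root_.IsPrimitiveRoot.injective_pow_val {n : ℕ} {ζ : K} (hζ : IsPrimitiveRoot ζ n) :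
    Function.Injective fun i : Fin n => ζ ^ (i : ℕ) :=
  fun i j h => Fin.ext (hζ.pow_inj i.2 j.2 h)

theorem sum_cauchyMatrix_pow {n : ℕ} [NeZero n] {ζ : K} (h2 : (2 : K) ≠ 0)
    (hζ : IsPrimitiveRoot ζ n) (i : Fin n) :
    ∑ j, cauchyMatrix (fun k : Fin n => ζ ^ (k : ℕ)) i j = 1 - n := by
  set A := cauchyMatrix fun k : Fin n => ζ ^ (k : ℕ) with hA
  have hpair (j : Fin n) : A i j + A i (i + i - j) = if i = j then 0 else -2 := by
    split_ifs with h
    · subst h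
      simp [hA, cauchyMatrix]
    have hk : ζ ^ (j : ℕ) * ζ ^ ((i + i - j : Fin n) : ℕ) = ζ ^ (i : ℕ) * ζ ^ (i : ℕ) := by
      rw [← hζ.pow_val_add, ← hζ.pow_val_add]
      congr 2
      abel
    have hne : ζ ^ (i : ℕ) - ζ ^ (j : ℕ) ≠ 0 := sub_ne_zero.2 (hζ.injective_pow_val.ne h)
    have hne' : ζ ^ (i : ℕ) - ζ ^ ((i + i - j : Fin n) : ℕ) ≠ 0 := by
      refine sub_ne_zero.2 (hζ.injective_pow_val.ne fun h' => h ?_)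
      have : i = i + (i - j) := by rw [← add_sub_assoc]; exact h'
      exact sub_eq_zero.1 (left_eq_add.1 this)
    simp only [hA, cauchyMatrix, of_apply]
    field_simp
    linear_combination -hk
  have hsum := sum_congr rfl fun j (_ : j ∈ univ) => hpair j
  have hrefl : ∑ j, A i (i + i - j) = ∑ j, A i j :=
    (Equiv.subLeft (i + i)).sum_comp (A i)
  rw [sum_add_distrib, hrefl] at hsum
  have hcount : ∑ j : Fin n, (if i = j then (0 : K) else -2) = 2 * (1 - n) := by
    have (j : Fin n) : (if i = j then (0 : K) else -2) = (if i = j then 2 else 0) - 2 := by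
      split_ifs <;> ring
    simp only [this, sum_sub_distrib, sum_ite_eq, mem_univ, if_true, sum_const, card_univ,
      Fintype.card_fin, nsmul_eq_mul]
    ring
  rw [hcount, ← two_mul] at hsum
  exact mul_left_cancel₀ h2 hsum

/-- The powers of a primitive root of unity form an eigenvector of its Cauchy matrix. -/
theorem sum_cauchyMatrix_pow_mul_pow {n : ℕ} [NeZero n] {ζ : K} (h2 : (2 : K) ≠ 0)
    (hζ : IsPrimitiveRoot ζ n) (i : Fin n) {m : ℕ} (hm : m < n) :
    ∑ j, cauchyMatrix (fun k : Fin n => ζ ^ (k : ℕ)) i j * (ζ ^ (j : ℕ)) ^ m =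
      (2 * m + 1 - n) * (ζ ^ (i : ℕ)) ^ m := by
  induction m with
  | zero => simpa using sum_cauchyMatrix_pow h2 hζ i
  | succ m ih =>
    have hzero : ∑ j : Fin n, (ζ ^ (j : ℕ)) ^ (m + 1) = 0 := by
      rw [Fin.sum_univ_eq_sum_range (fun j => (ζ ^ j) ^ (m + 1))]
      simp only [pow_right_comm ζ _ (m + 1)]
      have h1 : ζ ^ (m + 1) ≠ 1 := hζ.pow_ne_one_of_pos_of_lt (by omega) hm
      rw [geom_sum_eq h1, pow_right_comm, hζ.pow_eq_one]
      simp
    have hstep (j : Fin n) : cauchyMatrix (fun k : Fin n => ζ ^ (k : ℕ)) i j *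
        (ζ ^ (j : ℕ)) ^ (m + 1) =
        ζ ^ (i : ℕ) * (cauchyMatrix (fun k : Fin n => ζ ^ (k : ℕ)) i j * (ζ ^ (j : ℕ)) ^ m) -
        2 * (ζ ^ (j : ℕ)) ^ (m + 1) + if i = j then 2 * (ζ ^ (i : ℕ)) ^ (m + 1) else 0 := by
      split_ifs with h
      · subst h
        simp [cauchyMatrix]
      · have hne : ζ ^ (i : ℕ) - ζ ^ (j : ℕ) ≠ 0 := sub_ne_zero.2 (hζ.injective_pow_val.ne h)
        simp only [cauchyMatrix, of_apply]
        field_simp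
        ring
    simp only [hstep, sum_add_distrib, sum_sub_distrib, ← mul_sum, ih (by omega), hzero,
      sum_ite_eq, mem_univ, if_true]
    push_cast
    ring

theorem det_cauchyMatrix_pow {n : ℕ} [NeZero n] {ζ : K} (h2 : (2 : K) ≠ 0)
    (hζ : IsPrimitiveRoot ζ n) :
    (cauchyMatrix fun k : Fin n => ζ ^ (k : ℕ)).det = ∏ m : Fin n, (2 * (m : K) + 1 - n) := by
  have hV : (vandermonde fun k : Fin n => ζ ^ (k : ℕ)).det ≠ 0 :=
    det_vandermonde_ne_zero_iff.2 hζ.injective_pow_val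
  refine mul_right_cancel₀ hV ?_
  rw [← det_mul, ← det_diagonal, mul_comm, ← det_mul]
  congr 1
  ext i m
  rw [mul_apply, mul_diagonal]
  simp only [vandermonde_apply]
  rw [sum_cauchyMatrix_pow_mul_pow h2 hζ i m.2, mul_comm]

theorem prod_range_odd_sub (k : ℕ) :
    ∏ m ∈ range (2 * k), (2 * (m : K) + 1 - (2 * k : ℕ)) =
      (-1) ^ k * (Nat.doubleFactorial (2 * k - 1) : K) ^ 2 := by
  have hfac : ∀ k : ℕ, (Nat.doubleFactorial (2 * k - 1) : K) = ∏ m ∈ range k, (2 * (m : K) + 1) := by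
    intro k
    induction k with
    | zero => simp
    | succ k ih =>
      rw [prod_range_succ, ← ih]
      rcases k with _ | k
      · simp
      · have h1 : 2 * (k + 1 + 1) - 1 = 2 * (k + 1) - 1 + 2 := by omega
        have h2 : 2 * (k + 1) - 1 + 2 = 2 * (k + 1) + 1 := by omega
        rw [h1, Nat.doubleFactorial_add_two, h2]
        push_cast
        ring
  rw [two_mul k, prod_range_add, ← two_mul, hfac, sq, ← mul_assoc]
  congr 1
  · rw [← prod_range_reflect, ← card_range k, ← prod_const, card_range, ← prod_mul_distrib]
    refine prod_congr rfl fun m hm => ?_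
    have : m + 1 ≤ k := mem_range.1 hm
    rw [Nat.sub_sub, add_comm 1 m, Nat.cast_sub this]
    push_cast
    ring
  · refine prod_congr rfl fun m _ => ?_
    push_cast
    ring

end RootsOfUnity

end Matrix

/- For an even integer `n > 1` and `ζ` a primitive `n`-th root of unity in `ℂ`, the permanent
of the `n × n` matrix with entries `(1 + ζ^{j-k})/(1 - ζ^{j-k})` off the diagonal and `1` on
the diagonal equals `((n-1)!!)^2`. -/
theorem permanent_root_of_unity_matrix_even (n : ℕ) (hn : 1 < n) (heven : Even n)
    (ζ : ℂ) (hζ : IsPrimitiveRoot ζ n) :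
    Matrix.permanent (Matrix.of fun j k : Fin n =>
        if j = k then (1 : ℂ)
        else (1 + ζ ^ ((j : ℤ) - (k : ℤ))) / (1 - ζ ^ ((j : ℤ) - (k : ℤ)))) =
      (Nat.doubleFactorial (n - 1) : ℂ) ^ 2 := by
  have : NeZero n := ⟨by omega⟩
  obtain ⟨k, rfl⟩ := even_iff_exists_two_mul.1 heven
  have hζ0 : ζ ≠ 0 := hζ.ne_zero (by omega)
  have hper := Matrix.permanent_eq_det_cauchyMatrix hζ.injective_pow_val (Fintype.card_fin _)
  rw [Matrix.det_cauchyMatrix_pow two_ne_zero hζ,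
    Fin.prod_univ_eq_prod_range (fun m => 2 * (m : ℂ) + 1 - (2 * k : ℕ)) (2 * k),
    Matrix.prod_range_odd_sub, ← mul_assoc, ← mul_pow, neg_one_mul, neg_neg, one_pow, one_mul]
    at hper
  rw [← hper, ← Matrix.permanent_transpose]
  congr 1
  ext i j
  simp only [Matrix.transpose_apply, Matrix.of_apply, eq_comm (a := j)]
  split_ifs with h
  · rfl
  have hi : ζ ^ (i : ℕ) ≠ 0 := pow_ne_zero _ hζ0
  rw [zpow_sub₀ hζ0, zpow_natCast, zpow_natCast, one_add_div hi, one_sub_div hi,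
    div_div_div_cancel_right₀ hi]
end

section
/- Let n > 1 be an odd integer and ζ a primitive n-th root of unity in ℂ. Define c_{j,k} = (1 + ζ^{j-k})/(1 - ζ^{j-k}) for j ≠ k and c_{j,j} = 1. Then the permanent of the (n-1)×(n-1) matrix [c_{j,k}]_{1≤j,k≤n-1} equals ((n-1)!!)^2 / n. -/
open Equiv Finset Polynomial

namespace Matrix

/-- The matrix has unit diagonal, is skew-symmetric off the diagonal, and its off-diagonal entries
obey the addition law of the hyperbolic cotangent. -/
structure IsSkewCoth {α R : Type*} [CommRing R] (A : Matrix α α R) : Prop where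
  diag (i : α) : A i i = 1
  skew {i j : α} (h : i ≠ j) : A j i = -A i j
  add {i j p : α} (hi : i ≠ p) (hj : j ≠ p) (hij : i ≠ j) :
    A i p * A p j = A i j * (A i p - A j p) - 1

theorem IsSkewCoth.submatrix {α β R : Type*} [CommRing R] {A : Matrix α α R}
    (hA : A.IsSkewCoth) {f : β → α} (hf : f.Injective) : (A.submatrix f f).IsSkewCoth where
  diag _ := hA.diag _
  skew h := hA.skew (hf.ne h)
  add hi hj hij := hA.add (hf.ne hi) (hf.ne hj) (hf.ne hij)

variable {α β R : Type*} [Fintype α] [DecidableEq α] [Fintype β] [DecidableEq β] [CommRing R]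

/-- The sum over all permutations weighted by the `e`-th power of their sign: the permanent for
`e = 0`, the determinant for `e = 1`. -/
def signedPermanent (e : ℕ) (M : Matrix α α R) : R :=
  ∑ σ : Perm α, ((Perm.sign σ : ℤ) : R) ^ e * ∏ i, M (σ i) i

theorem signedPermanent_zero (M : Matrix α α R) : M.signedPermanent 0 = M.permanent := by
  simp [signedPermanent, permanent]

theorem signedPermanent_one (M : Matrix α α R) : M.signedPermanent 1 = M.det := by
  simp [signedPermanent, det_apply']

theorem signedPermanent_submatrix_equiv (e : ℕ) (f : β ≃ α) (M : Matrix α α R) :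
    (M.submatrix f f).signedPermanent e = M.signedPermanent e := by
  unfold signedPermanent
  refine Fintype.sum_equiv f.permCongr _ _ fun σ => ?_
  rw [Perm.sign_permCongr, ← f.prod_comp]
  simp

theorem map_signedPermanent {S : Type*} [CommRing S] (φ : R →+* S) (e : ℕ) (M : Matrix α α R) :
    φ (M.signedPermanent e) = (M.map φ).signedPermanent e := by
  simp [signedPermanent]

/-- Expansion along the decomposition of `Perm (Option α)`, where a permutation of `Option α`
arises from one of `α` by adding `none` as a fixed point or inserting it into a cycle. -/
theorem signedPermanent_option (e : ℕ) (M : Matrix (Option α) (Option α) R) :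
    M.signedPermanent e =
      M none none * (M.submatrix some some).signedPermanent e +
      (-1) ^ e * ∑ σ : Perm α, ((Perm.sign σ : ℤ) : R) ^ e *
        ∑ i, (∏ k ∈ univ.erase i, M (some (σ k)) (some k)) *
          (M (some (σ i)) none * M none (some i)) := by
  unfold signedPermanent
  rw [← Perm.decomposeOption.symm.sum_comp, Fintype.sum_prod_type, Fintype.sum_option]
  congr 1
  · rw [mul_sum]
    refine sum_congr rfl fun σ _ => ?_
    simp [Fintype.prod_option]
    ring
  · rw [sum_comm, mul_sum]
    refine sum_congr rfl fun σ _ => ?_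
    rw [← mul_assoc, mul_sum, ← Equiv.sum_comp σ]
    refine sum_congr rfl fun i _ => ?_
    have h : ∀ k ∈ univ.erase i,
        Equiv.swap none (some (σ i)) (some (σ k)) = some (σ k) := fun k hk =>
      swap_apply_of_ne_of_ne (by simp) (by simpa using (mem_erase.1 hk).1)
    rw [Fintype.prod_option, ← mul_prod_erase univ _ (mem_univ i)]
    simp only [Perm.decomposeOption_symm_apply, Perm.coe_mul, Function.comp_apply,
      optionCongr_apply, Option.map_none, Option.map_some, swap_apply_left, swap_apply_right,
      Perm.sign_mul, Perm.sign_swap (Option.some_ne_none _).symm, optionCongr_sign]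
    rw [prod_congr rfl fun k hk => by rw [h k hk]]
    push_cast
    ring

theorem signedPermanent_submatrix_ne (e : ℕ) (M : Matrix α α R) (i : α) :
    (M.submatrix (Subtype.val : {k // k ≠ i} → α) Subtype.val).signedPermanent e =
      ∑ σ : Perm α, ((Perm.sign σ : ℤ) : R) ^ e *
        ((∏ k ∈ univ.erase i, M (σ k) k) * if σ i = i then 1 else 0) := by
  have h := signedPermanent_submatrix_equiv e (optionSubtypeNe i) (M.updateCol i (Pi.single i 1))
  rw [signedPermanent_option] at h
  have h0 : ∀ k : {k // k ≠ i}, (M.updateCol i (Pi.single i 1)) k i = 0 := fun k => by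
    simp [k.2]
  simp only [submatrix_apply, optionSubtypeNe_none, optionSubtypeNe_some, h0, zero_mul, mul_zero,
    sum_const_zero, add_zero] at h
  rw [updateCol_self, Pi.single_eq_same, one_mul] at h
  have h1 : ((M.updateCol i (Pi.single i 1)).submatrix (optionSubtypeNe i)
      (optionSubtypeNe i)).submatrix some some =
      M.submatrix (Subtype.val : {k // k ≠ i} → α) Subtype.val := by
    ext k l
    simp [l.2]
  rw [← h1, h]
  unfold signedPermanent
  refine sum_congr rfl fun σ _ => ?_
  rw [← prod_erase_mul univ _ (mem_univ i), updateCol_self, Pi.single_apply]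
  congr 2
  exact prod_congr rfl fun k hk => updateCol_ne (mem_erase.1 hk).1

/-- The `signedPermanent` of `A` with the indeterminate added to every entry. -/
noncomputable def signedPermanentShift (e : ℕ) (A : Matrix α α R) : R[X] :=
  (of fun i j => X + C (A i j)).signedPermanent e

theorem signedPermanentShift_submatrix_equiv (e : ℕ) (f : β ≃ α) (A : Matrix α α R) :
    (A.submatrix f f).signedPermanentShift e = A.signedPermanentShift e := by
  have h : (of fun i j => (X + C (A.submatrix f f i j) : R[X])) =
      (of fun i j => (X + C (A i j) : R[X])).submatrix f f := rfl
  rw [signedPermanentShift, h, signedPermanent_submatrix_equiv, signedPermanentShift]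

theorem eval_signedPermanentShift (e : ℕ) (A : Matrix α α R) (r : R) :
    (A.signedPermanentShift e).eval r = (of fun i j => r + A i j).signedPermanent e := by
  rw [signedPermanentShift, ← coe_evalRingHom, map_signedPermanent]
  congr 1
  ext i j
  simp

theorem derivative_signedPermanentShift (e : ℕ) (A : Matrix α α R) :
    derivative (A.signedPermanentShift e) =
      ∑ σ : Perm α, ((Perm.sign σ : ℤ) : R[X]) ^ e *
        ∑ i, ∏ k ∈ univ.erase i, (X + C (A (σ k) k)) := by
  unfold signedPermanentShift signedPermanent
  rw [derivative_sum]
  refine sum_congr rfl fun σ _ => ?_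
  have : ((Perm.sign σ : ℤ) : R[X]) ^ e = C (((Perm.sign σ : ℤ) : R) ^ e) := by simp
  rw [this, derivative_C_mul, derivative_prod_finset]
  simp

theorem IsSkewCoth.signedPermanentShift_option {A : Matrix (Option α) (Option α) R}
    (hA : A.IsSkewCoth) (e : ℕ) :
    A.signedPermanentShift e =
      (X + 1) * (A.submatrix some some).signedPermanentShift e +
      (-1) ^ e * ((X ^ 2 - 1) * derivative ((A.submatrix some some).signedPermanentShift e) +
        ∑ i, C (1 - A (some i) none ^ 2) *
          ((A.submatrix some some).submatrix (Subtype.val : {k // k ≠ i} → α)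
            Subtype.val).signedPermanentShift e) := by
  have key (i j : α) : (X + C (A (some j) none)) * (X + C (A none (some i))) =
      (X ^ 2 - 1 : R[X]) +
        (X + C (A (some j) (some i))) * (C (A (some j) none) - C (A (some i) none)) +
        C (1 - A (some i) none ^ 2) * if j = i then 1 else 0 := by
    have h1 : A none (some i) = -A (some i) none := hA.skew (by simp)
    rcases eq_or_ne j i with rfl | hij
    · simp [h1]
      ring
    · have h2 := congrArg (C : R → R[X])
        (hA.add (i := some j) (j := some i) (p := none) (by simp) (by simp) (by simpa using hij))
      rw [if_neg hij, h1] at *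
      simp only [map_mul, map_sub, map_neg, map_one] at h2 ⊢
      linear_combination h2
  have htel (σ : Perm α) : ∑ i, (∏ k ∈ univ.erase i, (X + C (A (some (σ k)) (some k)))) *
      ((X + C (A (some (σ i)) none)) * (X + C (A none (some i)))) =
      (X ^ 2 - 1) * (∑ i, ∏ k ∈ univ.erase i, (X + C (A (some (σ k)) (some k)))) +
      ∑ i, C (1 - A (some i) none ^ 2) *
        ((∏ k ∈ univ.erase i, (X + C (A (some (σ k)) (some k)))) *
          if σ i = i then 1 else 0) := by
    have h0 : ∑ i, (∏ k, (X + C (A (some (σ k)) (some k)))) *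
        (C (A (some (σ i)) none) - C (A (some i) none)) = 0 := by
      rw [← mul_sum, sum_sub_distrib, Equiv.sum_comp σ (fun i => C (A (some i) none)), sub_self,
        mul_zero]
    rw [← sub_eq_zero, mul_sum, ← sum_add_distrib, ← sum_sub_distrib]
    refine Eq.trans (sum_congr rfl fun i _ => ?_) h0
    rw [key, ← prod_erase_mul univ _ (mem_univ i)]
    ring
  rw [derivative_signedPermanentShift, signedPermanentShift, signedPermanent_option]
  congr 1
  · simp only [of_apply, hA.diag, map_one]
    rfl
  · congr 1
    simp only [of_apply, htel]
    simp only [mul_add, sum_add_distrib]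
    congr 1
    · rw [mul_sum]
      exact sum_congr rfl fun σ _ => mul_left_comm _ _ _
    · have hsub (i : α) := signedPermanent_submatrix_ne e
        (of fun i j => (X + C (A (some i) (some j)) : R[X])) i
      have hshift (i : α) : ((A.submatrix some some).submatrix (Subtype.val : {k // k ≠ i} → α)
          Subtype.val).signedPermanentShift e =
          ((of fun i j => (X + C (A (some i) (some j)) : R[X])).submatrix
            (Subtype.val : {k // k ≠ i} → α) Subtype.val).signedPermanent e := by
        rw [signedPermanentShift]
        congr 1
      simp only [hshift, hsub, mul_sum, of_apply]
      rw [sum_comm]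
      exact sum_congr rfl fun i _ => sum_congr rfl fun σ _ => mul_left_comm _ _ _

theorem IsSkewCoth.signedPermanentShift_eq {A : Matrix α α R} (hA : A.IsSkewCoth) (e : ℕ)
    (a : α) :
    A.signedPermanentShift e =
      (X + 1) * (A.submatrix (Subtype.val : {b // b ≠ a} → α) Subtype.val).signedPermanentShift e +
      (-1) ^ e * ((X ^ 2 - 1) * derivative ((A.submatrix (Subtype.val : {b // b ≠ a} → α)
          Subtype.val).signedPermanentShift e) +
        ∑ i, C (1 - A (Subtype.val i) a ^ 2) *
          ((A.submatrix (Subtype.val : {b // b ≠ a} → α) Subtype.val).submatrix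
            (Subtype.val : {k // k ≠ i} → {b // b ≠ a}) Subtype.val).signedPermanentShift e) := by
  rw [← signedPermanentShift_submatrix_equiv e (optionSubtypeNe a),
    (hA.submatrix (optionSubtypeNe a).injective).signedPermanentShift_option]
  rfl

theorem IsSkewCoth.eval_neg_one_signedPermanentShift_one (m : ℕ) :
    ∀ {α : Type*} [Fintype α] [DecidableEq α] {A : Matrix α α R}, A.IsSkewCoth →
      Fintype.card α = 2 * m →
      (A.signedPermanentShift 1).eval (-1) = (-1) ^ m * (A.signedPermanentShift 0).eval (-1) := by
  induction m with
  | zero =>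
    intro α _ _ A _ h
    have := Fintype.card_eq_zero_iff.1 h
    simp [signedPermanentShift, signedPermanent]
  | succ m ih =>
    intro α _ _ A hA h
    obtain ⟨a⟩ : Nonempty α := Fintype.card_pos_iff.1 (by omega)
    simp only [hA.signedPermanentShift_eq _ a, eval_add, eval_mul, eval_finsetSum, eval_sub,
      eval_pow, eval_X, eval_one, eval_C, eval_neg]
    have hcard (i : {b // b ≠ a}) : Fintype.card {k // k ≠ i} = 2 * m := by
      simp [h]
      omega
    have ih' (i : {b // b ≠ a}) := ih ((hA.submatrix Subtype.val_injective).submatrix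
      (Subtype.val_injective (p := (· ≠ i)))) (hcard i)
    simp only [ih', mul_left_comm _ ((-1 : R) ^ m), ← mul_sum]
    ring

/-- Up to a constant, `signedPermanentShift 0 A` is `X + 1` times a polynomial of parity opposite
to that of the size of `A`. -/
theorem IsSkewCoth.exists_signedPermanentShift_zero_eq (m : ℕ) :
    ∀ {α : Type*} [Fintype α] [DecidableEq α] {A : Matrix α α R}, A.IsSkewCoth →
      Fintype.card α = m →
      ∃ (h : R) (p : R[X]), A.signedPermanentShift 0 = C h + (X + 1) * p ∧
        p.comp (-X) = -(-1) ^ m * p ∧ (Odd m → h = 0) := by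
  induction m using Nat.strong_induction_on with
  | _ m ih =>
  intro α _ _ A hA hα
  rcases m with _ | m
  · have := Fintype.card_eq_zero_iff.1 hα
    exact ⟨1, 0, by simp [signedPermanentShift, signedPermanent]⟩
  obtain ⟨a⟩ : Nonempty α := Fintype.card_pos_iff.1 (by omega)
  have hβ : Fintype.card {b // b ≠ a} = m := by simp [hα]
  obtain ⟨h, p, hp, hpar, hodd⟩ := ih m (by omega) (hA.submatrix Subtype.val_injective) hβ
  have hm (i : {b // b ≠ a}) : 0 < m := hβ ▸ Fintype.card_pos_iff.2 ⟨i⟩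
  have hγ (i : {b // b ≠ a}) : Fintype.card {k // k ≠ i} = m - 1 := by simp [hα]
  have ih' (i : {b // b ≠ a}) := ih (m - 1) (by omega)
    ((hA.submatrix Subtype.val_injective).submatrix (Subtype.val_injective (p := (· ≠ i)))) (hγ i)
  choose g q hq hqpar hqodd using ih'
  refine ⟨∑ i, (1 - A (Subtype.val i) a ^ 2) * g i,
    C h + 2 * X * p + (X ^ 2 - 1) * derivative p + ∑ i, C (1 - A (Subtype.val i) a ^ 2) * q i,
    ?_, ?_, fun hm1 => ?_⟩
  · have hsum : ∑ i, C (1 - A (Subtype.val i) a ^ 2) * (C (g i) + (X + 1) * q i) =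
        C (∑ i, (1 - A (Subtype.val i) a ^ 2) * g i) +
          (X + 1) * ∑ i, C (1 - A (Subtype.val i) a ^ 2) * q i := by
      rw [map_sum, mul_sum, ← sum_add_distrib]
      refine sum_congr rfl fun i _ => ?_
      rw [C_mul]
      ring
    rw [hA.signedPermanentShift_eq 0 a, hp]
    simp only [hq, hsum, derivative_add, derivative_C, derivative_mul, derivative_X,
      derivative_one]
    ring
  · have hder : (derivative p).comp (-X) = (-1) ^ m * derivative p := by
      have := congrArg derivative hpar
      have hC : (-(-1) ^ m : R[X]) = C (-(-1) ^ m) := by simp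
      rw [hC, derivative_C_mul, derivative_comp, ← hC] at this
      simp only [derivative_neg, derivative_X] at this
      linear_combination -this
    have hh : (C h : R[X]) = (-1) ^ m * C h := by
      rcases m.even_or_odd with hm | hm
      · simp [hm.neg_one_pow]
      · simp [hodd hm]
    have hsum : (∑ i, C (1 - A (Subtype.val i) a ^ 2) * q i).comp (-X) =
        (-1) ^ m * ∑ i, C (1 - A (Subtype.val i) a ^ 2) * q i := by
      rw [Polynomial.sum_comp, mul_sum]
      refine sum_congr rfl fun i _ => ?_
      obtain ⟨k, rfl⟩ := Nat.exists_eq_add_of_lt (hm i)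
      rw [mul_comp, C_comp, hqpar]
      simp only [zero_add, Nat.add_sub_cancel]
      ring
    simp only [add_comp, mul_comp, C_comp, X_comp, sub_comp, pow_comp, one_comp, hder, hpar,
      hsum, ofNat_comp]
    linear_combination hh
  · refine sum_eq_zero fun i _ => ?_
    rw [hqodd i, mul_zero]
    have := hm i
    rcases hm1 with ⟨k, hk⟩
    exact ⟨k - 1, by omega⟩

theorem IsSkewCoth.permanent_eq_det [NoZeroDivisors R] [CharZero R] {A : Matrix α α R}
    (hA : A.IsSkewCoth) {m : ℕ} (hm : Fintype.card α = 2 * m) :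
    A.permanent = (-1) ^ m * (of fun i j => A i j - 1).det := by
  obtain ⟨h, p, hp, hpar, -⟩ := IsSkewCoth.exists_signedPermanentShift_zero_eq _ hA hm
  have hp0 : p.eval 0 = 0 := by
    have := congrArg (eval 0) hpar
    simpa [eval_comp, self_eq_neg] using this
  have h0 : A.permanent = h := by
    have := eval_signedPermanentShift 0 A 0
    rw [hp] at this
    simp only [zero_add, signedPermanent_zero] at this
    exact this.symm.trans (by simp [hp0])
  have h1 : (of fun i j => A i j - 1).det = (-1) ^ m * h := by
    have := eval_signedPermanentShift 1 A (-1)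
    rw [hA.eval_neg_one_signedPermanentShift_one m hm, hp, signedPermanent_one] at this
    simp only [neg_add_eq_sub] at this
    rw [← this]
    simp
  rw [h0, h1, ← mul_assoc, ← mul_pow]
  simp

end Matrix

open Matrix hiding zpow_mul one_zpow

theorem sum_range_mul_pow_of_pow_eq_one {K : Type*} [Field K] {z : K} {n : ℕ} (hz : z ≠ 1)
    (hn : z ^ n = 1) :
    ∑ r ∈ range n, ((n : K) - 1 - 2 * r) * z ^ (r + 1) = n * (2 * z / (1 - z)) := by
  have h (m : ℕ) : (∑ r ∈ range m, ((n : K) - 1 - 2 * r) * z ^ (r + 1)) * (1 - z) ^ 2 =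
      z * ((n - 1) * (1 - z) * (1 - z ^ m) - 2 * (z - m * z ^ m + (m - 1) * z ^ (m + 1))) := by
    induction m with
    | zero => simp
    | succ m ih =>
      rw [sum_range_succ, add_mul, ih]
      push_cast
      ring
  have hz' : 1 - z ≠ 0 := sub_ne_zero.2 hz.symm
  have := h n
  rw [pow_succ z, hn] at this
  field_simp
  refine mul_right_cancel₀ hz' ?_
  linear_combination this

theorem sum_range_cast_sub_one_sub_two_mul {K : Type*} [CommRing K] (n : ℕ) :
    ∑ r ∈ range n, ((n : K) - 1 - 2 * r) = 0 := by
  have h (m : ℕ) : ∑ r ∈ range m, ((n : K) - 1 - 2 * r) = m * (n - m) := by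
    induction m with
    | zero => simp
    | succ m ih =>
      rw [sum_range_succ, ih]
      push_cast
      ring
  simpa using h n

theorem prod_erase_two_mul_sub (K : Type*) [CommRing K] (t : ℕ) :
    ∏ r ∈ (range (2 * t + 1)).erase t, ((2 * t : K) - 2 * r) =
      (-1) ^ t * ((2 * t).doubleFactorial : K) ^ 2 := by
  have hs : (range (2 * t + 1)).erase t = range t ∪ (range t).image (t + 1 + ·) := by
    ext r
    simp only [mem_erase, mem_range, mem_union, mem_image]
    constructor
    · rintro ⟨h1, h2⟩
      rcases lt_or_gt_of_ne h1 with h | h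
      · exact Or.inl h
      · exact Or.inr ⟨r - (t + 1), by omega, by omega⟩
    · rintro (h | ⟨k, h, rfl⟩) <;> omega
  have hd : Disjoint (range t) ((range t).image (t + 1 + ·)) := by
    rw [Finset.disjoint_left]
    simp only [mem_range, mem_image, not_exists, not_and]
    omega
  have h1 : ∏ r ∈ range t, ((2 * t : K) - 2 * r) = ((2 * t).doubleFactorial : K) := by
    rw [Nat.doubleFactorial_eq_prod_even, ← prod_range_reflect]
    push_cast
    refine prod_congr rfl fun r hr => ?_
    have := mem_range.1 hr
    have : ((t - 1 - r : ℕ) : K) = t - 1 - r := by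
      rw [Nat.cast_sub (by omega), Nat.cast_sub (by omega), Nat.cast_one]
    rw [this]
    ring
  have h2 : ∏ r ∈ range t, ((2 * t : K) - 2 * (t + 1 + r : ℕ)) =
      (-1) ^ t * ((2 * t).doubleFactorial : K) := by
    rw [Nat.doubleFactorial_eq_prod_even]
    push_cast
    have h : (-1 : K) ^ t = ∏ r ∈ range t, (-1) := by simp
    rw [h, ← prod_mul_distrib]
    exact prod_congr rfl fun r _ => by ring
  rw [hs, prod_union hd, prod_image (by simp), h1, h2]
  ring

namespace IsPrimitiveRoot

variable {K : Type*} [Field K] {ζ : K} {n : ℕ}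

theorem zpow_sub_ne_one (hζ : IsPrimitiveRoot ζ n) {i j : ℕ} (hi : i < n) (hj : j < n)
    (hij : i ≠ j) : ζ ^ ((i : ℤ) - j) ≠ 1 := by
  rw [Ne, hζ.zpow_eq_one_iff_dvd]
  intro h
  have := Int.eq_zero_of_abs_lt_dvd h (by rw [abs_lt]; omega)
  omega

theorem isSkewCoth (hζ : IsPrimitiveRoot ζ n) {m : ℕ} (hm : m ≤ n) :
    (of fun j k : Fin m => if j = k then (1 : K) else
      (1 + ζ ^ ((j : ℤ) - (k : ℤ))) / (1 - ζ ^ ((j : ℤ) - (k : ℤ)))).IsSkewCoth := by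
  have hne (i j : Fin m) (hij : i ≠ j) : 1 - ζ ^ ((i : ℤ) - (j : ℤ)) ≠ 0 :=
    sub_ne_zero.2 (hζ.zpow_sub_ne_one (i.2.trans_le hm) (j.2.trans_le hm)
      (Fin.val_injective.ne hij)).symm
  have h0 (i j : Fin m) : ζ ≠ 0 := hζ.ne_zero (by have := i.2; omega)
  refine ⟨fun i => by simp, fun {i j} h => ?_, fun {i j p} hi hj hij => ?_⟩
  · simp only [of_apply, if_neg h, if_neg h.symm]
    have h1 := hne i j h
    have h2 := hne j i h.symm
    have h3 : ζ ^ ((i : ℤ) - j) * ζ ^ ((j : ℤ) - i) = 1 := by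
      rw [← zpow_add₀ (h0 i j)]
      simp
    field_simp
    linear_combination -2 * h3
  · simp only [of_apply, if_neg hi, if_neg hj, if_neg hij, if_neg hj.symm]
    have h1 := hne i p hi
    have h2 := hne j p hj
    have h3 := hne i j hij
    have h4 := hne p j hj.symm
    have h5 : ζ ^ ((i : ℤ) - j) = ζ ^ ((i : ℤ) - p) * ζ ^ ((p : ℤ) - j) := by
      rw [← zpow_add₀ (h0 i j)]
      simp
    have h6 : ζ ^ ((p : ℤ) - j) * ζ ^ ((j : ℤ) - p) = 1 := by
      rw [← zpow_add₀ (h0 i j)]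
      simp
    have h7 : (1 + ζ ^ ((j : ℤ) - p)) / (1 - ζ ^ ((j : ℤ) - p)) =
        -((1 + ζ ^ ((p : ℤ) - j)) / (1 - ζ ^ ((p : ℤ) - j))) := by
      field_simp
      linear_combination -2 * h6
    rw [h7]
    rw [h5] at h3 ⊢
    generalize ζ ^ ((i : ℤ) - p) = x at *
    generalize ζ ^ ((p : ℤ) - j) = y at *
    field_simp
    ring

theorem det_two_mul_div_one_sub [CharZero K] {t : ℕ} (hζ : IsPrimitiveRoot ζ (2 * t + 1)) :
    (of fun j k : Fin (2 * t) =>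
      2 * ζ ^ ((j : ℤ) - (k : ℤ)) / (1 - ζ ^ ((j : ℤ) - (k : ℤ)))).det =
      (-1) ^ t * ((2 * t).doubleFactorial : K) ^ 2 / (2 * t + 1 : ℕ) := by
  have h0 : ζ ≠ 0 := hζ.ne_zero (by omega)
  have hn : ((2 * t + 1 : ℕ) : K) ≠ 0 := Nat.cast_ne_zero.2 (by omega)
  set n := 2 * t + 1 with hnt
  let B : Matrix (Fin n) (Fin n) K := of fun j k =>
    2 * ζ ^ ((j : ℤ) - (k : ℤ)) / (1 - ζ ^ ((j : ℤ) - (k : ℤ)))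
  let F : Matrix (Fin n) (Fin n) K := of fun j r => ζ ^ ((j : ℤ) * (r + 1))
  let G : Matrix (Fin n) (Fin n) K := of fun r k => ζ ^ (-(k : ℤ) * (r + 1)) / n
  let d : Fin n → K := fun r => n - 1 - 2 * (r : ℕ)
  have hterm (j k r : Fin n) : F j r * G r k = (ζ ^ ((j : ℤ) - k)) ^ ((r : ℕ) + 1) / n := by
    simp only [F, G, of_apply, ← mul_div_assoc, ← zpow_add₀ h0, ← zpow_natCast (ζ ^ ((j : ℤ) - k)),
      ← zpow_mul ζ]
    congr 2
    push_cast
    ring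
  have hpow (j k : Fin n) : (ζ ^ ((j : ℤ) - k)) ^ n = 1 := by
    rw [← zpow_natCast, ← zpow_mul, mul_comm, zpow_mul, zpow_natCast, hζ.pow_eq_one,
      one_zpow]
  have hFG : F * G = 1 := by
    ext j k
    rw [mul_apply, sum_congr rfl fun r _ => hterm j k r,
      Fin.sum_univ_eq_sum_range (fun r => (ζ ^ ((j : ℤ) - k)) ^ (r + 1) / (n : K)), ← sum_div]
    rcases eq_or_ne j k with rfl | hjk
    · simp [hn]
    · have h1 := hζ.zpow_sub_ne_one j.2 k.2 (Fin.val_injective.ne hjk)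
      simp_rw [pow_succ, ← sum_mul]
      rw [geom_sum_eq h1, hpow]
      simp [hjk]
  have hB : B = F * diagonal d * G := by
    ext j k
    rw [mul_apply]
    simp only [mul_diagonal]
    rw [sum_congr rfl fun r _ => show F j r * d r * G r k =
      ((n : K) - 1 - 2 * (r : ℕ)) * (ζ ^ ((j : ℤ) - k)) ^ ((r : ℕ) + 1) / n by
        rw [mul_right_comm, hterm]; ring,
      Fin.sum_univ_eq_sum_range
        (fun r => ((n : K) - 1 - 2 * r) * (ζ ^ ((j : ℤ) - k)) ^ (r + 1) / (n : K)), ← sum_div]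
    rcases eq_or_ne j k with rfl | hjk
    · simp only [sub_self, zpow_zero, one_pow, mul_one, sum_range_cast_sub_one_sub_two_mul]
      simp [B]
    · rw [sum_range_mul_pow_of_pow_eq_one
        (hζ.zpow_sub_ne_one j.2 k.2 (Fin.val_injective.ne hjk)) (hpow j k)]
      simp only [B, of_apply]
      field_simp
  let c : Fin n := ⟨t, by omega⟩
  have hdc : d c = 0 := by
    simp only [d, c, hnt]
    push_cast
    ring
  have hadj : adjugate (diagonal d) =
      diagonal (Pi.single c ((-1) ^ t * ((2 * t).doubleFactorial : K) ^ 2)) := by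
    rw [adjugate_diagonal]
    congr 1
    ext r
    rcases eq_or_ne r c with rfl | hr
    · rw [Pi.single_eq_same, ← prod_erase_two_mul_sub]
      refine prod_bij (fun r _ => (r : ℕ)) (fun r hr => ?_) (fun r _ s _ h => Fin.ext h)
        (fun r hr => ?_) (fun r _ => ?_)
      · have := (mem_erase.1 hr).1
        simp only [mem_erase, mem_range, Ne, Fin.ext_iff, c] at this ⊢
        exact ⟨this, r.2⟩
      · simp only [mem_erase, mem_range] at hr
        exact ⟨⟨r, hr.2⟩, by simp [Fin.ext_iff, c, hr.1], rfl⟩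
      · simp only [d, hnt]
        push_cast
        ring
    · rw [Pi.single_eq_of_ne hr]
      exact prod_eq_zero (mem_erase.2 ⟨hr.symm, mem_univ c⟩) hdc
  have hG : adjugate G = G.det • F := by
    rw [← mul_one (adjugate G), ← mul_eq_one_comm.1 hFG, ← mul_assoc, adjugate_mul]
    simp
  have hF : adjugate F = F.det • G := by
    rw [← one_mul (adjugate F), ← mul_eq_one_comm.1 hFG, mul_assoc, mul_adjugate]
    simp
  have hdet : F.det * G.det = 1 := by rw [← det_mul, hFG, det_one]
  have hadjB : adjugate B = F * adjugate (diagonal d) * G := by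
    rw [hB, adjugate_mul_distrib, adjugate_mul_distrib, hG, hF]
    simp only [Matrix.smul_mul, Matrix.mul_smul, smul_smul, hdet, one_smul, mul_assoc]
  have hminor := adjugate_fin_succ_eq_det_submatrix B (Fin.last (2 * t)) (Fin.last (2 * t))
  rw [← two_mul, (even_two_mul _).neg_one_pow, one_mul] at hminor
  have hsub : B.submatrix (Fin.last (2 * t)).succAbove (Fin.last (2 * t)).succAbove =
      of fun j k : Fin (2 * t) =>
        2 * ζ ^ ((j : ℤ) - (k : ℤ)) / (1 - ζ ^ ((j : ℤ) - (k : ℤ))) := by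
    ext j k
    simp [B]
  rw [← hsub, ← hminor, hadjB, hadj, mul_apply, sum_eq_single c]
  · rw [mul_diagonal, Pi.single_eq_same, mul_right_comm, hterm]
    simp
    ring
  · intro r _ hr
    simp [hr]
  · simp

end IsPrimitiveRoot

/- For an odd integer `n > 1` and `ζ` a primitive `n`-th root of unity in `ℂ`, the permanent
of the `(n-1) × (n-1)` matrix with entries `(1 + ζ^{j-k})/(1 - ζ^{j-k})` off the diagonal
and `1` on the diagonal equals `((n-1)!!)^2 / n`. -/
theorem permanent_root_of_unity_matrix_odd (n : ℕ) (hn : 1 < n) (hodd : Odd n)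
    (ζ : ℂ) (hζ : IsPrimitiveRoot ζ n) :
    Matrix.permanent (Matrix.of fun j k : Fin (n - 1) =>
        if j = k then (1 : ℂ)
        else (1 + ζ ^ ((j : ℤ) - (k : ℤ))) / (1 - ζ ^ ((j : ℤ) - (k : ℤ)))) =
      (Nat.doubleFactorial (n - 1) : ℂ) ^ 2 / n := by
  obtain ⟨t, rfl⟩ := hodd
  rw [(hζ.isSkewCoth (Nat.sub_le _ 1)).permanent_eq_det (m := t) (by simp)]
  have h : (Matrix.of fun j k : Fin (2 * t) => (Matrix.of fun j k : Fin (2 * t) =>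
      if j = k then (1 : ℂ)
      else (1 + ζ ^ ((j : ℤ) - (k : ℤ))) / (1 - ζ ^ ((j : ℤ) - (k : ℤ)))) j k - 1) =
      Matrix.of fun j k : Fin (2 * t) =>
        2 * ζ ^ ((j : ℤ) - (k : ℤ)) / (1 - ζ ^ ((j : ℤ) - (k : ℤ))) := by
    ext j k
    rcases eq_or_ne j k with rfl | hjk
    · simp
    · have := sub_ne_zero.2 (hζ.zpow_sub_ne_one (j.2.trans (by omega)) (k.2.trans (by omega))
        (Fin.val_injective.ne hjk)).symm
      simp only [Matrix.of_apply, if_neg hjk]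
      field_simp
      ring
  refine (congrArg (fun M => (-1) ^ t * M.det) h).trans ?_
  simp only [hζ.det_two_mul_div_one_sub, Nat.add_sub_cancel]
  rw [← mul_div_assoc, ← mul_assoc, ← mul_pow]
  simp
end

section
/- For any integer n > 2 and pairwise distinct elements x_1,...,x_n of a field of characteristic 0, Σ over all n-cycles τ in S_n of Π_{j=1}^n 1/(x_{τ(j)} - x_j) = 0. -/
open Equiv Finset

/-- An equivalence relation relating each point to its image relates all points of a cycle. -/
theorem Equiv.Perm.SameCycle.rel_of_rel_apply {α : Type*} {τ : Perm α} {r : α → α → Prop}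
    (hr : Equivalence r) (h : ∀ a, r a (τ a)) {a b : α} (hab : τ.SameCycle a b) : r a b := by
  obtain ⟨k, rfl⟩ := hab
  induction k using Int.induction_on with
  | zero => exact hr.refl a
  | succ k ih =>
    rw [add_comm, zpow_add, zpow_one, Perm.mul_apply]
    exact hr.trans ih (h _)
  | pred k ih =>
    refine hr.trans ih (hr.symm ?_)
    have := h ((τ ^ (-(k : ℤ) - 1)) a)
    rwa [← Perm.mul_apply, ← zpow_one_add, add_sub_cancel] at this

theorem Equiv.Perm.sameCycle_equivalence {α : Type*} (τ : Perm α) : Equivalence τ.SameCycle :=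
  ⟨Perm.SameCycle.refl τ, Perm.SameCycle.symm, Perm.SameCycle.trans⟩

theorem Equiv.Perm.isCycle_and_support_eq_univ_iff {α : Type*} [Fintype α] [DecidableEq α]
    [Nontrivial α] (τ : Perm α) :
    τ.IsCycle ∧ τ.support = univ ↔ ∀ a b, τ.SameCycle a b := by
  constructor
  · rintro ⟨hc, hs⟩ a b
    have hmoved (c : α) : τ c ≠ c := Perm.mem_support.1 (hs ▸ mem_univ c)
    exact hc.sameCycle (hmoved a) (hmoved b)
  · intro h
    have hmoved (c : α) : τ c ≠ c := by
      intro hc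
      obtain ⟨d, hd⟩ := exists_ne c
      exact hd ((h c d).eq_of_left hc).symm
    obtain ⟨a⟩ := (inferInstance : Nonempty α)
    exact ⟨⟨a, hmoved a, fun b _ => h a b⟩, by ext c; simp [hmoved c]⟩

section InsertNone

variable {α : Type*} [DecidableEq α] (σ : Perm α) (b : α)

theorem swap_none_some_mul_optionCongr_apply_some (j : α) :
    (swap none (some b) * optionCongr σ) (some j) = if σ j = b then none else some (σ j) := by
  rw [Perm.mul_apply, optionCongr_apply, Option.map_some]
  split_ifs with h
  · rw [h, swap_apply_right]
  · exact swap_apply_of_ne_of_ne (by simp) (by simpa using h)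

theorem swap_none_some_mul_optionCongr_apply_none :
    (swap none (some b) * optionCongr σ) none = some b := by
  simp

/-- Inserting a new point into a permutation preserves and reflects being a single cycle. -/
theorem sameCycle_swap_none_some_mul_optionCongr_iff :
    (∀ u v, (swap none (some b) * optionCongr σ).SameCycle u v) ↔ ∀ i j, σ.SameCycle i j := by
  have hnone := swap_none_some_mul_optionCongr_apply_none σ b
  have hsome := swap_none_some_mul_optionCongr_apply_some σ b
  set τ := swap none (some b) * optionCongr σ
  constructor
  · intro h i j
    refine (h (some i) (some j)).rel_of_rel_apply
      (r := fun u v => σ.SameCycle (u.getD b) (v.getD b))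
      (σ.sameCycle_equivalence.comap fun u : Option α => u.getD b) ?_
    rintro (_ | k)
    · rw [hnone]
      exact Perm.SameCycle.refl _ _
    · rw [hsome]
      split_ifs with hk
      · exact ⟨1, by simpa using hk⟩
      · exact ⟨1, by simp⟩
  · intro h
    have hb : τ.SameCycle none (some b) := ⟨1, by simpa using hnone⟩
    have hstep (k : α) : τ.SameCycle (some k) (some (σ k)) := by
      have hk : τ.SameCycle (some k) (τ (some k)) := ⟨1, by simp⟩
      rw [hsome] at hk
      split_ifs at hk with hkb
      · exact hkb ▸ hk.trans hb
      · exact hk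
    have hfrom (u : Option α) : τ.SameCycle u (some b) := by
      rcases u with _ | i
      · exact hb
      · exact (h i b).rel_of_rel_apply (r := fun i j => τ.SameCycle (some i) (some j))
          (τ.sameCycle_equivalence.comap some) hstep
    exact fun u v => (hfrom u).trans (hfrom v).symm

end InsertNone

section Weights

variable {F α : Type*} [Field F] [Fintype α] [DecidableEq α]

theorem prod_inv_sub_swap_none_some_mul_optionCongr {x : Option α → F}
    (hx : Function.Injective x) {σ : Perm α} (hσ : ∀ j, σ j ≠ j) (i : α) :
    ∏ u, (x ((swap none (some (σ i)) * optionCongr σ) u) - x u)⁻¹ =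
      (∏ j, (x (some (σ j)) - x (some j))⁻¹) *
        ((x none - x (some i))⁻¹ - (x none - x (some (σ i)))⁻¹) := by
  have hrest : ∏ j ∈ univ.erase i,
        (x ((swap none (some (σ i)) * optionCongr σ) (some j)) - x (some j))⁻¹ =
      ∏ j ∈ univ.erase i, (x (some (σ j)) - x (some j))⁻¹ := by
    refine prod_congr rfl fun j hj => ?_
    rw [swap_none_some_mul_optionCongr_apply_some,
      if_neg (σ.injective.ne (ne_of_mem_erase hj))]
  rw [Fintype.prod_option, swap_none_some_mul_optionCongr_apply_none,
    ← mul_prod_erase univ _ (mem_univ i), hrest, swap_none_some_mul_optionCongr_apply_some,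
    if_pos rfl, ← mul_prod_erase univ (fun j => (x (some (σ j)) - x (some j))⁻¹) (mem_univ i)]
  have h₁ : x (some (σ i)) - x none ≠ 0 := sub_ne_zero.2 (hx.ne (by simp))
  have h₂ : x none - x (some (σ i)) ≠ 0 := sub_ne_zero.2 (hx.ne (by simp))
  have h₃ : x none - x (some i) ≠ 0 := sub_ne_zero.2 (hx.ne (by simp))
  have h₄ : x (some (σ i)) - x (some i) ≠ 0 := sub_ne_zero.2 (hx.ne (by simpa using hσ i))
  have hpartial : (x (some (σ i)) - x none)⁻¹ * (x none - x (some i))⁻¹ =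
      (x (some (σ i)) - x (some i))⁻¹ *
        ((x none - x (some i))⁻¹ - (x none - x (some (σ i)))⁻¹) := by
    rw [← neg_sub (x none) (x (some (σ i)))] at h₁ ⊢
    field_simp
    ring
  linear_combination (∏ j ∈ univ.erase i, (x (some (σ j)) - x (some j))⁻¹) * hpartial

theorem sum_prod_inv_sub_swap_none_some_mul_optionCongr {x : Option α → F}
    (hx : Function.Injective x) {σ : Perm α} (hσ : ∀ j, σ j ≠ j) :
    ∑ b : α, ∏ u, (x ((swap none (some b) * optionCongr σ) u) - x u)⁻¹ = 0 := by
  rw [← Equiv.sum_comp σ]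
  simp_rw [prod_inv_sub_swap_none_some_mul_optionCongr hx hσ]
  rw [← mul_sum, sum_sub_distrib, Equiv.sum_comp σ (fun j => (x none - x (some j))⁻¹), sub_self,
    mul_zero]

open scoped Classical in
theorem sum_sameCycle_prod_inv_sub_option_eq_zero [Nontrivial α] {x : Option α → F}
    (hx : Function.Injective x) :
    ∑ τ : Perm (Option α),
      (if ∀ u v, τ.SameCycle u v then ∏ u, (x (τ u) - x u)⁻¹ else 0) = 0 := by
  rw [← Equiv.sum_comp Perm.decomposeOption.symm, Fintype.sum_prod_type_right]
  refine sum_eq_zero fun σ _ => ?_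
  rw [Fintype.sum_option]
  simp only [Perm.decomposeOption_symm_apply]
  have hnone : ¬ ∀ u v, (swap none none * optionCongr σ).SameCycle u v := by
    intro h
    obtain ⟨a⟩ := (inferInstance : Nonempty α)
    exact Option.some_ne_none a ((h none (some a)).eq_of_left (by simp [Function.IsFixedPt])).symm
  rw [if_neg hnone, zero_add]
  simp only [sameCycle_swap_none_some_mul_optionCongr_iff]
  split_ifs with h
  · refine sum_prod_inv_sub_swap_none_some_mul_optionCongr hx fun j hj => ?_
    obtain ⟨k, hk⟩ := exists_ne j
    exact hk ((h j k).eq_of_left hj).symm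
  · exact sum_const_zero

end Weights

/- For any integer `n > 2` and pairwise distinct `x_1, …, x_n` in a field of
characteristic zero, the sum over all `n`-cycles `τ` in `S_n` of
`∏_{j=1}^n 1 / (x_{τ(j)} - x_j)` vanishes. -/
open scoped Classical in
theorem sum_cycles_prod_inv_sub_eq_zero {F : Type*} [Field F] [CharZero F]
    (n : ℕ) (hn : 2 < n) (x : Fin n → F) (hx : Function.Injective x) :
    ∑ τ ∈ univ.filter (fun τ : Perm (Fin n) => τ.IsCycle ∧ τ.support = univ),
      ∏ j, (x (τ j) - x j)⁻¹ = 0 := by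
  obtain ⟨m, rfl⟩ : ∃ m, n = m + 1 := ⟨n - 1, by omega⟩
  have : Nontrivial (Fin m) := Fin.nontrivial_iff_two_le.2 (by omega)
  have : Nontrivial (Fin (m + 1)) := Fin.nontrivial_iff_two_le.2 (by omega)
  let e := finSuccEquiv m
  rw [sum_filter]
  refine (Fintype.sum_equiv e.permCongr _ _ fun τ => ?_).trans
    (sum_sameCycle_prod_inv_sub_option_eq_zero (hx.comp e.symm.injective))
  have hcycle : (∀ u v, (e.permCongr τ).SameCycle u v) ↔ ∀ i j, τ.SameCycle i j := by
    have hpow (k : ℤ) : e.permCongr τ ^ k = e.permCongr (τ ^ k) :=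
      (map_zpow e.permCongrHom τ k).symm
    simp only [Perm.SameCycle, hpow, ← e.forall_congr_right, permCongr_apply, symm_apply_apply,
      e.apply_eq_iff_eq]
  rw [← Equiv.prod_comp e]
  simp only [hcycle, Perm.isCycle_and_support_eq_univ_iff, permCongr_apply, symm_apply_apply,
    Function.comp_apply]
end

section
/- Let n > 1 be odd and ζ a primitive n-th root of unity. Then Σ over all derangements τ of {1,...,n-1} of Π_{j=1}^{n-1} 1/(1 - ζ^{j-τ(j)}) = (1/n)·(((n-1)/2)!)^2. -/
open Equiv Finset

/-- The sum over permutations `σ` of `s (sign σ) * ∏ j, (x j - x (σ j))⁻¹`. As `0⁻¹ = 0`, only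
derangements contribute. -/
def derangementSum {K α : Type*} [Field K] [Fintype α] [DecidableEq α]
    (s : ℤˣ →* K) (x : α → K) : K :=
  ∑ σ : Perm α, s (Perm.sign σ) * ∏ j, (x j - x (σ j))⁻¹

theorem sum_fixing_eq_derangementSum {K α : Type*} [Field K] [Fintype α] [DecidableEq α]
    (s : ℤˣ →* K) (x : α → K) (d : α) :
    ∑ σ : Perm α with σ d = d, s (Perm.sign σ) * ∏ j ∈ univ.erase d, (x j - x (σ j))⁻¹ =
      derangementSum s (fun c : {c // c ≠ d} => x c) := by
  unfold derangementSum
  symm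
  refine sum_bij (fun σ _ => Perm.ofSubtype σ) ?_ ?_ ?_ ?_
  · intro σ _
    simp [Perm.ofSubtype_apply_of_not_mem]
  · intro a _ b _ h
    exact Perm.ofSubtype_injective h
  · intro τ hτ
    simp only [mem_filter, mem_univ, true_and] at hτ
    refine ⟨τ.subtypePerm (p := fun c => c ≠ d) ?_, mem_univ _, ?_⟩
    · intro c
      rw [not_iff_not]
      constructor
      · intro h
        exact τ.injective (h.trans hτ.symm)
      · rintro rfl
        exact hτ
    · apply Perm.ofSubtype_subtypePerm
      rintro c hc rfl
      exact hc hτ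
  · intro σ _
    rw [Perm.sign_ofSubtype]
    congr 1
    rw [← filter_ne', ← prod_subtype_eq_prod_filter]
    simp [Finset.subtype_univ]

/-- The effect on `∏ j, (x j - x (σ j))⁻¹` of inserting `none` between `c` and `σ c`. -/
theorem prod_inv_sub_swap_mul_optionCongr {K α : Type*} [Field K] [Fintype α] [DecidableEq α]
    (x : Option α → K) (hx : Function.Injective x) (σ : Perm α) (c : α) :
    ∏ o, (x o - x ((swap none (some (σ c)) * optionCongr σ) o))⁻¹ =
      ((x (some c) - x none)⁻¹ - (x (some (σ c)) - x none)⁻¹) *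
        ∏ j, (x (some j) - x (some (σ j)))⁻¹ +
      if σ c = c then -((x none - x (some c)) ^ 2)⁻¹ *
        ∏ j ∈ univ.erase c, (x (some j) - x (some (σ j)))⁻¹ else 0 := by
  have hprod : ∏ j ∈ univ.erase c,
      (x (some j) - x ((swap none (some (σ c)) * optionCongr σ) (some j)))⁻¹ =
      ∏ j ∈ univ.erase c, (x (some j) - x (some (σ j)))⁻¹ := by
    refine prod_congr rfl fun j hj => ?_
    have hj : j ≠ c := ne_of_mem_erase hj
    rw [Perm.mul_apply, optionCongr_apply, Option.map_some, swap_apply_of_ne_of_ne] <;> simp [hj]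
  have h1 : ∀ j, x (some j) - x none ≠ 0 := fun j => sub_ne_zero.2 (hx.ne (by simp))
  rw [Fintype.prod_option, ← mul_prod_erase univ _ (mem_univ c), hprod,
    ← mul_prod_erase univ (fun j => (x (some j) - x (some (σ j)))⁻¹) (mem_univ c)]
  simp only [Perm.mul_apply, optionCongr_apply, Option.map_some, Option.map_none,
    swap_apply_left, swap_apply_right]
  have h2 : ∀ j, x none - x (some j) ≠ 0 := fun j => sub_ne_zero.2 (hx.ne (by simp))
  have h3 := h1 c
  have h4 := h2 c
  have h5 := h1 (σ c)
  have h6 := h2 (σ c)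
  split_ifs with h
  · rw [h, sub_self, zero_mul, zero_add, ← mul_assoc]
    congr 1
    field_simp
    ring
  · have h7 : x (some c) - x (some (σ c)) ≠ 0 :=
      sub_ne_zero.2 (hx.ne (by simpa using Ne.symm h))
    rw [add_zero, ← mul_assoc, ← mul_assoc]
    congr 1
    field_simp
    ring

/-- Expansion along one index: cycles of length at least three cancel, so that only the
transpositions of `none` with some `d` contribute. -/
theorem derangementSum_option {K α : Type*} [Field K] [Fintype α] [DecidableEq α]
    (s : ℤˣ →* K) (x : Option α → K) (hx : Function.Injective x) :
    derangementSum s x = s (-1) * ∑ d : α, -((x none - x (some d)) ^ 2)⁻¹ *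
      derangementSum s (fun c : {c // c ≠ d} => x (some c)) := by
  have key : ∀ σ : Perm α,
      ∑ d, ∏ o, (x o - x ((swap none (some d) * optionCongr σ : Perm (Option α)) o))⁻¹ =
      ∑ c, if σ c = c then -((x none - x (some c)) ^ 2)⁻¹ *
        ∏ j ∈ univ.erase c, (x (some j) - x (some (σ j)))⁻¹ else 0 := by
    intro σ
    rw [← Equiv.sum_comp σ]
    simp_rw [prod_inv_sub_swap_mul_optionCongr x hx σ, sum_add_distrib, ← sum_mul, sum_sub_distrib]
    rw [Equiv.sum_comp σ (fun c => (x (some c) - x none)⁻¹)]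
    simp
  simp_rw [← fun d => sum_fixing_eq_derangementSum s (fun c => x (some c)) d]
  unfold derangementSum
  rw [← Equiv.sum_comp Perm.decomposeOption.symm, Fintype.sum_prod_type, Fintype.sum_option]
  simp only [Perm.decomposeOption_symm_apply]
  rw [sum_eq_zero, zero_add, sum_comm]
  · simp only [optionCongr_sign, map_mul]
    have : ∀ d : α, Perm.sign (swap none (some d)) = -1 := fun d => Perm.sign_swap (by simp)
    simp_rw [this, mul_assoc, ← mul_sum, key, mul_sum, sum_filter]
    rw [sum_comm]
    refine sum_congr rfl fun d _ => sum_congr rfl fun σ _ => ?_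
    split_ifs
    · ring
    · simp
  · intro σ _
    rw [Fintype.prod_option]
    simp

theorem derangementSum_congr {K α β : Type*} [Field K] [Fintype α] [DecidableEq α]
    [Fintype β] [DecidableEq β] (s : ℤˣ →* K) (e : α ≃ β) (x : β → K) :
    derangementSum s (x ∘ e) = derangementSum s x := by
  unfold derangementSum
  rw [← Equiv.sum_comp e.permCongr]
  refine sum_congr rfl fun σ _ => ?_
  rw [Perm.sign_permCongr, ← Equiv.prod_comp e]
  simp

theorem derangementSum_eq_pow_mul {K : Type*} [Field K] (s : ℤˣ →* K) (k : ℕ) :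
    ∀ {α : Type} [Fintype α] [DecidableEq α] (x : α → K), Function.Injective x →
      Fintype.card α = 2 * k → derangementSum s x = s (-1) ^ k * derangementSum 1 x := by
  induction k with
  | zero =>
    intro α _ _ x _ hc
    have : IsEmpty α := Fintype.card_eq_zero_iff.1 hc
    simp [derangementSum]
  | succ k ih =>
    intro α _ _ x hx hc
    let e : Option (Fin (2 * k + 1)) ≃ α := Fintype.equivOfCardEq (by simp [hc]; ring)
    have hxe : Function.Injective (x ∘ e) := hx.comp e.injective
    rw [← derangementSum_congr s e, ← derangementSum_congr 1 e, derangementSum_option s _ hxe,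
      derangementSum_option 1 _ hxe, pow_succ', mul_assoc, MonoidHom.one_apply, one_mul]
    refine congrArg (s (-1) * ·) ?_
    rw [mul_sum]
    refine sum_congr rfl fun d _ => ?_
    rw [ih (fun c : {c // c ≠ d} => (x ∘ e) (some c))
      (hxe.comp ((Option.some_injective _).comp Subtype.val_injective))
      (by simp [Fintype.card_subtype_compl])]
    ring

theorem one_sub_mul_sum_sub_mul_pow {K : Type*} [CommRing K] (a w : K) (N : ℕ) :
    (1 - w) * ∑ i ∈ range N, (a - i) * w ^ i =
      a - (a - N) * w ^ N - w * ∑ i ∈ range N, w ^ i := by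
  induction N with
  | zero => simp
  | succ N ih =>
    rw [sum_range_succ, sum_range_succ, mul_add, ih]
    push_cast
    ring

theorem prod_erase_range_sub (m : ℕ) :
    ∏ i ∈ (range (2 * m + 1)).erase m, ((m : ℂ) - i) = (-1) ^ m * (m.factorial : ℂ) ^ 2 := by
  have : (range (2 * m + 1)).erase m = range m ∪ (range m).image (m + 1 + ·) := by
    ext i
    simp only [mem_erase, mem_range, mem_union, mem_image]
    constructor
    · intro h
      by_cases hi : i < m
      · exact Or.inl hi
      · exact Or.inr ⟨i - (m + 1), by omega, by omega⟩
    · rintro (h | ⟨j, h, rfl⟩) <;> omega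
  rw [this, prod_union, prod_image (by intro a _ b _ h; simpa using h)]
  · have h1 : ∏ i ∈ range m, ((m : ℂ) - i) = m.factorial := by
      rw [← prod_range_reflect, ← prod_range_add_one_eq_factorial, Nat.cast_prod]
      refine prod_congr rfl fun i hi => ?_
      have := mem_range.1 hi
      rw [Nat.sub_sub, Nat.cast_sub (by omega)]
      push_cast
      ring
    have h2 : ∏ i ∈ range m, ((m : ℂ) - (m + 1 + i : ℕ)) = (-1) ^ m * m.factorial := by
      rw [← prod_range_add_one_eq_factorial, Nat.cast_prod]
      rw [show (-1 : ℂ) ^ m = ∏ _i ∈ range m, (-1) by simp, ← prod_mul_distrib]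
      refine prod_congr rfl fun i hi => ?_
      push_cast
      ring
    rw [h1, h2]
    ring
  · rw [disjoint_left]
    simp only [mem_range, mem_image]
    rintro a h ⟨j, _, rfl⟩
    omega

theorem inv_mul_sum_sub_mul_pow (m : ℕ) (w : ℂ) (hw : w ^ (2 * m + 1) = 1) :
    ((2 * m + 1 : ℕ) : ℂ)⁻¹ * ∑ i ∈ range (2 * m + 1), ((m : ℂ) - i) * w ^ i = (1 - w)⁻¹ := by
  by_cases h : w = 1
  · subst h
    have : ∑ i ∈ range (2 * m + 1), ((m : ℂ) - i) = 0 := by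
      have h2 : ∀ N : ℕ, 2 * ∑ i ∈ range N, ((m : ℂ) - i) = N * (2 * m + 1 - N) := by
        intro N
        induction N with
        | zero => simp
        | succ N ih =>
          rw [sum_range_succ, mul_add, ih]
          push_cast
          ring
      have h3 := h2 (2 * m + 1)
      push_cast at h3
      simpa using h3
    simp [this]
  · have h1 : 1 - w ≠ 0 := sub_ne_zero.2 (Ne.symm h)
    have h0 : ∑ i ∈ range (2 * m + 1), w ^ i = 0 := by
      have := mul_neg_geom_sum w (2 * m + 1)
      rw [hw, sub_self] at this
      exact (mul_eq_zero.1 this).resolve_left h1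
    have key := one_sub_mul_sum_sub_mul_pow (m : ℂ) w (2 * m + 1)
    rw [hw, h0] at key
    have hN : ((2 * m + 1 : ℕ) : ℂ) ≠ 0 := by exact_mod_cast Nat.succ_ne_zero (2 * m)
    rw [← mul_right_inj' h1, mul_left_comm, key, mul_inv_cancel₀ h1, inv_mul_eq_one₀ hN]
    push_cast
    ring

/-- The principal minor of the circulant matrix with entries `(1 - ζ ^ (j - k))⁻¹`, whose eigenvalues
are the integers `m, m - 1, …, -m`. -/
theorem det_inv_one_sub_zpow (m : ℕ) (ζ : ℂ) (hζ : IsPrimitiveRoot ζ (2 * m + 1)) :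
    (Matrix.of fun j k : Fin (2 * m) => (1 - ζ ^ ((j : ℤ) - (k : ℤ)))⁻¹).det =
      ((2 * m + 1 : ℕ) : ℂ)⁻¹ * ((-1) ^ m * (m.factorial : ℂ) ^ 2) := by
  have hζ0 : ζ ≠ 0 := hζ.ne_zero (Nat.succ_ne_zero _)
  have hN : ((2 * m + 1 : ℕ) : ℂ) ≠ 0 := by exact_mod_cast Nat.succ_ne_zero (2 * m)
  have hpow : ∀ r : ℤ, (ζ ^ r) ^ (2 * m + 1) = 1 := fun r => by
    rw [← zpow_natCast, zpow_comm, zpow_natCast, hζ.pow_eq_one, one_zpow]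
  let V : Matrix (Fin (2 * m + 1)) (Fin (2 * m + 1)) ℂ :=
    Matrix.of fun j s => (ζ ^ (j : ℤ)) ^ (s : ℕ)
  let W : Matrix (Fin (2 * m + 1)) (Fin (2 * m + 1)) ℂ :=
    Matrix.of fun s k => ((2 * m + 1 : ℕ) : ℂ)⁻¹ * (ζ ^ (-(k : ℤ))) ^ (s : ℕ)
  let v : Fin (2 * m + 1) → ℂ := fun s => (m : ℂ) - (s : ℕ)
  have hVW : V * W = 1 := by
    ext j k
    have : (V * W) j k = ((2 * m + 1 : ℕ) : ℂ)⁻¹ *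
        ∑ i ∈ range (2 * m + 1), (ζ ^ ((j : ℤ) - k)) ^ i := by
      rw [Matrix.mul_apply, mul_sum, ← Fin.sum_univ_eq_sum_range (fun i =>
        ((2 * m + 1 : ℕ) : ℂ)⁻¹ * (ζ ^ ((j : ℤ) - k)) ^ i)]
      refine sum_congr rfl fun i _ => ?_
      simp only [V, W, Matrix.of_apply]
      rw [sub_eq_add_neg, zpow_add₀ hζ0, mul_pow]
      ring
    rw [this, Matrix.one_apply]
    split_ifs with h
    · subst h
      simp only [sub_self, zpow_zero, one_pow, sum_const, card_range, nsmul_eq_mul, mul_one]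
      exact inv_mul_cancel₀ hN
    · have h1 : 1 - ζ ^ ((j : ℤ) - k) ≠ 0 := by
        rw [sub_ne_zero, ne_comm, Ne, hζ.zpow_eq_one_iff_dvd]
        intro hd
        apply h
        have := Int.eq_zero_of_abs_lt_dvd hd (by rw [abs_lt]; constructor <;> (push_cast; omega))
        ext
        omega
      have := mul_neg_geom_sum (ζ ^ ((j : ℤ) - k)) (2 * m + 1)
      rw [hpow, sub_self] at this
      rw [(mul_eq_zero.1 this).resolve_left h1, mul_zero]
  have hC : V * Matrix.diagonal v * W =
      Matrix.of fun j k : Fin (2 * m + 1) => (1 - ζ ^ ((j : ℤ) - (k : ℤ)))⁻¹ := by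
    ext j k
    rw [Matrix.of_apply, ← inv_mul_sum_sub_mul_pow m _ (hpow _), Matrix.mul_apply, mul_sum,
      ← Fin.sum_univ_eq_sum_range (fun i =>
        ((2 * m + 1 : ℕ) : ℂ)⁻¹ * (((m : ℂ) - i) * (ζ ^ ((j : ℤ) - k)) ^ i))]
    refine sum_congr rfl fun i _ => ?_
    rw [Matrix.mul_diagonal]
    simp only [V, W, v, Matrix.of_apply]
    rw [sub_eq_add_neg (j : ℤ), zpow_add₀ hζ0, mul_pow]
    ring
  have hdet : W.det * V.det = 1 := by
    rw [mul_comm, ← Matrix.det_mul, hVW, Matrix.det_one]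
  have hV : V.adjugate = V.det • W := by
    rw [← mul_one V.adjugate, ← hVW, ← mul_assoc, Matrix.adjugate_mul, Matrix.smul_mul, one_mul]
  have hW : W.adjugate = W.det • V := by
    rw [← one_mul W.adjugate, ← hVW, mul_assoc, Matrix.mul_adjugate, Matrix.mul_smul, mul_one]
  have hadj : (V * Matrix.diagonal v * W).adjugate = V * (Matrix.diagonal v).adjugate * W := by
    rw [Matrix.adjugate_mul_distrib, Matrix.adjugate_mul_distrib, hV, hW, Matrix.mul_smul,
      Matrix.mul_smul, Matrix.smul_mul, smul_smul, mul_comm V.det, hdet, one_smul,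
      mul_assoc]
  have h00 := congrFun (congrFun hadj 0) 0
  rw [hC, Matrix.adjugate_fin_succ_eq_det_submatrix, Matrix.adjugate_diagonal, Matrix.mul_apply,
    sum_eq_single (⟨m, by omega⟩ : Fin (2 * m + 1))] at h00
  · rw [Matrix.mul_diagonal] at h00
    have hprod : ∏ j ∈ univ.erase (⟨m, by omega⟩ : Fin (2 * m + 1)), v j =
        (-1) ^ m * (m.factorial : ℂ) ^ 2 := by
      rw [← prod_erase_range_sub]
      refine prod_bij (fun i _ => (i : ℕ)) ?_ ?_ ?_ ?_
      · intro i hi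
        simpa [Fin.ext_iff, -Order.lt_add_one_iff] using hi
      · intro a _ b _ h
        exact Fin.ext h
      · intro b hb
        simp only [mem_erase, mem_range] at hb
        exact ⟨⟨b, hb.2⟩, by simpa [Fin.ext_iff] using hb.1, rfl⟩
      · intro i _
        rfl
    rw [hprod] at h00
    simp only [V, W, Matrix.of_apply, Fin.val_zero, add_zero, pow_zero, one_mul, Nat.cast_zero,
      zpow_zero, one_pow, neg_zero, mul_one] at h00
    rw [mul_comm _ ((-1) ^ m * (m.factorial : ℂ) ^ 2), ← h00]
    congr 1
    ext j k
    simp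
  · intro s _ hs
    rw [Matrix.mul_diagonal, prod_eq_zero (mem_erase.2 ⟨Ne.symm hs, mem_univ _⟩) (by simp [v])]
    simp
  · simp

theorem sum_sign_mul_prod_inv_one_sub_zpow {n : ℕ} (s : ℤˣ →* ℂ) (ζ : ℂ) (hζ0 : ζ ≠ 0) :
    ∑ σ : Perm (Fin n), s (Perm.sign σ) * ∏ j : Fin n, (1 - ζ ^ ((j : ℤ) - (σ j : ℤ)))⁻¹ =
      (∏ j : Fin n, ζ ^ (j : ℕ)) * derangementSum s (fun j : Fin n => -ζ ^ (j : ℕ)) := by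
  unfold derangementSum
  rw [mul_sum]
  refine sum_congr rfl fun σ _ => ?_
  rw [← Equiv.prod_comp σ (fun j => ζ ^ (j : ℕ)), mul_left_comm, ← prod_mul_distrib]
  congr 1
  refine prod_congr rfl fun j _ => ?_
  rw [zpow_sub₀ hζ0, zpow_natCast, zpow_natCast]
  have h := pow_ne_zero (σ j : ℕ) hζ0
  rw [one_sub_div h, inv_div, div_eq_mul_inv]
  congr 2
  ring

/- For an odd integer `n > 1` and `ζ` a primitive `n`-th root of unity in `ℂ`,
`∑_{τ derangement of {1,…,n-1}} ∏_{j=1}^{n-1} 1/(1 - ζ^{j-τ(j)}) = (((n-1)/2)!)^2 / n`. -/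
theorem sum_derangements_odd (n : ℕ) (hn : 1 < n) (hodd : Odd n)
    (ζ : ℂ) (hζ : IsPrimitiveRoot ζ n) :
    ∑ τ ∈ univ.filter (fun τ : Perm (Fin (n - 1)) => ∀ j, τ j ≠ j),
        ∏ j : Fin (n - 1), (1 - ζ ^ ((j : ℤ) - (τ j : ℤ)))⁻¹ =
      (1 / (n : ℂ)) * (((n - 1) / 2).factorial : ℂ) ^ 2 := by
  obtain ⟨m, rfl⟩ := hodd
  have hζ0 : ζ ≠ 0 := hζ.ne_zero (Nat.succ_ne_zero _)
  rw [sum_filter_of_ne]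
  · simp only [Nat.add_sub_cancel, Nat.mul_div_cancel_left m two_pos]
    let s : ℤˣ →* ℂ := (Int.castRingHom ℂ : ℤ →* ℂ).comp (Units.coeHom ℤ)
    have hs : s (-1) = -1 := by simp [s]
    have hinj : Function.Injective (fun j : Fin (2 * m) => -ζ ^ (j : ℕ)) := by
      intro a b h
      exact Fin.ext (hζ.pow_inj (by omega) (by omega) (neg_injective h))
    have hper := sum_sign_mul_prod_inv_one_sub_zpow (n := 2 * m) 1 ζ hζ0
    have hdet := sum_sign_mul_prod_inv_one_sub_zpow (n := 2 * m) s ζ hζ0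
    have hM : ∑ σ : Perm (Fin (2 * m)), s (Perm.sign σ) *
        ∏ j : Fin (2 * m), (1 - ζ ^ ((j : ℤ) - (σ j : ℤ)))⁻¹ =
        ((2 * m + 1 : ℕ) : ℂ)⁻¹ * ((-1) ^ m * (m.factorial : ℂ) ^ 2) := by
      rw [← det_inv_one_sub_zpow m ζ hζ, ← Matrix.det_transpose, Matrix.det_apply']
      rfl
    rw [hM, derangementSum_eq_pow_mul s m _ hinj (by simp), hs, mul_left_comm,
      mul_left_comm (∏ j : Fin (2 * m), ζ ^ (j : ℕ)), ← hper] at hdet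
    simp only [MonoidHom.one_apply, one_mul] at hdet
    rw [one_div]
    exact (mul_left_cancel₀ (pow_ne_zero m (by norm_num)) hdet).symm
  · intro τ _ h j hj
    exact h (prod_eq_zero (mem_univ j) (by simp [hj]))
end

section
/- For pairwise distinct nonzero x_1, x_2, x_3, x_4 in a field of characteristic 0, the permanent of the 4×4 matrix with entries (x_j+x_k)/(x_j-x_k) off-diagonal and 1 on the diagonal equals 16·x_1x_2x_3x_4·(1/((x_1-x_2)^2(x_3-x_4)^2) + 1/((x_1-x_3)^2(x_2-x_4)^2) + 1/((x_1-x_4)^2(x_2-x_3)^2)). -/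
open Equiv Finset

/-- The three Hamiltonian cycle products of the ratios `(x + y) / (x - y)` on four points
sum to `1`. -/
lemma sum_four_cycle_ratio {F : Type*} [Field F] {a b c d : F}
    (hab : a - b ≠ 0) (hac : a - c ≠ 0) (had : a - d ≠ 0)
    (hbc : b - c ≠ 0) (hbd : b - d ≠ 0) (hcd : c - d ≠ 0) :
    -((a + b) / (a - b) * ((b + c) / (b - c)) * ((c + d) / (c - d)) * ((a + d) / (a - d))) +
      (a + b) / (a - b) * ((b + d) / (b - d)) * ((c + d) / (c - d)) * ((a + c) / (a - c)) +
      (a + c) / (a - c) * ((b + c) / (b - c)) * ((b + d) / (b - d)) * ((a + d) / (a - d)) = 1 := by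
  field_simp
  ring

/-- The ratio `t = (a + b) / (a - b)` satisfies `t ^ 2 - 1 = 4 a b / (a - b) ^ 2`. -/
lemma ratio_sq_sub_one {F : Type*} [Field F] {a b : F} (hab : a - b ≠ 0) :
    ((a + b) / (a - b)) ^ 2 - 1 = 4 * (a * b) * ((a - b) ^ 2)⁻¹ := by
  field_simp
  ring

/-- The ratio `(a + b) / (a - b)` is antisymmetric. -/
lemma ratio_swap {F : Type*} [Field F] (a b : F) :
    (b + a) / (b - a) = -((a + b) / (a - b)) := by
  rw [← neg_sub a b, div_neg, add_comm]

/-- The permanent of a `4 × 4` matrix with unit diagonal and antisymmetric off-diagonal part. -/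
lemma permanent_one_add_antisymm_four {R : Type*} [CommRing R] (A : Matrix (Fin 4) (Fin 4) R)
    (hd : ∀ i, A i i = 1) (hs : ∀ i j, i < j → A j i = -A i j) :
    A.permanent = 1 - (A 0 1 ^ 2 + A 0 2 ^ 2 + A 0 3 ^ 2 + A 1 2 ^ 2 + A 1 3 ^ 2 + A 2 3 ^ 2) +
      (A 0 1 ^ 2 * A 2 3 ^ 2 + A 0 2 ^ 2 * A 1 3 ^ 2 + A 0 3 ^ 2 * A 1 2 ^ 2) +
      2 * (-(A 0 1 * A 1 2 * A 2 3 * A 0 3) + A 0 1 * A 1 3 * A 2 3 * A 0 2 +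
        A 0 2 * A 1 2 * A 1 3 * A 0 3) := by
  simp only [Matrix.permanent, Finset.univ_perm_fin_succ, Finset.sum_map, Fintype.sum_prod_type,
    Fin.sum_univ_succ, Fin.prod_univ_succ, Equiv.coe_toEmbedding,
    Perm.decomposeFin_symm_apply_zero, Perm.decomposeFin_symm_apply_succ, swap_apply_def,
    Finset.univ_unique, Finset.sum_singleton, Finset.prod_singleton, Perm.default_eq]
  simp [Fin.ext_iff, hd]
  rw [hs 0 1 (by decide), hs 0 2 (by decide), hs 0 3 (by decide), hs 1 2 (by decide),
    hs 1 3 (by decide), hs 2 3 (by decide)]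
  ring

/- For pairwise distinct `x_1, x_2, x_3, x_4` in a field of characteristic zero, the permanent
of the `4 × 4` matrix with entries `(x_j + x_k)/(x_j - x_k)` off the diagonal and `1` on the
diagonal equals
`16 x_1 x_2 x_3 x_4 (1/((x_1-x_2)^2 (x_3-x_4)^2) + 1/((x_1-x_3)^2 (x_2-x_4)^2)
  + 1/((x_1-x_4)^2 (x_2-x_3)^2))`. -/
theorem permanent_ratio_matrix_four {F : Type*} [Field F] [CharZero F]
    (x : Fin 4 → F) (hx : Function.Injective x) :
    Matrix.permanent (Matrix.of fun j k : Fin 4 =>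
        if j = k then (1 : F) else (x j + x k) / (x j - x k)) =
      16 * (x 0 * x 1 * x 2 * x 3) *
        (((x 0 - x 1) ^ 2 * (x 2 - x 3) ^ 2)⁻¹ +
          ((x 0 - x 2) ^ 2 * (x 1 - x 3) ^ 2)⁻¹ +
          ((x 0 - x 3) ^ 2 * (x 1 - x 2) ^ 2)⁻¹) := by
  have h {i j : Fin 4} (hij : i ≠ j) : x i - x j ≠ 0 := sub_ne_zero.2 (hx.ne hij)
  have h01 : x 0 - x 1 ≠ 0 := h (by decide)
  have h02 : x 0 - x 2 ≠ 0 := h (by decide)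
  have h03 : x 0 - x 3 ≠ 0 := h (by decide)
  have h12 : x 1 - x 2 ≠ 0 := h (by decide)
  have h13 : x 1 - x 3 ≠ 0 := h (by decide)
  have h23 : x 2 - x 3 ≠ 0 := h (by decide)
  rw [permanent_one_add_antisymm_four _ (by simp)
    (fun i j hij => by simpa [hij.ne, hij.ne'] using ratio_swap (x i) (x j))]
  have hc := sum_four_cycle_ratio h01 h02 h03 h12 h13 h23
  have e01 := ratio_sq_sub_one h01
  have e02 := ratio_sq_sub_one h02
  have e03 := ratio_sq_sub_one h03
  have e12 := ratio_sq_sub_one h12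
  have e13 := ratio_sq_sub_one h13
  have e23 := ratio_sq_sub_one h23
  simp only [Matrix.of_apply, Fin.reduceEq, if_false, mul_inv]
  generalize (x 0 + x 1) / (x 0 - x 1) = t01 at *
  generalize (x 0 + x 2) / (x 0 - x 2) = t02 at *
  generalize (x 0 + x 3) / (x 0 - x 3) = t03 at *
  generalize (x 1 + x 2) / (x 1 - x 2) = t12 at *
  generalize (x 1 + x 3) / (x 1 - x 3) = t13 at *
  generalize (x 2 + x 3) / (x 2 - x 3) = t23 at *
  have p1 := congrArg₂ (· * ·) e01 e23
  have p2 := congrArg₂ (· * ·) e02 e13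
  have p3 := congrArg₂ (· * ·) e03 e12
  linear_combination p1 + p2 + p3 + 2 * hc
end
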